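/- arXiv:2504.07006 — 3 statements merged into one kernel-verified Lean document; each statement's English description precedes it below -/
import Mathlib

section
/- There exists a constant C > 0 such that the following holds (relative sifting). Let α, ε, γ, τ ∈ (0, 1), let k be a positive integer, and suppose γ ≤ (ατ)^{C·(ε^{-2}·k·(log(2/α))² + ε^{-1}·k·log(2/τ))}. Let Ω₁, Ω₂ be finite nonempty sets, let T ⊆ Ω₁ × Ω₂ be (τ, γ)-combinatorially spread, and let f : Ω₁ × Ω₂ → [0, 1] be a function supported on T (that is, f(x,y) = 0 whenever (x,y) ∉ T). Suppose E_{x₁,x₂ ∈ Ω₁, y₁,…,y_k ∈ Ω₂}[∏_{i=1}^{k} f(x₁, y_i)·f(x₂, y_i)] ≥ α^{2k}·τ^{2k}. Then there exist functions g₁ : Ω₁ → [0, 1] and g₂ : Ω₂ → [0, 1] such that E_{x∈Ω₁, y∈Ω₂}[f(x,y)·g₁(x)·g₂(y)] ≥ (1−ε)·α·τ·E_{x∈Ω₁}[g₁(x)]·E_{y∈Ω₂}[g₂(y)], and moreover E_{x∈Ω₁}[g₁(x)] ≥ (εα/2)^{C·ε^{-1}·k²·log(2/α)} and E_{y∈Ω₂}[g₂(y)]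 ≥ (εα/2)^{C·ε^{-1}·log(2/α)}. -/
/-- A subset `T ⊆ Ω₁ × Ω₂` is `(τ, γ)`-combinatorially spread if its density on every
rectangle is at most `τ` times the density of the rectangle, up to error `γ`
(Definition 3.1 of the paper). -/
def CombinatoriallySpread {Ω₁ Ω₂ : Type*} [Fintype Ω₁] [Fintype Ω₂]
    (T : Set (Ω₁ × Ω₂)) (τ γ : ℝ) : Prop :=
  ∀ (f : Ω₁ → ℝ) (g : Ω₂ → ℝ),
    (∀ x, f x ∈ Set.Icc (0 : ℝ) 1) → (∀ y, g y ∈ Set.Icc (0 : ℝ) 1) →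
    (∑ x : Ω₁, ∑ y : Ω₂, f x * g y * T.indicator (fun _ => (1 : ℝ)) (x, y)) /
        ((Fintype.card Ω₁ : ℝ) * (Fintype.card Ω₂ : ℝ)) ≤
      τ * ((∑ x : Ω₁, f x) / (Fintype.card Ω₁ : ℝ)) *
          ((∑ y : Ω₂, g y) / (Fintype.card Ω₂ : ℝ)) + γ


open Finset BigOperators

section RS
set_option linter.unusedSectionVars false
set_option linter.unusedVariables false
variable {Ω₁ Ω₂ : Type*} [Fintype Ω₁] [Fintype Ω₂] [Nonempty Ω₁] [Nonempty Ω₂]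

lemma rs_mono {ι : Type*} [Fintype ι] {f g : ι → ℝ} (h : ∀ i, f i ≤ g i) :
    𝔼 i, f i ≤ 𝔼 i, g i := Finset.expect_le_expect (fun i _ => h i)

lemma rs_nonneg {ι : Type*} [Fintype ι] {f : ι → ℝ} (h : ∀ i, 0 ≤ f i) :
    0 ≤ 𝔼 i, f i := Finset.expect_nonneg (fun i _ => h i)

lemma rs_le {ι : Type*} [Fintype ι] [Nonempty ι] {f : ι → ℝ} {a : ℝ} (h : ∀ i, f i ≤ a) :
    𝔼 i, f i ≤ a := Finset.expect_le univ_nonempty (fun i _ => h i)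

lemma rs_pow {ι : Type*} [Fintype ι] (f : ι → ℝ) (n : ℕ) :
    (𝔼 i, f i) ^ n = 𝔼 z : Fin n → ι, ∏ i, f (z i) := by
  rw [Finset.expect_pow, Fintype.piFinset_univ]

lemma rs_chain (s : ℕ → ℝ) (q : ℝ) (hq : 0 < q) (k : ℕ) (hk : 0 < k) (h0 : s 0 = 1)
    (h : q ^ k ≤ s k) : ∃ m, m < k ∧ q * s m ≤ s (m + 1) := by
  by_contra hc
  push Not at hc
  have : ∀ j, j < k → s (j + 1) < q ^ (j + 1) := by
    intro j
    induction j with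
    | zero => intro hj; have := hc 0 hj; simpa [h0] using this
    | succ j ih =>
      intro hj
      have h1 := hc _ hj
      have h2 := ih (by omega)
      have : q * s (j + 1) < q * q ^ (j + 1) := by gcongr
      calc _ < _ := h1
        _ < _ := this
        _ = _ := by ring
  obtain ⟨j, rfl⟩ : ∃ j, k = j + 1 := ⟨k - 1, by omega⟩
  exact absurd (this j (by omega)) (not_lt.mpr h)

/-- codegree -/
noncomputable def rsD (f : Ω₁ → Ω₂ → ℝ) (x x' : Ω₁) : ℝ := 𝔼 y, f x y * f x' y

lemma rsD_mem (f : Ω₁ → Ω₂ → ℝ) (hf : ∀ x y, 0 ≤ f x y ∧ f x y ≤ 1) (x x' : Ω₁) :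
    0 ≤ rsD f x x' ∧ rsD f x x' ≤ 1 :=
  ⟨rs_nonneg fun y => mul_nonneg (hf _ _).1 (hf _ _).1,
   rs_le fun y => mul_le_one₀ (hf _ _).2 (hf _ _).1 (hf _ _).2⟩

/-- Splitting off rows with small average. -/
lemma rs_split (D K : Ω₁ → Ω₁ → ℝ) (M ρ : ℝ) (hK : ∀ x x', 0 ≤ K x x' ∧ K x x' ≤ 1)
    (hM : 0 ≤ M) (hρ : 0 ≤ ρ)
    (hDM : ∀ x x', D x x' * K x x' ≤ M * K x x') :
    ∃ K' : Ω₁ → Ω₁ → ℝ, (∀ x x', 0 ≤ K' x x' ∧ K' x x' ≤ 1) ∧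
      (∀ x, 𝔼 x', K' x x' = 0 ∨ ρ ≤ 𝔼 x', K' x x') ∧
      (𝔼 x, 𝔼 x', D x x' * K x x' ≤ (𝔼 x, 𝔼 x', D x x' * K' x x') + M * ρ) ∧
      (𝔼 x, 𝔼 x', K' x x' ≤ 𝔼 x, 𝔼 x', K x x') ∧
      ((𝔼 x, 𝔼 x', K x x') - ρ ≤ 𝔼 x, 𝔼 x', K' x x') := by
  classical
  refine ⟨fun x x' => if ρ ≤ 𝔼 z, K x z then K x x' else 0, ?_, ?_, ?_, ?_, ?_⟩
  · intro x x'
    dsimp only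
    split_ifs
    · exact hK x x'
    · norm_num
  · intro x
    by_cases h : ρ ≤ 𝔼 z, K x z
    · right; simpa [h] using h
    · left; simp [h]
  · have : (𝔼 x, 𝔼 x', D x x' * (if ρ ≤ 𝔼 z, K x z then K x x' else 0)) + M * ρ
        = 𝔼 x, ((𝔼 x', D x x' * (if ρ ≤ 𝔼 z, K x z then K x x' else 0)) + M * ρ) := by
      rw [Finset.expect_add_distrib, Fintype.expect_const]
    rw [this]
    refine rs_mono fun x => ?_
    by_cases h : ρ ≤ 𝔼 z, K x z
    · simp only [h, if_true]
      have := mul_nonneg hM hρ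
      linarith
    · simp only [h, if_false, mul_zero, Finset.expect_const_zero, zero_add]
      calc _ ≤ 𝔼 x', M * K x x' := rs_mono fun x' => hDM x x'
        _ = M * 𝔼 x', K x x' := by rw [Finset.mul_expect]
        _ ≤ M * ρ := by push Not at h; gcongr
  · refine rs_mono fun x => rs_mono fun x' => ?_
    dsimp only
    split_ifs
    · exact le_rfl
    · exact (hK x x').1
  · have : (𝔼 x, 𝔼 x', K x x') - ρ = 𝔼 x, ((𝔼 x', K x x') - ρ) := by
      rw [Finset.expect_sub_distrib, Fintype.expect_const]
    rw [this]
    refine rs_mono fun x => ?_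
    by_cases h : ρ ≤ 𝔼 z, K x z
    · simp only [h, if_true]; linarith
    · simp only [h, if_false, Finset.expect_const_zero]
      push Not at h
      linarith

lemma rs_mid_dense (f : Ω₁ → Ω₂ → ℝ) (hf : ∀ x y, 0 ≤ f x y ∧ f x y ≤ 1)
    (b δ₁ δ₂ ρ : ℝ) (hb : 0 ≤ b) (hδ₂0 : 0 ≤ δ₂) (hδ₂ : δ₂ ≤ 1) (hδ₁ : δ₁ ≤ ρ)
    (hN : ∀ (g₁ : Ω₁ → ℝ) (g₂ : Ω₂ → ℝ), (∀ x, 0 ≤ g₁ x ∧ g₁ x ≤ 1) →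
      (∀ x, 0 ≤ g₂ x ∧ g₂ x ≤ 1) → δ₁ ≤ 𝔼 x, g₁ x → δ₂ ≤ 𝔼 y, g₂ y →
      𝔼 x, 𝔼 y, f x y * g₁ x * g₂ y < b * (𝔼 x, g₁ x) * 𝔼 y, g₂ y)
    (K : Ω₁ → Ω₁ → ℝ) (hK : ∀ x x', 0 ≤ K x x' ∧ K x x' ≤ 1)
    (hκ : ∀ x, 𝔼 x', K x x' = 0 ∨ ρ ≤ 𝔼 x', K x x')
    (hE : ρ ≤ 𝔼 x, 𝔼 x', K x x') :
    𝔼 x, 𝔼 x', rsD f x x' * K x x' ≤ (b ^ 2 + δ₂) * 𝔼 x, 𝔼 x', K x x' := by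
  set κ : Ω₁ → ℝ := fun x => 𝔼 x', K x x' with hκd
  have hκ01 : ∀ x, 0 ≤ κ x ∧ κ x ≤ 1 := fun x =>
    ⟨rs_nonneg fun x' => (hK x x').1, rs_le fun x' => (hK x x').2⟩
  have h1 : ∀ x, 𝔼 x', rsD f x x' * K x x' ≤ b * (𝔼 y, f x y * κ x * 1) + δ₂ * κ x := by
    intro x
    have e1 : 𝔼 x', rsD f x x' * K x x' = 𝔼 x', 𝔼 y, f x' y * K x x' * f x y := by
      refine Finset.expect_congr rfl fun x' _ => ?_
      rw [rsD, Finset.expect_mul]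
      exact Finset.expect_congr rfl fun y _ => by ring
    have e2 : 𝔼 y, f x y * κ x * 1 = κ x * 𝔼 y, f x y := by
      rw [Finset.mul_expect]
      exact Finset.expect_congr rfl fun y _ => by ring
    have e3 : 𝔼 x', 𝔼 y, f x' y * K x x' * f x y ≤ κ x * 𝔼 y, f x y := by
      rw [hκd, Finset.expect_mul_expect]
      refine rs_mono fun x' => rs_mono fun y => ?_
      have := mul_le_mul_of_nonneg_right (hf x' y).2 (mul_nonneg (hK x x').1 (hf x y).1)
      linarith
    have hd0 : 0 ≤ 𝔼 y, f x y := rs_nonneg fun y => (hf x y).1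
    rw [e1, e2]
    rcases hκ x with h | h
    · have h' : κ x = 0 := h
      rw [h'] at e3 ⊢; linarith
    · by_cases hd : δ₂ ≤ 𝔼 y, f x y
      · have := hN (fun x' => K x x') (fun y => f x y) (hK x) (hf x) (hδ₁.trans h) hd
        have h3 := mul_nonneg hδ₂0 (hκ01 x).1
        have : 𝔼 x', 𝔼 y, f x' y * K x x' * f x y < b * κ x * 𝔼 y, f x y := this
        linarith
      · push Not at hd
        have h3 := mul_le_mul_of_nonneg_left hd.le (hκ01 x).1
        have h4 := mul_nonneg hb (mul_nonneg (hκ01 x).1 hd0)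
        linarith
  have h2 := hN κ (fun _ => 1) hκ01 (fun _ => by norm_num) (hδ₁.trans hE)
    (by rw [Fintype.expect_const]; exact hδ₂)
  rw [Fintype.expect_const] at h2
  calc _ ≤ 𝔼 x, (b * (𝔼 y, f x y * κ x * 1) + δ₂ * κ x) := rs_mono h1
    _ = b * (𝔼 x, 𝔼 y, f x y * κ x * 1) + δ₂ * 𝔼 x, κ x := by
      rw [Finset.expect_add_distrib, Finset.mul_expect, Finset.mul_expect]
    _ ≤ b * (b * (𝔼 x, κ x) * 1) + δ₂ * 𝔼 x, κ x := by gcongr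
    _ = _ := by ring

lemma rs_core_dense (f : Ω₁ → Ω₂ → ℝ) (hf : ∀ x y, 0 ≤ f x y ∧ f x y ≤ 1)
    (a e δ₁ δ₂ : ℝ) (k : ℕ) (hk : 0 < k) (ha : 0 < a) (ha1 : a < 1) (he : 0 < e) (he1 : e < 1)
    (hδ₁ : δ₁ ≤ e / 4 * a ^ (2 * k + 2)) (hδ₂0 : 0 ≤ δ₂) (hδ₂ : δ₂ ≤ e / 4 * a ^ 2)
    (hN : ∀ (g₁ : Ω₁ → ℝ) (g₂ : Ω₂ → ℝ), (∀ x, 0 ≤ g₁ x ∧ g₁ x ≤ 1) →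
      (∀ x, 0 ≤ g₂ x ∧ g₂ x ≤ 1) → δ₁ ≤ 𝔼 x, g₁ x → δ₂ ≤ 𝔼 y, g₂ y →
      𝔼 x, 𝔼 y, f x y * g₁ x * g₂ y < ((1 - e) * a) * (𝔼 x, g₁ x) * 𝔼 y, g₂ y)
    (hD : a ^ (2 * k) ≤ 𝔼 x, 𝔼 x', rsD f x x' ^ k) : False := by
  have hD01 := rsD_mem f hf
  obtain ⟨m, hm, hm'⟩ := rs_chain (fun j => 𝔼 x, 𝔼 x', rsD f x x' ^ j) (a ^ 2) (by positivity) k hk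
    (by simp) (by rw [← pow_mul]; exact hD)
  set K : Ω₁ → Ω₁ → ℝ := fun x x' => rsD f x x' ^ m with hKd
  have hK : ∀ x x', 0 ≤ K x x' ∧ K x x' ≤ 1 := fun x x' =>
    ⟨pow_nonneg (hD01 x x').1 _, pow_le_one₀ (hD01 x x').1 (hD01 x x').2⟩
  have hEK : a ^ (2 * k) ≤ 𝔼 x, 𝔼 x', K x x' := hD.trans (rs_mono fun x => rs_mono fun x' =>
    pow_le_pow_of_le_one (hD01 x x').1 (hD01 x x').2 hm.le)
  have hEK0 : 0 < 𝔼 x, 𝔼 x', K x x' := lt_of_lt_of_le (by positivity) hEK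
  set ρ := e / 4 * a ^ (2 * k + 2) with hρ
  have hρ0 : 0 < ρ := by positivity
  have ha2 : a ^ 2 < 1 := by nlinarith
  have hρ2 : ρ ≤ e / 4 * a ^ 2 * 𝔼 x, 𝔼 x', K x x' := by
    calc ρ = e / 4 * a ^ 2 * a ^ (2 * k) := by rw [hρ]; ring
      _ ≤ _ := by gcongr
  obtain ⟨K', hK', hκ', hs, hle, hge⟩ := rs_split (rsD f) K 1 ρ hK (by norm_num) hρ0.le
    (fun x x' => by have := mul_le_mul_of_nonneg_right (hD01 x x').2 (hK x x').1; linarith)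
  set EK := 𝔼 x, 𝔼 x', K x x'
  have h8 : e / 4 * a ^ 2 * EK ≤ EK / 4 := by
    have : e / 4 * a ^ 2 ≤ 1 / 4 := by nlinarith
    nlinarith
  have h1 := rs_mid_dense f hf ((1 - e) * a) δ₁ δ₂ ρ (by nlinarith) hδ₂0 (by nlinarith) hδ₁ hN K' hK' hκ'
    (by linarith)
  have h2 : 𝔼 x, 𝔼 x', rsD f x x' ^ (m + 1) = 𝔼 x, 𝔼 x', rsD f x x' * K x x' :=
    Finset.expect_congr rfl fun x _ => Finset.expect_congr rfl fun x' _ => by rw [hKd]; ring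
  simp only [h2] at hm'
  have h3 : (((1 - e) * a) ^ 2 + δ₂) * (𝔼 x, 𝔼 x', K' x x') ≤ (((1 - e) * a) ^ 2 + δ₂) * EK := by
    gcongr
  have h4 : a ^ 2 * EK ≤ (((1 - e) * a) ^ 2 + δ₂) * EK + e / 4 * a ^ 2 * EK := by
    calc a ^ 2 * EK ≤ _ := hm'
      _ ≤ _ := hs
      _ ≤ _ := by linarith
  have h5 : a ^ 2 ≤ ((1 - e) * a) ^ 2 + δ₂ + e / 4 * a ^ 2 := by
    refine le_of_mul_le_mul_right ?_ hEK0
    linarith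
  have h6 : a ^ 2 ≤ a ^ 2 * ((1 - e) ^ 2 + e / 4 + e / 4) := by nlinarith
  have h7 : (1 - e) ^ 2 + e / 4 + e / 4 < 1 := by nlinarith
  have : 0 < a ^ 2 := by positivity
  nlinarith

lemma rs_spread_scale (t : Ω₁ → Ω₂ → ℝ) (τ γ : ℝ)
    (hT : ∀ (g₁ : Ω₁ → ℝ) (g₂ : Ω₂ → ℝ), (∀ x, 0 ≤ g₁ x ∧ g₁ x ≤ 1) →
      (∀ x, 0 ≤ g₂ x ∧ g₂ x ≤ 1) →
      𝔼 x, 𝔼 y, t x y * g₁ x * g₂ y ≤ τ * (𝔼 x, g₁ x) * (𝔼 y, g₂ y) + γ)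
    (R : ℝ) (hR : 0 < R) (u : Ω₁ → ℝ) (v : Ω₂ → ℝ) (hu : ∀ x, 0 ≤ u x ∧ u x ≤ R)
    (hv : ∀ y, 0 ≤ v y ∧ v y ≤ 1) :
    𝔼 x, 𝔼 y, t x y * u x * v y ≤ τ * (𝔼 x, u x) * (𝔼 y, v y) + γ * R := by
  have h := hT (fun x => R⁻¹ * u x) v (fun x => ⟨by have := (hu x).1; positivity, by
    rw [inv_mul_le_iff₀ hR]; simpa using (hu x).2⟩) hv
  have e1 : 𝔼 x, 𝔼 y, t x y * (R⁻¹ * u x) * v y = R⁻¹ * 𝔼 x, 𝔼 y, t x y * u x * v y := by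
    rw [Finset.mul_expect]
    refine Finset.expect_congr rfl fun x _ => ?_
    rw [Finset.mul_expect]
    exact Finset.expect_congr rfl fun y _ => by ring
  simp only [e1, ← Finset.mul_expect] at h
  have h2 := mul_le_mul_of_nonneg_left h hR.le
  have e2 : R * (R⁻¹ * 𝔼 x, 𝔼 y, t x y * u x * v y) = 𝔼 x, 𝔼 y, t x y * u x * v y := by
    field_simp
  rw [e2] at h2
  refine h2.trans (le_of_eq ?_)
  field_simp

lemma rs_swap1 {Z : Type*} [Fintype Z] (t : Ω₁ → Ω₂ → ℝ) (U : Z → Ω₁ → ℝ) (V : Z → Ω₂ → ℝ) :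
    𝔼 x, 𝔼 y, t x y * (𝔼 z, U z x * V z y) = 𝔼 z, 𝔼 x, 𝔼 y, t x y * U z x * V z y := by
  rw [Finset.expect_comm univ univ (fun z x => 𝔼 y, t x y * U z x * V z y)]
  refine Finset.expect_congr rfl fun x _ => ?_
  rw [Finset.expect_comm univ univ (fun z y => t x y * U z x * V z y)]
  refine Finset.expect_congr rfl fun y _ => ?_
  rw [Finset.mul_expect]
  exact Finset.expect_congr rfl fun z _ => by ring

lemma rs_swap2 {Z : Type*} [Fintype Z] (τ : ℝ) (U : Z → Ω₁ → ℝ) (V : Z → Ω₂ → ℝ) :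
    τ * 𝔼 x, 𝔼 y, (𝔼 z, U z x * V z y) = 𝔼 z, τ * (𝔼 x, U z x) * (𝔼 y, V z y) := by
  have := rs_swap1 (fun _ _ => (1:ℝ)) U V
  simp only [one_mul] at this
  rw [this, Finset.mul_expect]
  refine Finset.expect_congr rfl fun z _ => ?_
  rw [mul_assoc, Finset.expect_mul_expect]

/-- The moment bound in the sparse case. -/
lemma rs_moment (f t : Ω₁ → Ω₂ → ℝ) (hf : ∀ x y, 0 ≤ f x y ∧ f x y ≤ 1)
    (hft : ∀ x y, f x y ≤ t x y)
    (b τ γ δ₁ δ₂ ρ : ℝ) (p : ℕ) (hb : 0 < b) (hτ : 0 < τ) (hδ₁ : δ₁ ≤ ρ)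
    (hρ : 0 < ρ) (hρ1 : ρ ≤ 1)
    (hN : ∀ (g₁ : Ω₁ → ℝ) (g₂ : Ω₂ → ℝ), (∀ x, 0 ≤ g₁ x ∧ g₁ x ≤ 1) →
      (∀ x, 0 ≤ g₂ x ∧ g₂ x ≤ 1) → δ₁ ≤ 𝔼 x, g₁ x → δ₂ ≤ 𝔼 y, g₂ y →
      𝔼 x, 𝔼 y, f x y * g₁ x * g₂ y < b * (𝔼 x, g₁ x) * 𝔼 y, g₂ y)
    (hT : ∀ (g₁ : Ω₁ → ℝ) (g₂ : Ω₂ → ℝ), (∀ x, 0 ≤ g₁ x ∧ g₁ x ≤ 1) →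
      (∀ x, 0 ≤ g₂ x ∧ g₂ x ≤ 1) →
      𝔼 x, 𝔼 y, t x y * g₁ x * g₂ y ≤ τ * (𝔼 x, g₁ x) * (𝔼 y, g₂ y) + γ)
    (hγ : γ ≤ ρ ^ (p + 1) * τ * b ^ p / 4) (hδ₂ : (2 * τ) ^ p * δ₂ ≤ b ^ p / 4)
    (K : Ω₁ → ℝ) (hK : ∀ x, 0 ≤ K x ∧ K x ≤ 1) (hκ : ρ ≤ 𝔼 x, K x) :
    𝔼 y, ((𝔼 x, K x)⁻¹ * 𝔼 x, f x y * K x) ^ p ≤ 3 / 2 * b ^ p := by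
  classical
  set κ := 𝔼 x, K x with hκd
  have hκ0 : 0 < κ := hρ.trans_le hκ
  set s : Ω₂ → ℝ := fun y => κ⁻¹ * 𝔼 x, f x y * K x with hs
  have hh : ∀ y, 𝔼 x, f x y * K x = κ * s y := fun y => by rw [hs]; field_simp
  have hs0 : ∀ y, 0 ≤ s y := fun y =>
    mul_nonneg (inv_nonneg.mpr hκ0.le) (rs_nonneg fun x => mul_nonneg (hf x y).1 (hK x).1)
  have hs1 : ∀ y, s y ≤ 1 := fun y => by
    rw [hs]; dsimp only
    rw [inv_mul_le_iff₀ hκ0, mul_one]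
    exact rs_mono fun x => mul_le_of_le_one_left (hK x).1 (hf x y).2
  have hsw : ∀ (F : Ω₁ → Ω₂ → ℝ) (g : Ω₂ → ℝ), 𝔼 x, 𝔼 y, F x y * K x * g y =
      𝔼 y, (𝔼 x, F x y * K x) * g y := by
    intro F g
    rw [Finset.expect_comm]
    exact Finset.expect_congr rfl fun y _ => by rw [Finset.expect_mul]
  set g : Ω₂ → ℝ := fun y => if b ≤ s y then 1 else 0 with hg
  set g' : Ω₂ → ℝ := fun y => if 2 * τ < s y then 1 else 0 with hg'
  have hg01 : ∀ y, 0 ≤ g y ∧ g y ≤ 1 := fun y => by rw [hg]; dsimp only; split_ifs <;> norm_num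
  have hg'01 : ∀ y, 0 ≤ g' y ∧ g' y ≤ 1 := fun y => by
    rw [hg']; dsimp only; split_ifs <;> norm_num
  have hGδ : 𝔼 y, g y ≤ δ₂ := by
    by_contra hc
    push Not at hc
    have h1 := hN K g hK hg01 (hδ₁.trans hκ) hc.le
    rw [hsw f g] at h1
    have h2 : b * κ * (𝔼 y, g y) ≤ 𝔼 y, (𝔼 x, f x y * K x) * g y := by
      rw [Finset.mul_expect]
      refine rs_mono fun y => ?_
      rw [hh, hg]; dsimp only
      split_ifs with h
      · nlinarith
      · simp
    linarith
  have hG' : τ * ρ * 𝔼 y, g' y ≤ γ := by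
    have h1 := hT K g' hK hg'01
    rw [hsw t g'] at h1
    have h2 : 2 * τ * κ * (𝔼 y, g' y) ≤ 𝔼 y, (𝔼 x, t x y * K x) * g' y := by
      rw [Finset.mul_expect]
      refine rs_mono fun y => ?_
      refine le_trans ?_ (mul_le_mul_of_nonneg_right
        (rs_mono fun x => mul_le_mul_of_nonneg_right (hft x y) (hK x).1) (hg'01 y).1)
      rw [hh, hg']; dsimp only
      split_ifs with h
      · nlinarith
      · simp
    have h3 : τ * ρ * (𝔼 y, g' y) ≤ τ * κ * 𝔼 y, g' y := by
      have := rs_nonneg (f := g') (fun y => (hg'01 y).1)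
      gcongr
    rw [← hκd] at h1
    linarith
  have hpt : ∀ y, s y ^ p ≤ b ^ p + (2 * τ) ^ p * g y + g' y := by
    intro y
    rw [hg, hg']; dsimp only
    by_cases h1 : 2 * τ < s y
    · rw [if_pos h1]
      have := pow_le_one₀ (n := p) (hs0 y) (hs1 y)
      have h3 : (0:ℝ) ≤ (2 * τ) ^ p * (if b ≤ s y then 1 else 0) := by split_ifs <;> positivity
      have h4 : 0 ≤ b ^ p := by positivity
      linarith
    · rw [if_neg h1]
      push Not at h1
      by_cases h2 : b ≤ s y
      · rw [if_pos h2]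
        have := pow_le_pow_left₀ (hs0 y) h1 p
        have h4 : 0 ≤ b ^ p := by positivity
        linarith
      · rw [if_neg h2]
        push Not at h2
        have := pow_le_pow_left₀ (hs0 y) h2.le p
        linarith
  have hfin : 𝔼 y, s y ^ p ≤ b ^ p + (2 * τ) ^ p * (𝔼 y, g y) + 𝔼 y, g' y := by
    refine (rs_mono hpt).trans (le_of_eq ?_)
    rw [Finset.expect_add_distrib, Finset.expect_add_distrib, Fintype.expect_const,
      Finset.mul_expect]
  have h5 : (2 * τ) ^ p * (𝔼 y, g y) ≤ b ^ p / 4 := le_trans (by gcongr) hδ₂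
  have h6 : 𝔼 y, g' y ≤ b ^ p / 4 := by
    have h7 : τ * ρ * 𝔼 y, g' y ≤ τ * ρ * (b ^ p / 4) := by
      calc _ ≤ γ := hG'
        _ ≤ _ := hγ
        _ = ρ ^ p * (τ * ρ * (b ^ p / 4)) := by ring
        _ ≤ 1 * (τ * ρ * (b ^ p / 4)) := by gcongr; exact pow_le_one₀ hρ.le hρ1
        _ = _ := one_mul _
    exact le_of_mul_le_mul_left h7 (by positivity)
  linarith

set_option maxHeartbeats 2000000 in
lemma rs_mid_sparse (f t : Ω₁ → Ω₂ → ℝ) (hf : ∀ x y, 0 ≤ f x y ∧ f x y ≤ 1)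
    (hft : ∀ x y, f x y ≤ t x y)
    (b τ γ δ₁ δ₂ ρ lam : ℝ) (p : ℕ) (hb : 0 < b) (hτ : 0 < τ) (hδ₂1 : δ₂ ≤ 1) (hδ₁ : δ₁ ≤ ρ)
    (hρ : 0 < ρ) (hρ1 : ρ ≤ 1) (hγ0 : 0 ≤ γ) (hp : 0 < p) (hlam : 0 < lam)
    (hlp : 2 * τ ≤ b * lam ^ p)
    (hN : ∀ (g₁ : Ω₁ → ℝ) (g₂ : Ω₂ → ℝ), (∀ x, 0 ≤ g₁ x ∧ g₁ x ≤ 1) →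
      (∀ x, 0 ≤ g₂ x ∧ g₂ x ≤ 1) → δ₁ ≤ 𝔼 x, g₁ x → δ₂ ≤ 𝔼 y, g₂ y →
      𝔼 x, 𝔼 y, f x y * g₁ x * g₂ y < b * (𝔼 x, g₁ x) * 𝔼 y, g₂ y)
    (hT : ∀ (g₁ : Ω₁ → ℝ) (g₂ : Ω₂ → ℝ), (∀ x, 0 ≤ g₁ x ∧ g₁ x ≤ 1) →
      (∀ x, 0 ≤ g₂ x ∧ g₂ x ≤ 1) →
      𝔼 x, 𝔼 y, t x y * g₁ x * g₂ y ≤ τ * (𝔼 x, g₁ x) * (𝔼 y, g₂ y) + γ)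
    (hγ : γ ≤ ρ ^ (p + 1) * τ * b ^ p / 4) (hδ₂ : (2 * τ) ^ p * δ₂ ≤ b ^ p / 4)
    (K : Ω₁ → Ω₁ → ℝ) (hK : ∀ x x', 0 ≤ K x x' ∧ K x x' ≤ 1)
    (hκ : ∀ x, 𝔼 x', K x x' = 0 ∨ ρ ≤ 𝔼 x', K x x')
    (hE : ρ ≤ 𝔼 x, 𝔼 x', K x x') :
    𝔼 x, 𝔼 x', rsD f x x' * K x x' ≤ lam * b ^ 2 * 𝔼 x, 𝔼 x', K x x' := by
  set κ : Ω₁ → ℝ := fun x => 𝔼 x', K x x' with hκd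
  have hκ01 : ∀ x, 0 ≤ κ x ∧ κ x ≤ 1 := fun x =>
    ⟨rs_nonneg fun x' => (hK x x').1, rs_le fun x' => (hK x x').2⟩
  set h : Ω₁ → Ω₂ → ℝ := fun x y => 𝔼 x', f x' y * K x x' with hhd
  have hh0 : ∀ x y, 0 ≤ h x y := fun x y =>
    rs_nonneg fun x' => mul_nonneg (hf x' y).1 (hK x x').1
  have hhκ : ∀ x y, h x y ≤ κ x := fun x y =>
    rs_mono fun x' => mul_le_of_le_one_left (hK x x').1 (hf x' y).2
  have ht0 : ∀ x y, 0 ≤ t x y := fun x y => (hf x y).1.trans (hft x y)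
  -- rewriting
  have e1 : 𝔼 x, 𝔼 x', rsD f x x' * K x x' = 𝔼 x, 𝔼 y, f x y * h x y := by
    refine Finset.expect_congr rfl fun x _ => ?_
    simp only [rsD, hhd, Finset.expect_mul, Finset.mul_expect]
    rw [Finset.expect_comm]
    exact Finset.expect_congr rfl fun y _ => Finset.expect_congr rfl fun x' _ => by ring
  -- Bernoulli
  have hbern : ∀ x y, p * (f x y * h x y) ≤ lam * b * (p - 1) * (f x y * κ x * 1) +
      lam * b * ((lam * b)⁻¹ ^ p) * (t x y * (κ x * ((κ x)⁻¹ * h x y) ^ p)) := by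
    intro x y
    have hc : 0 < lam * b := by positivity
    have hA : p * h x y ≤ lam * b * (p - 1) * κ x +
        lam * b * ((lam * b)⁻¹ ^ p) * (κ x * ((κ x)⁻¹ * h x y) ^ p) := by
      rcases (hκ01 x).1.eq_or_lt with h0 | h0
      · have := le_antisymm (h0 ▸ hhκ x y) (hh0 x y)
        rw [this, ← h0]; simp
      · have hB := one_add_mul_le_pow (a := (lam * b)⁻¹ * ((κ x)⁻¹ * h x y) - 1)
          (by have := hh0 x y
              have : 0 ≤ (lam * b)⁻¹ * ((κ x)⁻¹ * h x y) := by positivity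
              linarith) p
        have e : 1 + ((lam * b)⁻¹ * ((κ x)⁻¹ * h x y) - 1) = (lam * b)⁻¹ * ((κ x)⁻¹ * h x y) := by
          ring
        rw [e, mul_pow] at hB
        have hB2 := mul_le_mul_of_nonneg_left hB (mul_pos hc h0).le
        have e2 : lam * b * κ x * (1 + p * ((lam * b)⁻¹ * ((κ x)⁻¹ * h x y) - 1)) =
            p * h x y - lam * b * (p - 1) * κ x := by
          field_simp
          ring
        rw [e2] at hB2
        linarith
    have h1 := mul_le_mul_of_nonneg_left hA (hf x y).1
    have h2 : f x y * (lam * b * ((lam * b)⁻¹ ^ p) * (κ x * ((κ x)⁻¹ * h x y) ^ p)) ≤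
        t x y * (lam * b * ((lam * b)⁻¹ ^ p) * (κ x * ((κ x)⁻¹ * h x y) ^ p)) := by
      refine mul_le_mul_of_nonneg_right (hft x y) ?_
      have := hh0 x y
      have := (hκ01 x).1
      positivity
    linarith
  -- moment
  have hmom : 𝔼 x, 𝔼 y, t x y * (κ x * ((κ x)⁻¹ * h x y) ^ p) ≤ 2 * τ * b ^ p * 𝔼 x, κ x := by
    have hex : ∀ x y, κ x * ((κ x)⁻¹ * h x y) ^ p =
        𝔼 z : Fin p → Ω₁, (κ x * ∏ i, ((κ x)⁻¹ * K x (z i))) * ∏ i, f (z i) y := by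
      intro x y
      rw [hhd]; dsimp only
      rw [Finset.mul_expect, rs_pow, Finset.mul_expect]
      refine Finset.expect_congr rfl fun z _ => ?_
      rw [mul_assoc, ← Finset.prod_mul_distrib]
      congr 1
      exact Finset.prod_congr rfl fun i _ => by ring
    have hz : ∀ z : Fin p → Ω₁,
        𝔼 x, 𝔼 y, t x y * (κ x * ∏ i, ((κ x)⁻¹ * K x (z i))) * ∏ i, f (z i) y ≤
        τ * (𝔼 x, (κ x * ∏ i, ((κ x)⁻¹ * K x (z i)))) * (𝔼 y, ∏ i, f (z i) y) + γ * (ρ⁻¹ ^ p) := by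
      intro z
      refine rs_spread_scale t τ γ hT (ρ⁻¹ ^ p) (by positivity) _ _ ?_ ?_
      · intro x
        have hn : 0 ≤ ∏ i, ((κ x)⁻¹ * K x (z i)) := Finset.prod_nonneg fun i _ =>
          mul_nonneg (inv_nonneg.mpr (hκ01 x).1) (hK _ _).1
        refine ⟨mul_nonneg (hκ01 x).1 hn, ?_⟩
        rcases hκ x with h0 | h0
        · have h0' : κ x = 0 := h0
          rw [h0', zero_mul]; positivity
        · have h0' : ρ ≤ κ x := h0
          have h1 : ∏ i, ((κ x)⁻¹ * K x (z i)) ≤ ∏ _i : Fin p, ρ⁻¹ := by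
            refine Finset.prod_le_prod (fun i _ => mul_nonneg (inv_nonneg.mpr (hκ01 x).1) (hK _ _).1)
              fun i _ => ?_
            calc (κ x)⁻¹ * K x (z i) ≤ (κ x)⁻¹ * 1 :=
                  mul_le_mul_of_nonneg_left (hK _ _).2 (inv_nonneg.mpr (hκ01 x).1)
              _ = (κ x)⁻¹ := mul_one _
              _ ≤ ρ⁻¹ := by gcongr
          rw [Finset.prod_const, Finset.card_univ, Fintype.card_fin] at h1
          exact (mul_le_of_le_one_left hn (hκ01 x).2).trans h1
      · intro y
        exact ⟨Finset.prod_nonneg fun i _ => (hf _ _).1,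
          Finset.prod_le_one (fun i _ => (hf _ _).1) fun i _ => (hf _ _).2⟩
    have hL : 𝔼 x, 𝔼 y, t x y * (κ x * ((κ x)⁻¹ * h x y) ^ p) =
        𝔼 z : Fin p → Ω₁, 𝔼 x, 𝔼 y, t x y * (κ x * ∏ i, ((κ x)⁻¹ * K x (z i))) * ∏ i, f (z i) y := by
      simp only [hex]
      exact rs_swap1 t (fun (z : Fin p → Ω₁) x => κ x * ∏ i, ((κ x)⁻¹ * K x (z i)))
        (fun z y => ∏ i, f (z i) y)
    have hR : 𝔼 z : Fin p → Ω₁,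
        τ * (𝔼 x, (κ x * ∏ i, ((κ x)⁻¹ * K x (z i)))) * (𝔼 y, ∏ i, f (z i) y) =
        τ * 𝔼 x, 𝔼 y, κ x * ((κ x)⁻¹ * h x y) ^ p := by
      simp only [hex]
      exact (rs_swap2 τ (fun (z : Fin p → Ω₁) x => κ x * ∏ i, ((κ x)⁻¹ * K x (z i)))
        (fun z y => ∏ i, f (z i) y)).symm
    have hrow : ∀ x, 𝔼 y, κ x * ((κ x)⁻¹ * h x y) ^ p ≤ κ x * (3 / 2 * b ^ p) := by
      intro x
      rw [← Finset.mul_expect]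
      rcases hκ x with h0 | h0
      · have h0' : κ x = 0 := h0
        rw [h0', zero_mul, zero_mul]
      · refine mul_le_mul_of_nonneg_left ?_ (hκ01 x).1
        exact rs_moment f t hf hft b τ γ δ₁ δ₂ ρ p hb hτ hδ₁ hρ hρ1 hN hT hγ hδ₂ (K x) (hK x) h0
    have hγ2 : γ * ρ⁻¹ ^ p ≤ τ * b ^ p / 4 * 𝔼 x, κ x := by
      calc γ * ρ⁻¹ ^ p ≤ ρ ^ (p + 1) * τ * b ^ p / 4 * ρ⁻¹ ^ p := by gcongr
        _ = τ * b ^ p / 4 * ρ := by rw [inv_pow, pow_succ]; field_simp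
        _ ≤ _ := by gcongr
    calc _ = _ := hL
      _ ≤ _ := rs_mono hz
      _ = τ * (𝔼 x, 𝔼 y, κ x * ((κ x)⁻¹ * h x y) ^ p) + γ * (ρ⁻¹ ^ p) := by
        rw [Finset.expect_add_distrib, Fintype.expect_const, hR]
      _ ≤ τ * (𝔼 x, κ x * (3 / 2 * b ^ p)) + τ * b ^ p / 4 * 𝔼 x, κ x := by
        have := rs_mono hrow
        gcongr
      _ = τ * ((𝔼 x, κ x) * (3 / 2 * b ^ p)) + τ * b ^ p / 4 * 𝔼 x, κ x := by
        rw [Finset.expect_mul]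
      _ ≤ _ := by
        have : 0 ≤ τ * b ^ p * 𝔼 x, κ x := by
          have : 0 ≤ 𝔼 x, κ x := hρ.le.trans hE
          positivity
        linarith
  have h2 := hN κ (fun _ => 1) hκ01 (fun _ => by norm_num) (hδ₁.trans hE)
    (by rw [Fintype.expect_const]; exact hδ₂1)
  rw [Fintype.expect_const] at h2
  have hp1 : (1:ℝ) ≤ p := by exact_mod_cast hp
  have hEκ : 0 ≤ 𝔼 x, κ x := hρ.le.trans hE
  have hsum : p * (𝔼 x, 𝔼 y, f x y * h x y) ≤
      lam * b * (p - 1) * (𝔼 x, 𝔼 y, f x y * κ x * 1) +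
      lam * b * ((lam * b)⁻¹ ^ p) * (𝔼 x, 𝔼 y, t x y * (κ x * ((κ x)⁻¹ * h x y) ^ p)) := by
    simp only [Finset.mul_expect, ← Finset.expect_add_distrib]
    exact rs_mono fun x => rs_mono fun y => hbern x y
  rw [e1]
  have hfin : p * (𝔼 x, 𝔼 y, f x y * h x y) ≤ p * (lam * b ^ 2 * 𝔼 x, κ x) := by
    calc _ ≤ _ := hsum
      _ ≤ lam * b * (p - 1) * (b * (𝔼 x, κ x) * 1) +
          lam * b * ((lam * b)⁻¹ ^ p) * (2 * τ * b ^ p * 𝔼 x, κ x) := by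
        have : 0 ≤ (p:ℝ) - 1 := by linarith
        gcongr
      _ ≤ lam * b * (p - 1) * (b * (𝔼 x, κ x) * 1) +
          lam * b * ((lam * b)⁻¹ ^ p) * (b * lam ^ p * b ^ p * 𝔼 x, κ x) := by
        gcongr
      _ = _ := by
        rw [inv_pow, mul_pow]
        field_simp
        ring
  exact le_of_mul_le_mul_left hfin (by linarith)

set_option maxHeartbeats 2000000 in
lemma rs_core_sparse (f t : Ω₁ → Ω₂ → ℝ) (hf : ∀ x y, 0 ≤ f x y ∧ f x y ≤ 1)
    (hft : ∀ x y, f x y ≤ t x y)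
    (α e τ γ δ₁ δ₂ ρ : ℝ) (k p : ℕ) (hk : 0 < k) (hp : 0 < p) (hα : 0 < α) (hα1 : α < 1)
    (hτ : 0 < τ) (hτ1 : τ < 1) (he : 0 < e) (he1 : e < 1) (hγ0 : 0 ≤ γ)
    (hρ : ρ = e / 128 * α ^ 2 * (α / 2) ^ (2 * k))
    (hδ₁ : δ₁ ≤ ρ) (hδ₂1 : δ₂ ≤ 1) (hδ₂ : 2 ^ p * δ₂ ≤ ((1 - e) * α) ^ p / 4)
    (hlp : 2 ≤ (1 - e) * α * (1 + e) ^ p)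
    (hγ : γ ≤ ρ ^ (p + 1) * τ * ((1 - e) * α * τ) ^ p / 4)
    (hγ' : 2 * γ ≤ τ ^ 2 * (e / 4 * (α * τ) ^ (2 * k + 2)))
    (hN : ∀ (g₁ : Ω₁ → ℝ) (g₂ : Ω₂ → ℝ), (∀ x, 0 ≤ g₁ x ∧ g₁ x ≤ 1) →
      (∀ x, 0 ≤ g₂ x ∧ g₂ x ≤ 1) → δ₁ ≤ 𝔼 x, g₁ x → δ₂ ≤ 𝔼 y, g₂ y →
      𝔼 x, 𝔼 y, f x y * g₁ x * g₂ y < ((1 - e) * α * τ) * (𝔼 x, g₁ x) * 𝔼 y, g₂ y)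
    (hT : ∀ (g₁ : Ω₁ → ℝ) (g₂ : Ω₂ → ℝ), (∀ x, 0 ≤ g₁ x ∧ g₁ x ≤ 1) →
      (∀ x, 0 ≤ g₂ x ∧ g₂ x ≤ 1) →
      𝔼 x, 𝔼 y, t x y * g₁ x * g₂ y ≤ τ * (𝔼 x, g₁ x) * (𝔼 y, g₂ y) + γ)
    (hD : (α * τ) ^ (2 * k) ≤ 𝔼 x, 𝔼 x', rsD f x x' ^ k) : False := by
  classical
  have hD01 := rsD_mem f hf
  set a := α * τ with ha
  have ha0 : 0 < a := by positivity
  have ha1 : a < 1 := by nlinarith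
  have hone : 0 < 1 - e := by linarith
  obtain ⟨m, hm, hm'⟩ := rs_chain (fun j => 𝔼 x, 𝔼 x', rsD f x x' ^ j) (a ^ 2) (by positivity) k hk
    (by simp) (by rw [← pow_mul]; exact hD)
  -- the exceptional set
  set B : Ω₁ → Ω₁ → ℝ := fun x x' => if rsD f x x' ≤ 4 * τ ^ 2 then 0 else 1 with hB
  have hB01 : ∀ x x', 0 ≤ B x x' ∧ B x x' ≤ 1 := fun x x' => by
    rw [hB]; dsimp only; split_ifs <;> norm_num
  have hBm : 𝔼 x, 𝔼 x', B x x' ≤ e / 4 * a ^ (2 * k + 2) := by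
    set g : Ω₁ → ℝ := fun x => if (𝔼 y, f x y) ≤ 2 * τ then 0 else 1 with hg
    have hg01 : ∀ x, 0 ≤ g x ∧ g x ≤ 1 := fun x => by rw [hg]; dsimp only; split_ifs <;> norm_num
    have hg1 : τ * 𝔼 x, g x ≤ γ := by
      have h1 := hT g (fun _ => 1) hg01 (fun _ => by norm_num)
      rw [Fintype.expect_const] at h1
      have h2 : 2 * τ * (𝔼 x, g x) ≤ 𝔼 x, 𝔼 y, t x y * g x * 1 := by
        rw [Finset.mul_expect]
        refine rs_mono fun x => ?_
        refine le_trans ?_ (rs_mono fun y => mul_le_mul_of_nonneg_right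
          (mul_le_mul_of_nonneg_right (hft x y) (hg01 x).1) zero_le_one)
        simp only [mul_one, ← Finset.expect_mul]
        rw [hg]; dsimp only
        split_ifs with h
        · simp
        · push Not at h; linarith
      linarith
    have hrow : ∀ x, τ ^ 2 * 𝔼 x', B x x' ≤ τ ^ 2 * g x + γ := by
      intro x
      have hBle : 𝔼 x', B x x' ≤ 1 := rs_le fun x' => (hB01 x x').2
      by_cases h : (𝔼 y, f x y) ≤ 2 * τ
      · have h1 := hT (fun x' => B x x') (fun y => f x y) (hB01 x) (hf x)
        have h0 : 0 ≤ 𝔼 x', B x x' := rs_nonneg fun x' => (hB01 x x').1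
        have h2 : 4 * τ ^ 2 * (𝔼 x', B x x') ≤ 𝔼 x', 𝔼 y, t x' y * B x x' * f x y := by
          rw [Finset.mul_expect]
          refine rs_mono fun x' => ?_
          refine le_trans ?_ (rs_mono fun y => mul_le_mul_of_nonneg_right
            (mul_le_mul_of_nonneg_right (hft x' y) (hB01 x x').1) (hf x y).1)
          have e1 : 𝔼 y, f x' y * B x x' * f x y = rsD f x x' * B x x' := by
            rw [rsD, Finset.expect_mul]
            exact Finset.expect_congr rfl fun y _ => by ring
          rw [e1, hB]; dsimp only
          split_ifs with h
          · simp
          · push Not at h; linarith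
        have h3 : τ * (𝔼 x', B x x') * (𝔼 y, f x y) ≤ τ * (𝔼 x', B x x') * (2 * τ) := by gcongr
        have h4 : 0 ≤ τ ^ 2 * g x := mul_nonneg (by positivity) (hg01 x).1
        have h5 : 0 ≤ τ ^ 2 * 𝔼 x', B x x' := by positivity
        have h1' : 𝔼 x', 𝔼 y, t x' y * B x x' * f x y ≤ τ * (𝔼 x', B x x') * (𝔼 y, f x y) + γ := h1
        linarith
      · have : g x = 1 := by rw [hg]; dsimp only; rw [if_neg h]
        rw [this]
        have : τ ^ 2 * (𝔼 x', B x x') ≤ τ ^ 2 * 1 := by gcongr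
        linarith
    have h1 : τ ^ 2 * (𝔼 x, 𝔼 x', B x x') ≤ 2 * γ := by
      rw [Finset.mul_expect]
      refine (rs_mono hrow).trans ?_
      rw [Finset.expect_add_distrib, ← Finset.mul_expect, Fintype.expect_const]
      have h0 : 0 ≤ 𝔼 x, g x := rs_nonneg fun x => (hg01 x).1
      have : τ ^ 2 * (𝔼 x, g x) ≤ τ * 𝔼 x, g x := by
        gcongr
        nlinarith
      linarith
    exact le_of_mul_le_mul_left (h1.trans hγ') (by positivity)
  set Q := (4 * τ ^ 2) with hQ
  have hQ0 : 0 < Q := by positivity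
  set K : Ω₁ → Ω₁ → ℝ := fun x x' => if rsD f x x' ≤ Q then (rsD f x x' / Q) ^ m else 0 with hKd
  have hK : ∀ x x', 0 ≤ K x x' ∧ K x x' ≤ 1 := fun x x' => by
    rw [hKd]; dsimp only
    have := (hD01 x x').1
    split_ifs with h
    · exact ⟨by positivity, pow_le_one₀ (by positivity) (by rw [div_le_one hQ0]; exact h)⟩
    · norm_num
  set EK := 𝔼 x, 𝔼 x', K x x' with hEKd
  set EB := 𝔼 x, 𝔼 x', B x x' with hEBd
  have hup : ∀ j, m ≤ j → 𝔼 x, 𝔼 x', rsD f x x' ^ j ≤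
      Q ^ m * (𝔼 x, 𝔼 x', rsD f x x' ^ (j - m) * K x x') + EB := by
    intro j hj
    simp only [hEBd, Finset.mul_expect, ← Finset.expect_add_distrib]
    refine rs_mono fun x => rs_mono fun x' => ?_
    rw [hKd, hB]; dsimp only
    have h0 := hD01 x x'
    split_ifs with h
    · rw [div_pow]
      have : Q ^ m * (rsD f x x' ^ (j - m) * (rsD f x x' ^ m / Q ^ m)) = rsD f x x' ^ j := by
        field_simp
        rw [← pow_add]; congr 1; omega
      rw [this]; simp
    · have := pow_le_one₀ (n := j) h0.1 h0.2
      simpa using this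
  have hup0 : Q ^ m * EK ≤ 𝔼 x, 𝔼 x', rsD f x x' ^ m := by
    simp only [hEKd, Finset.mul_expect]
    refine rs_mono fun x => rs_mono fun x' => ?_
    rw [hKd]; dsimp only
    have h0 := (hD01 x x').1
    split_ifs with h
    · rw [div_pow]; field_simp; exact le_rfl
    · simp only [mul_zero]; positivity
  have hmain := hup (m + 1) (by omega)
  simp only [Nat.add_sub_cancel_left, pow_one] at hmain
  set EDm := 𝔼 x, 𝔼 x', rsD f x x' ^ m with hEDm
  have hEDm1 : a ^ (2 * k) ≤ EDm := hD.trans (rs_mono fun x => rs_mono fun x' =>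
    pow_le_pow_of_le_one (hD01 x x').1 (hD01 x x').2 hm.le)
  have hEB1 : EB ≤ e / 4 * a ^ 2 * EDm := by
    calc EB ≤ _ := hBm
      _ = e / 4 * a ^ 2 * a ^ (2 * k) := by ring
      _ ≤ _ := by gcongr
  have hlow : (1 - e / 4) * a ^ 2 * EK ≤ 𝔼 x, 𝔼 x', rsD f x x' * K x x' := by
    have h1 : (1 - e / 4) * a ^ 2 * EDm ≤ Q ^ m * 𝔼 x, 𝔼 x', rsD f x x' * K x x' := by linarith
    have h2 : (1 - e / 4) * a ^ 2 * (Q ^ m * EK) ≤ (1 - e / 4) * a ^ 2 * EDm := by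
      have : 0 ≤ 1 - e / 4 := by linarith
      gcongr
    have h3 : Q ^ m * ((1 - e / 4) * a ^ 2 * EK) ≤ Q ^ m * 𝔼 x, 𝔼 x', rsD f x x' * K x x' := by
      linarith
    exact le_of_mul_le_mul_left h3 (by positivity)
  -- lower bound for EK
  have hEK : (α / 2) ^ (2 * k) / 2 ≤ EK := by
    have h1 := hup k hm.le
    have h2 : 𝔼 x, 𝔼 x', rsD f x x' ^ (k - m) * K x x' ≤ Q ^ (k - m) * EK := by
      simp only [hEKd, Finset.mul_expect]
      refine rs_mono fun x => rs_mono fun x' => ?_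
      rw [hKd]; dsimp only
      have h0 := (hD01 x x').1
      split_ifs with h
      · gcongr
      · simp
    have h3 : Q ^ m * (𝔼 x, 𝔼 x', rsD f x x' ^ (k - m) * K x x') ≤ Q ^ k * EK := by
      calc _ ≤ Q ^ m * (Q ^ (k - m) * EK) := by gcongr
        _ = Q ^ k * EK := by rw [← mul_assoc, ← pow_add]; congr 2; omega
    have h4 : EB ≤ a ^ (2 * k) / 2 := by
      calc EB ≤ _ := hBm
        _ = (e / 4 * a ^ 2) * a ^ (2 * k) := by ring
        _ ≤ (1 / 2) * a ^ (2 * k) := by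
          gcongr
          have : a ^ 2 ≤ 1 := by nlinarith
          nlinarith
        _ = _ := by ring
    have h5 : a ^ (2 * k) / 2 ≤ Q ^ k * EK := by linarith
    have h6 : a ^ (2 * k) = Q ^ k * (α / 2) ^ (2 * k) := by
      rw [pow_mul, pow_mul, ← mul_pow, ha, hQ]; congr 1; ring
    rw [h6] at h5
    refine le_of_mul_le_mul_left (a := Q ^ k) ?_ (by positivity)
    linarith
  have hEK0 : 0 < EK := lt_of_lt_of_le (by positivity) hEK
  have hρ0 : 0 < ρ := by rw [hρ]; positivity
  have hρ2 : ρ ≤ e / 64 * α ^ 2 * EK := by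
    calc ρ = e / 64 * α ^ 2 * ((α / 2) ^ (2 * k) / 2) := by rw [hρ]; ring
      _ ≤ _ := by gcongr
  have hEK1 : EK ≤ 1 := rs_le fun x => rs_le fun x' => (hK x x').2
  have h8 : e / 64 * α ^ 2 ≤ 1 / 64 := by
    have : α ^ 2 ≤ 1 := by nlinarith
    nlinarith
  have hρ3 : ρ ≤ EK / 64 := by nlinarith
  obtain ⟨K', hK', hκ', hs, hle, hge⟩ := rs_split (rsD f) K Q ρ hK hQ0.le hρ0.le
    (fun x x' => by
      rw [hKd]; dsimp only
      have h0 := (hD01 x x').1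
      split_ifs with h
      · gcongr
      · simp)
  have hb0 : 0 < (1 - e) * α * τ := by positivity
  have hmid := rs_mid_sparse f t hf hft ((1 - e) * α * τ) τ γ δ₁ δ₂ ρ (1 + e) p hb0 hτ hδ₂1 hδ₁
    hρ0 (by linarith) hγ0 hp (by linarith)
    (by calc 2 * τ ≤ ((1 - e) * α * (1 + e) ^ p) * τ := by gcongr
          _ = _ := by ring)
    hN hT hγ
    (by rw [mul_pow, mul_pow _ τ]
        calc 2 ^ p * τ ^ p * δ₂ = τ ^ p * (2 ^ p * δ₂) := by ring
          _ ≤ τ ^ p * (((1 - e) * α) ^ p / 4) := by gcongr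
          _ = _ := by ring)
    K' hK' hκ' (by linarith)
  have h3 : (1 + e) * ((1 - e) * α * τ) ^ 2 * (𝔼 x, 𝔼 x', K' x x') ≤
      (1 + e) * ((1 - e) * α * τ) ^ 2 * EK := by gcongr
  have h4 : Q * ρ ≤ e / 16 * a ^ 2 * EK := by
    calc Q * ρ ≤ Q * (e / 64 * α ^ 2 * EK) := by gcongr
      _ = _ := by rw [hQ, ha]; ring
  have h5 : (1 - e / 4) * a ^ 2 * EK ≤ (1 + e) * ((1 - e) * α * τ) ^ 2 * EK + e / 16 * a ^ 2 * EK := by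
    linarith
  have h6 : (1 - e / 4) * (a ^ 2 * EK) ≤ ((1 + e) * (1 - e) ^ 2 + e / 16) * (a ^ 2 * EK) := by
    calc _ = (1 - e / 4) * a ^ 2 * EK := by ring
      _ ≤ _ := h5
      _ = _ := by rw [ha]; ring
  have h7 := le_of_mul_le_mul_right h6 (by positivity)
  nlinarith [mul_pos hone he, mul_pos (mul_pos hone he) he]

end RS

section RSParam

lemma rs_rpow_le (w x : ℝ) (n : ℕ) (hw : 0 < w) (hw1 : w ≤ 1) (h : (n : ℝ) ≤ x) :
    w ^ x ≤ w ^ n := by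
  rw [← Real.rpow_natCast]
  exact Real.rpow_le_rpow_of_exponent_ge hw hw1 h

lemma rs_conv2 {Ω₁ Ω₂ : Type*} [Fintype Ω₁] [Fintype Ω₂] (F : Ω₁ → Ω₂ → ℝ) :
    (∑ x, ∑ y, F x y) / ((Fintype.card Ω₁ : ℝ) * (Fintype.card Ω₂ : ℝ)) = 𝔼 x, 𝔼 y, F x y := by
  simp only [Fintype.expect_eq_sum_div_card]
  rw [← Finset.sum_div, div_div, mul_comm]

lemma rs_logbound (α : ℝ) (h0 : 0 < α) (h1 : α < 1) : 1 / 2 ≤ Real.log (2 / α) := by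
  have h2 : Real.log 2 ≤ Real.log (2 / α) := by
    apply Real.log_le_log (by norm_num)
    rw [le_div_iff₀ h0]; linarith
  have := Real.log_two_gt_d9
  linarith

lemma rs_pow_lower (α e : ℝ) (p : ℕ) (hα : 0 < α) (hα1 : α < 1) (he : 0 < e) (he1 : e ≤ 1 / 2)
    (hp : 4 * Real.log (2 / α) / e ≤ p) : 2 ≤ (1 - e) * α * (1 + e) ^ p := by
  have h1 : Real.exp (e / 2) ≤ 1 + e := by
    have h2 := Real.add_one_le_exp (-(e / 2))
    rw [Real.exp_neg] at h2
    have h3 : 0 < Real.exp (e / 2) := Real.exp_pos _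
    have h4 : (-(e / 2) + 1) * Real.exp (e / 2) ≤ 1 := by
      calc _ ≤ (Real.exp (e / 2))⁻¹ * Real.exp (e / 2) := by gcongr
        _ = 1 := by field_simp
    by_contra hc
    push Not at hc
    nlinarith
  have h5 : 4 / α ^ 2 ≤ (1 + e) ^ p := by
    calc 4 / α ^ 2 = (2 / α) ^ 2 := by ring
      _ = Real.exp (2 * Real.log (2 / α)) := by
        rw [show 2 * Real.log (2 / α) = Real.log (2 / α) + Real.log (2 / α) by ring, Real.exp_add,
          Real.exp_log (by positivity)]; ring
      _ ≤ Real.exp (p * (e / 2)) := by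
        apply Real.exp_le_exp.mpr
        rw [div_le_iff₀ he] at hp
        linarith
      _ = Real.exp (e / 2) ^ p := by rw [Real.exp_nat_mul]
      _ ≤ _ := by gcongr
  calc (2:ℝ) ≤ 2 / α := by rw [le_div_iff₀ hα]; linarith
    _ = 1 / 2 * α * (4 / α ^ 2) := by field_simp; ring
    _ ≤ (1 - e) * α * (1 + e) ^ p := by
      have h9 : 1 / 2 * α ≤ (1 - e) * α := by gcongr; linarith
      have h10 : 0 ≤ (1 - e) * α := le_trans (by positivity) h9
      exact mul_le_mul h9 h5 (by positivity) h10

lemma rs_param_gamma (α e τ ρ γ : ℝ) (k p q N : ℕ) (hα : 0 < α) (hα1 : α < 1)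
    (hτ : 0 < τ) (hτ1 : τ < 1 / 2) (he : 0 < e) (he1 : e ≤ 1 / 2)
    (hq : 1 / e ≤ q)
    (hρ : ρ = e / 128 * α ^ 2 * (α / 2) ^ (2 * k))
    (hN : N = (q + 9 + 4 * k) * (p + 1) + 2 * p + 3)
    (hγ : γ ≤ (α * τ) ^ N) :
    γ ≤ ρ ^ (p + 1) * τ * ((1 - e) * α * τ) ^ p / 4 ∧
    2 * γ ≤ τ ^ 2 * (e / 4 * (α * τ) ^ (2 * k + 2)) := by
  set a := α * τ with ha
  have ha0 : 0 < a := by positivity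
  have haα : a ≤ α := by rw [ha]; nlinarith
  have haτ : a ≤ τ := by rw [ha]; nlinarith
  have ha2 : a ≤ 1 / 2 := by linarith
  have hea : a ^ q ≤ e := by
    have hq0 : (0:ℝ) < q := lt_of_lt_of_le (by positivity) hq
    have h1 : (q:ℝ) ≤ 2 ^ q := by exact_mod_cast (Nat.lt_two_pow_self (n := q)).le
    calc a ^ q ≤ (1 / 2) ^ q := by gcongr
      _ = 1 / 2 ^ q := by rw [div_pow, one_pow]
      _ ≤ 1 / q := by gcongr
      _ ≤ e := by rw [div_le_iff₀ hq0]; rw [div_le_iff₀ he] at hq; linarith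
  have hρa : a ^ (q + 9 + 4 * k) ≤ ρ := by
    have h7 : a ^ 7 ≤ 1 / 128 := by
      calc a ^ 7 ≤ (1 / 2) ^ 7 := by gcongr
        _ = _ := by norm_num
    calc a ^ (q + 9 + 4 * k) = a ^ q * a ^ 7 * a ^ 2 * (a * a) ^ (2 * k) := by
          rw [← sq, ← pow_mul]; ring
      _ ≤ e * (1 / 128) * α ^ 2 * (α * (1 / 2)) ^ (2 * k) := by gcongr
      _ = ρ := by rw [hρ]; ring
  have hb : a ^ 2 ≤ (1 - e) * α * τ := by
    calc a ^ 2 = a * a := sq a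
      _ ≤ 1 / 2 * a := by gcongr
      _ ≤ (1 - e) * a := by gcongr; linarith
      _ = _ := by rw [ha]; ring
  have h4 : a ^ 2 ≤ 1 / 4 := by nlinarith
  constructor
  · calc γ ≤ a ^ N := hγ
      _ = (a ^ (q + 9 + 4 * k)) ^ (p + 1) * a * (a ^ 2) ^ p * a ^ 2 := by
        rw [hN, ← pow_mul, ← pow_mul]; ring
      _ ≤ ρ ^ (p + 1) * τ * ((1 - e) * α * τ) ^ p * (1 / 4) := by
        have : 0 ≤ (1 - e) * α * τ := le_trans (by positivity) hb
        have : 0 ≤ ρ := le_trans (by positivity) hρa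
        gcongr
      _ = _ := by ring
  · have h8 : a ^ 3 ≤ 1 / 8 := by
      calc a ^ 3 ≤ (1 / 2) ^ 3 := by gcongr
        _ = _ := by norm_num
    calc 2 * γ ≤ 2 * a ^ N := by gcongr
      _ ≤ 2 * a ^ (2 + q + 3 + (2 * k + 2)) := by
        gcongr 2 * ?_
        apply pow_le_pow_of_le_one ha0.le (by linarith)
        rw [hN]
        nlinarith [Nat.zero_le (p * (q + 9 + 4 * k))]
      _ = 2 * (a ^ 2 * (a ^ q * a ^ 3 * a ^ (2 * k + 2))) := by ring
      _ ≤ 2 * (τ ^ 2 * (e * (1 / 8) * a ^ (2 * k + 2))) := by gcongr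
      _ = _ := by ring

lemma rs_Nle (i L M : ℝ) (k p q N : ℕ) (hk1 : (1:ℝ) ≤ k) (hi : 1 ≤ i) (hL : 1 / 2 ≤ L)
    (hM : 1 / 2 ≤ M) (hiL : 1 / 2 ≤ i * L) (hpu : (p:ℝ) ≤ 10 * (i * L)) (hqu : (q:ℝ) ≤ 3 * i)
    (hNd : N = (q + 9 + 4 * k) * (p + 1) + 2 * p + 3) :
    (N:ℝ) ≤ 1000 * (i ^ 2 * k * L ^ 2 + i * k * M) := by
  have hi0 : 0 < i := by linarith
  have hL0 : 0 < L := by linarith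
  have hM0 : 0 < M := by linarith
  have j1 : i ≤ i * k := le_mul_of_one_le_right (by linarith) hk1
  have j2 : (k:ℝ) ≤ i * k := le_mul_of_one_le_left (by linarith) hi
  have h0 : 0 ≤ i * k * M := by positivity
  have h1 : (q:ℝ) + 9 + 4 * k ≤ 16 * (i * k) := by linarith
  have h2 : (p:ℝ) + 1 ≤ 12 * (i * L) := by linarith
  have h3 : ((q:ℝ) + 9 + 4 * k) * (p + 1) ≤ 16 * (i * k) * (12 * (i * L)) := by gcongr
  have h4 : i * L ≤ (i * L) * (i * k) := by
    apply le_mul_of_one_le_right (by linarith)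
    linarith
  have h5 : i ^ 2 * k * L ≤ 2 * (i ^ 2 * k * L ^ 2) := by
    have : L ≤ 2 * L ^ 2 := by nlinarith
    calc i ^ 2 * k * L ≤ i ^ 2 * k * (2 * L ^ 2) := by gcongr
      _ = _ := by ring
  have h6 : (N:ℝ) = ((q:ℝ) + 9 + 4 * k) * (p + 1) + 2 * p + 3 := by
    rw [hNd]; push_cast; ring
  have h7 : (N:ℝ) ≤ 230 * (i ^ 2 * k * L) := by
    rw [h6]
    have : 230 * (i ^ 2 * k * L) = 16 * (i * k) * (12 * (i * L)) +
      38 * ((i * L) * (i * k)) := by ring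
    rw [this]
    linarith
  have h8 : 0 ≤ i ^ 2 * k * L ^ 2 := by positivity
  linarith

end RSParam

set_option maxHeartbeats 4000000 in
/-- Relative sifting (Theorem 3.5 of the paper). -/
theorem relative_sifting :
    ∃ C : ℝ, 0 < C ∧
      ∀ (α ε γ τ : ℝ) (k : ℕ), 0 < k →
        α ∈ Set.Ioo (0 : ℝ) 1 → ε ∈ Set.Ioo (0 : ℝ) 1 →
        γ ∈ Set.Ioo (0 : ℝ) 1 → τ ∈ Set.Ioo (0 : ℝ) 1 →
        γ ≤ (α * τ) ^
          (C * (ε⁻¹ ^ 2 * (k : ℝ) * Real.log (2 / α) ^ 2 +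
            ε⁻¹ * (k : ℝ) * Real.log (2 / τ))) →
        ∀ (Ω₁ Ω₂ : Type*) [Fintype Ω₁] [Fintype Ω₂] [Nonempty Ω₁] [Nonempty Ω₂]
          (T : Set (Ω₁ × Ω₂)), CombinatoriallySpread T τ γ →
        ∀ f : Ω₁ → Ω₂ → ℝ, (∀ x y, f x y ∈ Set.Icc (0 : ℝ) 1) →
          (∀ x y, (x, y) ∉ T → f x y = 0) →
          α ^ (2 * k) * τ ^ (2 * k) ≤
            (∑ x₁ : Ω₁, ∑ x₂ : Ω₁, ∑ y : Fin k → Ω₂, ∏ i : Fin k, f x₁ (y i) * f x₂ (y i)) /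
              ((Fintype.card Ω₁ : ℝ) ^ 2 * (Fintype.card Ω₂ : ℝ) ^ k) →
          ∃ (g₁ : Ω₁ → ℝ) (g₂ : Ω₂ → ℝ),
            (∀ x, g₁ x ∈ Set.Icc (0 : ℝ) 1) ∧ (∀ y, g₂ y ∈ Set.Icc (0 : ℝ) 1) ∧
            (1 - ε) * α * τ * ((∑ x : Ω₁, g₁ x) / (Fintype.card Ω₁ : ℝ)) *
                ((∑ y : Ω₂, g₂ y) / (Fintype.card Ω₂ : ℝ)) ≤
              (∑ x : Ω₁, ∑ y : Ω₂, f x y * g₁ x * g₂ y) /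
                ((Fintype.card Ω₁ : ℝ) * (Fintype.card Ω₂ : ℝ)) ∧
            (ε * α / 2) ^ (C * ε⁻¹ * (k : ℝ) ^ 2 * Real.log (2 / α)) ≤
              (∑ x : Ω₁, g₁ x) / (Fintype.card Ω₁ : ℝ) ∧
            (ε * α / 2) ^ (C * ε⁻¹ * Real.log (2 / α)) ≤
              (∑ y : Ω₂, g₂ y) / (Fintype.card Ω₂ : ℝ) := by
  refine ⟨1000, by norm_num, ?_⟩
  intro α ε γ τ k hk hα hε hγ hτ hγle Ω₁ Ω₂ _ _ _ _ T hT f hf hfT hmom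
  obtain ⟨hα0, hα1⟩ := hα
  obtain ⟨hε0, hε1⟩ := hε
  obtain ⟨hγ0, hγ1⟩ := hγ
  obtain ⟨hτ0, hτ1⟩ := hτ
  by_contra hcon
  push Not at hcon
  have hL := rs_logbound α hα0 hα1
  have hLτ := rs_logbound τ hτ0 hτ1
  set L := Real.log (2 / α) with hLd
  set w := ε * α / 2 with hw
  have hw0 : 0 < w := by positivity
  have hw2 : w ≤ 1 / 2 := by rw [hw]; nlinarith
  have hwα : w ≤ α / 2 := by rw [hw]; nlinarith
  set δ₁ := w ^ (1000 * ε⁻¹ * (k : ℝ) ^ 2 * L) with hδ₁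
  set δ₂ := w ^ (1000 * ε⁻¹ * L) with hδ₂
  set e := min ε (1 / 2) with he
  have he0 : 0 < e := lt_min hε0 (by norm_num)
  have he2 : e ≤ 1 / 2 := min_le_right _ _
  have heε : e ≤ ε := min_le_left _ _
  have hεe : ε / 2 ≤ e := le_min (by linarith) (by linarith)
  have hwe : w ≤ e := by
    refine le_trans ?_ hεe
    rw [hw]; nlinarith
  have hk1 : (1:ℝ) ≤ k := by exact_mod_cast hk
  have hi : 1 ≤ ε⁻¹ := (one_le_inv₀ hε0).mpr hε1.le
  have hei : 1 / e ≤ 2 * ε⁻¹ := by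
    rw [div_le_iff₀ he0]
    calc (1:ℝ) = 2 * ε⁻¹ * (ε / 2) := by field_simp
      _ ≤ _ := by gcongr
  have hiL : 1 / 2 ≤ ε⁻¹ * L := by nlinarith
  have hf' : ∀ x y, 0 ≤ f x y ∧ f x y ≤ 1 := fun x y => hf x y
  have hδ₂0 : 0 ≤ δ₂ := Real.rpow_nonneg hw0.le _
  have hδ₁le : ∀ n : ℕ, n ≤ 2 * k + 10 → δ₁ ≤ w ^ n := by
    intro n hn
    apply rs_rpow_le w _ n hw0 (by linarith)
    have h1 : (n:ℝ) ≤ 2 * k + 10 := by exact_mod_cast hn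
    have h2 : (k:ℝ) ≤ (k:ℝ) ^ 2 := by nlinarith
    have h3 : 1000 * (1 / 2) * (k:ℝ) ^ 2 ≤ 1000 * (ε⁻¹ * L) * (k:ℝ) ^ 2 := by gcongr
    nlinarith
  have hδ₂le : ∀ n : ℕ, (n:ℝ) ≤ 1000 * (ε⁻¹ * L) → δ₂ ≤ w ^ n := by
    intro n hn
    apply rs_rpow_le w _ n hw0 (by linarith)
    linarith
  have hN : ∀ (g₁ : Ω₁ → ℝ) (g₂ : Ω₂ → ℝ), (∀ x, 0 ≤ g₁ x ∧ g₁ x ≤ 1) →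
      (∀ x, 0 ≤ g₂ x ∧ g₂ x ≤ 1) → δ₁ ≤ 𝔼 x, g₁ x → δ₂ ≤ 𝔼 y, g₂ y →
      𝔼 x, 𝔼 y, f x y * g₁ x * g₂ y < ((1 - e) * α * τ) * (𝔼 x, g₁ x) * 𝔼 y, g₂ y := by
    intro g₁ g₂ hg₁ hg₂ h1 h2
    by_contra hc
    push Not at hc
    have h3 := hcon g₁ g₂ hg₁ hg₂ (by
      rw [rs_conv2, ← Fintype.expect_eq_sum_div_card, ← Fintype.expect_eq_sum_div_card]
      refine le_trans ?_ hc
      have i1 : 0 ≤ 𝔼 x, g₁ x := rs_nonneg fun x => (hg₁ x).1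
      have i2 : 0 ≤ 𝔼 x, g₂ x := rs_nonneg fun x => (hg₂ x).1
      gcongr) (by rw [← Fintype.expect_eq_sum_div_card]; exact h1)
    rw [← Fintype.expect_eq_sum_div_card] at h3
    exact absurd h2 (not_le.mpr h3)
  have hD : (α * τ) ^ (2 * k) ≤ 𝔼 x, 𝔼 x', rsD f x x' ^ k := by
    rw [mul_pow]
    refine hmom.trans (le_of_eq ?_)
    have : ∀ x x', rsD f x x' ^ k =
        (∑ y : Fin k → Ω₂, ∏ i : Fin k, f x (y i) * f x' (y i)) / (Fintype.card Ω₂ : ℝ) ^ k := by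
      intro x x'
      rw [rsD, Fintype.expect_eq_sum_div_card, div_pow, Fintype.sum_pow]
    simp only [this, ← rs_conv2, ← Finset.sum_div]
    rw [div_div]
    congr 1
    ring
  by_cases hcase : 1 / 2 ≤ τ
  · -- dense case
    have hwa : w ≤ α * τ := by nlinarith
    have hw4 : w ^ 2 ≤ 1 / 4 := by nlinarith
    refine rs_core_dense f hf' (α * τ) e δ₁ δ₂ k hk (by positivity) (by nlinarith) he0 (by linarith)
      ?_ hδ₂0 ?_ ?_ hD
    · calc δ₁ ≤ w ^ (2 * k + 5) := hδ₁le _ (by omega)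
        _ = w * w ^ 2 * w ^ (2 * k + 2) := by ring
        _ ≤ e * (1 / 4) * (α * τ) ^ (2 * k + 2) := by gcongr
        _ = _ := by ring
    · calc δ₂ ≤ w ^ 5 := hδ₂le _ (by push_cast; linarith)
        _ = w * w ^ 2 * w ^ 2 := by ring
        _ ≤ e * (1 / 4) * (α * τ) ^ 2 := by gcongr
        _ = _ := by ring
    · intro g₁ g₂ h1 h2 h3 h4
      have := hN g₁ g₂ h1 h2 h3 h4
      rwa [← mul_assoc]
  · -- sparse case
    push Not at hcase
    set p := ⌈4 * L / e⌉₊ with hp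
    set q := ⌈1 / e⌉₊ with hq
    set N := (q + 9 + 4 * k) * (p + 1) + 2 * p + 3 with hNd
    have hpl : 4 * L / e ≤ p := Nat.le_ceil _
    have hql : 1 / e ≤ q := Nat.le_ceil _
    have hLe : 4 * L / e ≤ 8 * (ε⁻¹ * L) := by
      calc 4 * L / e = 4 * L * (1 / e) := by ring
        _ ≤ 4 * L * (2 * ε⁻¹) := by gcongr
        _ = _ := by ring
    have hpu : (p:ℝ) ≤ 10 * (ε⁻¹ * L) := by
      have := Nat.ceil_lt_add_one (a := 4 * L / e) (by positivity)
      linarith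
    have hqu : (q:ℝ) ≤ 3 * ε⁻¹ := by
      have := Nat.ceil_lt_add_one (a := 1 / e) (by positivity)
      linarith
    have hp0 : 0 < p := Nat.ceil_pos.mpr (by positivity)
    set ρ := e / 128 * α ^ 2 * (α / 2) ^ (2 * k) with hρ
    have hNle : (N:ℝ) ≤ 1000 * (ε⁻¹ ^ 2 * k * L ^ 2 + ε⁻¹ * k * Real.log (2 / τ)) := 
      rs_Nle ε⁻¹ L _ k p q N hk1 hi hL hLτ hiL hpu hqu hNd
    have ha1 : α * τ ≤ 1 := by nlinarith
    have hγN : γ ≤ (α * τ) ^ N := hγle.trans (rs_rpow_le _ _ N (by positivity) ha1 hNle)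
    obtain ⟨hγa, hγb⟩ := rs_param_gamma α e τ ρ γ k p q N hα0 hα1 hτ0 hcase he0 he2 hql hρ hNd hγN
    have hw7 : w ^ 7 ≤ 1 / 128 := by
      calc w ^ 7 ≤ (1 / 2) ^ 7 := by gcongr
        _ = _ := by norm_num
    have hδ₂p : δ₂ ≤ (α / 4) ^ p / 4 := by
      have hw4 : w ^ 2 ≤ 1 / 4 := by nlinarith
      have hwα4 : w ^ 2 ≤ α / 4 := by nlinarith
      calc δ₂ ≤ w ^ (2 * p + 2) := hδ₂le _ (by push_cast; linarith)
        _ = (w ^ 2) ^ p * w ^ 2 := by rw [← pow_mul]; ring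
        _ ≤ (α / 4) ^ p * (1 / 4) := by gcongr
        _ = _ := by ring
    refine rs_core_sparse f (fun x y => T.indicator (fun _ => (1 : ℝ)) (x, y)) hf' ?_ α e τ γ δ₁ δ₂ ρ
      k p hk hp0 hα0 hα1 hτ0 hτ1 he0 (by linarith) hγ0.le hρ ?_ ?_ ?_ ?_ hγa hγb hN ?_ hD
    · intro x y
      by_cases hxy : (x, y) ∈ T
      · simp only [Set.indicator_of_mem hxy]; exact (hf' x y).2
      · simp only [Set.indicator_of_notMem hxy]; exact (hfT x y hxy).le
    · calc δ₁ ≤ w ^ (2 * k + 10) := hδ₁le _ le_rfl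
        _ = w * w ^ 7 * w ^ 2 * w ^ (2 * k) := by ring
        _ ≤ e * (1 / 128) * α ^ 2 * (α / 2) ^ (2 * k) := by gcongr; linarith
        _ = _ := by rw [hρ]; ring
    · have := hδ₂le 0 (by push_cast; linarith)
      simpa using this
    · calc 2 ^ p * δ₂ ≤ 2 ^ p * ((α / 4) ^ p / 4) := by gcongr
        _ = (2 * (α / 4)) ^ p / 4 := by rw [mul_pow]; ring
        _ ≤ ((1 - e) * α) ^ p / 4 := by
          have h9 : 2 * (α / 4) ≤ (1 - e) * α := by nlinarith
          exact div_le_div_of_nonneg_right (pow_le_pow_left₀ (by positivity) h9 p) (by norm_num)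
    · exact rs_pow_lower α e p hα0 hα1 he0 he2 hpl
    · intro g₁ g₂ hg₁ hg₂
      have h1 := hT g₁ g₂ hg₁ hg₂
      rw [rs_conv2, ← Fintype.expect_eq_sum_div_card, ← Fintype.expect_eq_sum_div_card] at h1
      refine le_trans (le_of_eq ?_) h1
      exact Finset.expect_congr rfl fun x _ => Finset.expect_congr rfl fun y _ => by ring
end

section
/- Spectral positivity for grid norms: Let ε ∈ (0, 1/10), let k be an even positive integer, and let p = 36·⌈k/ε⁴⌉. Let Ω₁, Ω₂ be finite nonempty sets, let A : Ω₁ × Ω₂ → ℝ≥0 be a nonnegative function, and set α := E_{x∈Ω₁, y∈Ω₂}[A(x,y)]. Suppose that E_{x₁,x₂ ∈ Ω₁, y₁,…,y_k ∈ Ω₂}[∏_{i∈[2], j∈[k]} (A(x_i, y_j) − α)] ≥ (ε·α)^{2k}, and that for every x ∈ Ω₁ one has E_{y∈Ω₂}[A(x,y)] ≥ α − ε²·α/36. Then E_{x₁,x₂ ∈ Ω₁, y₁,…,y_p ∈ Ω₂}[∏_{i∈[2], j∈[p]} A(x_i, y_j)] ≥ ((1 + ε²/36)·α)^{2p}. 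-/
lemma sp_expand {X Y : Type*} [Fintype X] [Fintype Y] (g : X → Y → ℝ) (n : ℕ) :
    (∑ x : Fin 2 → X, ∑ y : Fin n → Y, ∏ i : Fin 2, ∏ j : Fin n, g (x i) (y j))
      = ∑ z : X × X, (∑ y, g z.1 y * g z.2 y) ^ n := by
  classical
  rw [← (finTwoArrowEquiv X).symm.sum_comp]
  refine Finset.sum_congr rfl fun z _ => ?_
  rw [Finset.sum_pow', Fintype.piFinset_univ]
  refine Finset.sum_congr rfl fun y _ => ?_
  rw [Fin.prod_univ_two, ← Finset.prod_mul_distrib]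
  simp [finTwoArrowEquiv]

lemma sp_nonneg {X Y : Type*} [Fintype X] [Fintype Y] (g : X → Y → ℝ) (n : ℕ) :
    0 ≤ ∑ z : X × X, (∑ y, g z.1 y * g z.2 y) ^ n := by
  classical
  have : ∑ z : X × X, (∑ y, g z.1 y * g z.2 y) ^ n
      = ∑ y : Fin n → Y, (∑ x, ∏ j, g x (y j)) * (∑ x, ∏ j, g x (y j)) := by
    simp_rw [Finset.sum_pow', Fintype.piFinset_univ]
    rw [Finset.sum_comm]
    refine Finset.sum_congr rfl fun y _ => ?_
    rw [Finset.sum_mul_sum, Fintype.sum_prod_type]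
    simp_rw [Finset.prod_mul_distrib]
  rw [this]
  exact Finset.sum_nonneg fun _ _ => mul_self_nonneg _

lemma sp_point (ε : ℝ) (h0 : 0 < ε) (h1 : ε < 1 / 10) (k : ℕ) (hk : 0 < k) (p : ℕ)
    (hp : p = 36 * ⌈(k : ℝ) / ε ^ 4⌉₊) (u : ℝ) (hu : 1 ≤ u) :
    (1 + ε ^ 2 * (7 / 36)) ^ p * u ^ (k + 1) ≤ (1 + ε ^ 2 * u / 4 - ε ^ 2 / 18) ^ p := by
  set B := 1 + ε ^ 2 * (7 / 36) with hB
  have he2 : 0 < ε ^ 2 := by positivity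
  have he2' : ε ^ 2 < 1 / 100 := by nlinarith
  have hBpos : 0 < B := by positivity
  set w := ε ^ 2 * (u - 1) / 4 / B with hw
  have hw0 : 0 ≤ w := by
    have : 0 ≤ u - 1 := by linarith
    positivity
  have e : 1 + ε ^ 2 * u / 4 - ε ^ 2 / 18 = B * (1 + w) := by
    rw [hw]; field_simp; rw [hB]; ring
  rw [e, mul_pow]
  refine mul_le_mul_of_nonneg_left ?_ (by positivity)
  set m := ⌈6 / ε ^ 2⌉₊ with hm
  have m1 : 6 / ε ^ 2 ≤ m := Nat.le_ceil _
  have m2 : (m : ℝ) < 6 / ε ^ 2 + 1 := Nat.ceil_lt_add_one (by positivity)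
  have m1' : 6 ≤ m * ε ^ 2 := by rwa [div_le_iff₀ he2] at m1
  have m2' : m * ε ^ 2 ≤ 7 := by
    have : (m:ℝ) * ε ^ 2 < (6 / ε ^ 2 + 1) * ε ^ 2 := mul_lt_mul_of_pos_right m2 he2
    have h3 : (6 / ε ^ 2 + 1) * ε ^ 2 = 6 + ε ^ 2 := by field_simp
    linarith
  have hk1 : (1:ℝ) ≤ k := by exact_mod_cast hk
  have hmp : m * (k + 1) ≤ p := by
    have hN : (k : ℝ) / ε ^ 4 ≤ (⌈(k : ℝ) / ε ^ 4⌉₊ : ℝ) := Nat.le_ceil _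
    have : ((m * (k + 1) : ℕ) : ℝ) ≤ p := by
      rw [hp]; push_cast
      have : (m : ℝ) * (k + 1) ≤ 36 * (k / ε ^ 4) := by
        rw [← mul_div_assoc, le_div_iff₀ (by positivity)]
        calc (m : ℝ) * (k + 1) * ε ^ 4 = (m * ε ^ 2) * (k + 1) * ε ^ 2 := by ring
          _ ≤ 7 * (2 * (k : ℝ)) * 1 := by
            gcongr <;> linarith
          _ ≤ _ := by linarith
      linarith
    exact_mod_cast this
  have hu1 : u ≤ (1 + w) ^ m := by
    have b := one_add_mul_le_pow (show (-2:ℝ) ≤ w by linarith) m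
    have : u - 1 ≤ m * w := by
      rw [hw, ← mul_div_assoc, le_div_iff₀ hBpos]
      have : (u - 1) * B ≤ (u - 1) * (m * ε ^ 2 / 4) := by
        refine mul_le_mul_of_nonneg_left ?_ (by linarith)
        rw [hB]; linarith
      linarith
    linarith
  calc u ^ (k + 1) ≤ ((1 + w) ^ m) ^ (k + 1) := by gcongr
    _ = (1 + w) ^ (m * (k + 1)) := by rw [pow_mul]
    _ ≤ _ := pow_le_pow_right₀ (by linarith) hmp

lemma sp_main (ε : ℝ) (h0 : 0 < ε) (h1 : ε < 1 / 10) (k : ℕ) (hk : 0 < k) (hkeven : Even k)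
    (p : ℕ) (hp : p = 36 * ⌈(k : ℝ) / ε ^ 4⌉₊) (α : ℝ) {I : Type*} [Fintype I] (u M : I → ℝ)
    (hM0 : ∀ i, 0 ≤ M i) (hM : ∀ i, α ^ 2 * (1 + ε ^ 2 * u i / 4 - ε ^ 2 / 18) ≤ M i)
    (hs : 4 ^ k * (Fintype.card I : ℝ) ≤ ∑ i, u i ^ k) (ho : 0 ≤ ∑ i, u i ^ (k + 1)) :
    ((1 + ε ^ 2 / 36) * α) ^ (2 * p) * Fintype.card I ≤ ∑ i, M i ^ p := by
  have he2 : 0 < ε ^ 2 := by positivity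
  have he2' : ε ^ 2 < 1 / 100 := by nlinarith
  set C := (α ^ 2) ^ p * (1 + ε ^ 2 * (7 / 36)) ^ p with hC
  have hC0 : 0 ≤ C := by positivity
  have key : ∀ i, C * ((u i ^ k - 1 + u i ^ (k + 1)) / 2 - 1) ≤ M i ^ p := by
    intro i
    by_cases hu : 1 ≤ u i
    · have h := sp_point ε h0 h1 k hk p hp (u i) hu
      have hle : u i ^ k ≤ u i ^ (k + 1) := pow_le_pow_right₀ hu (by omega)
      calc _ ≤ C * u i ^ (k + 1) := mul_le_mul_of_nonneg_left (by linarith) hC0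
        _ = (α ^ 2) ^ p * ((1 + ε ^ 2 * (7 / 36)) ^ p * u i ^ (k + 1)) := by rw [hC]; ring
        _ ≤ (α ^ 2) ^ p * (1 + ε ^ 2 * u i / 4 - ε ^ 2 / 18) ^ p := by gcongr
        _ = (α ^ 2 * (1 + ε ^ 2 * u i / 4 - ε ^ 2 / 18)) ^ p := by rw [mul_pow]
        _ ≤ _ := by
          refine pow_le_pow_left₀ ?_ (hM i) p
          have : ε ^ 2 ≤ ε ^ 2 * u i := le_mul_of_one_le_right he2.le hu
          have : 0 ≤ 1 + ε ^ 2 * u i / 4 - ε ^ 2 / 18 := by linarith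
          positivity
    · push Not at hu
      refine le_trans ?_ (pow_nonneg (hM0 i) p)
      refine mul_nonpos_of_nonneg_of_nonpos hC0 ?_
      have hk0 : 0 ≤ u i ^ k := hkeven.pow_nonneg _
      rw [pow_succ]
      by_cases hu' : u i ≤ -1
      · nlinarith
      · have : u i ^ k ≤ 1 := by
          rw [← hkeven.pow_abs]
          exact pow_le_one₀ (abs_nonneg _) (abs_le.2 ⟨by linarith, hu.le⟩)
        nlinarith
  have hsum := Finset.sum_le_sum fun i (_ : i ∈ Finset.univ) => key i
  refine le_trans ?_ hsum
  rw [← Finset.mul_sum, Finset.sum_sub_distrib, ← Finset.sum_div, Finset.sum_add_distrib,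
    Finset.sum_sub_distrib]
  simp only [Finset.sum_const, Finset.card_univ, nsmul_eq_mul, mul_one]
  set n := (Fintype.card I : ℝ)
  have hn : 0 ≤ n := Nat.cast_nonneg _
  have h4 : (4:ℝ) ^ 2 ≤ 4 ^ k := pow_le_pow_right₀ (by norm_num) (by
    obtain ⟨r, rfl⟩ := hkeven; omega)
  have h5 : 16 * n ≤ 4 ^ k * n := by nlinarith
  have hCC : ((1 + ε ^ 2 / 36) * α) ^ (2 * p) ≤ C := by
    rw [hC, pow_mul, ← mul_pow]
    refine pow_le_pow_left₀ (by positivity) ?_ p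
    rw [mul_pow, mul_comm]
    exact mul_le_mul_of_nonneg_left (by nlinarith) (by positivity)
  exact mul_le_mul hCC (by linarith) hn hC0

/-- Spectral positivity for grid norms (Lemma 4.2 of the paper). -/
theorem spectral_positivity
    (ε : ℝ) (hε : ε ∈ Set.Ioo (0 : ℝ) (1 / 10))
    (k : ℕ) (hk : 0 < k) (hkeven : Even k)
    (p : ℕ) (hp : p = 36 * ⌈(k : ℝ) / ε ^ 4⌉₊)
    (Ω₁ Ω₂ : Type*) [Fintype Ω₁] [Fintype Ω₂] [Nonempty Ω₁] [Nonempty Ω₂]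
    (A : Ω₁ → Ω₂ → ℝ) (hA : ∀ x y, 0 ≤ A x y)
    (α : ℝ)
    (hα : α = (∑ x : Ω₁, ∑ y : Ω₂, A x y) /
      ((Fintype.card Ω₁ : ℝ) * (Fintype.card Ω₂ : ℝ)))
    (hgrid : (ε * α) ^ (2 * k) ≤
      (∑ x : Fin 2 → Ω₁, ∑ y : Fin k → Ω₂,
          ∏ i : Fin 2, ∏ j : Fin k, (A (x i) (y j) - α)) /
        ((Fintype.card Ω₁ : ℝ) ^ 2 * (Fintype.card Ω₂ : ℝ) ^ k))
    (hrow : ∀ x : Ω₁,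
      α - ε ^ 2 * α / 36 ≤ (∑ y : Ω₂, A x y) / (Fintype.card Ω₂ : ℝ)) :
    ((1 + ε ^ 2 / 36) * α) ^ (2 * p) ≤
      (∑ x : Fin 2 → Ω₁, ∑ y : Fin p → Ω₂,
          ∏ i : Fin 2, ∏ j : Fin p, A (x i) (y j)) /
        ((Fintype.card Ω₁ : ℝ) ^ 2 * (Fintype.card Ω₂ : ℝ) ^ p) := by
  obtain ⟨h0, h1⟩ := hε
  have hc1 : (0:ℝ) < Fintype.card Ω₁ := by exact_mod_cast Fintype.card_pos
  have hc2 : (0:ℝ) < Fintype.card Ω₂ := by exact_mod_cast Fintype.card_pos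
  have hα0 : 0 ≤ α := by
    rw [hα]
    exact div_nonneg (Finset.sum_nonneg fun x _ => Finset.sum_nonneg fun y _ => hA x y)
      (by positivity)
  rw [sp_expand (fun x y => A x y - α)] at hgrid
  rw [sp_expand A]
  have hp0 : p ≠ 0 := by
    have hk' : (0:ℝ) < k := by exact_mod_cast hk
    have : 0 < ⌈(k : ℝ) / ε ^ 4⌉₊ := Nat.ceil_pos.2 (by positivity)
    omega
  rcases hα0.eq_or_lt with hz | hpos
  · rw [← hz, mul_zero, zero_pow (by omega)]
    refine div_nonneg (Finset.sum_nonneg fun z _ => pow_nonneg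
      (Finset.sum_nonneg fun y _ => mul_nonneg (hA _ _) (hA _ _)) _) (by positivity)
  set n₂ := (Fintype.card Ω₂ : ℝ) with hn2
  set c := 4 / (ε ^ 2 * α ^ 2 * n₂) with hc
  have hcpos : 0 < c := by positivity
  have hcard : (Fintype.card (Ω₁ × Ω₁) : ℝ) = (Fintype.card Ω₁ : ℝ) ^ 2 := by
    rw [Fintype.card_prod]; push_cast; ring
  have main := sp_main ε h0 h1 k hk hkeven p hp α (I := Ω₁ × Ω₁)
    (fun z => c * ∑ y, (A z.1 y - α) * (A z.2 y - α))
    (fun z => (∑ y, A z.1 y * A z.2 y) / n₂)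
    (fun z => div_nonneg (Finset.sum_nonneg fun y _ => mul_nonneg (hA _ _) (hA _ _)) hc2.le)
    ?_ ?_ ?_
  · rw [le_div_iff₀ (by positivity)]
    rw [hcard] at main
    simp_rw [div_pow] at main
    rw [← Finset.sum_div, le_div_iff₀ (by positivity)] at main
    rw [← mul_assoc]; exact main
  · rintro ⟨x, x'⟩
    have r1 := hrow x
    have r2 := hrow x'
    have e : ∑ y, (A x y - α) * (A x' y - α)
        = ∑ y, A x y * A x' y - α * ∑ y, A x y - α * ∑ y, A x' y + n₂ * α ^ 2 := by
      have : ∀ y, (A x y - α) * (A x' y - α)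
        = A x y * A x' y - α * A x y - α * A x' y + α ^ 2 := fun y => by ring
      simp_rw [this]
      rw [Finset.sum_add_distrib, Finset.sum_sub_distrib, Finset.sum_sub_distrib,
        ← Finset.mul_sum, ← Finset.mul_sum]
      simp [hn2]
    dsimp only
    rw [e]
    have e2 : α ^ 2 * (1 + ε ^ 2 * (c * (∑ y, A x y * A x' y - α * ∑ y, A x y
          - α * ∑ y, A x' y + n₂ * α ^ 2)) / 4 - ε ^ 2 / 18)
        = (∑ y, A x y * A x' y) / n₂ + α * ((α - ε ^ 2 * α / 36) - (∑ y, A x y) / n₂)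
          + α * ((α - ε ^ 2 * α / 36) - (∑ y, A x' y) / n₂) := by
      rw [hc]; field_simp; ring
    rw [e2]
    nlinarith
  · rw [hcard]
    simp_rw [mul_pow]
    rw [← Finset.mul_sum]
    rw [le_div_iff₀ (by positivity)] at hgrid
    have := mul_le_mul_of_nonneg_left hgrid (pow_nonneg hcpos.le k)
    refine le_trans (le_of_eq ?_) this
    have e3 : (4:ℝ) ^ k = c ^ k * ((ε * α) ^ (2 * k) * n₂ ^ k) := by
      rw [pow_mul, ← mul_pow, ← mul_pow, hc]
      congr 1; field_simp
    rw [e3]; ring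
  · simp_rw [mul_pow]
    rw [← Finset.mul_sum]
    exact mul_nonneg (pow_nonneg hcpos.le _) (sp_nonneg (fun x y => A x y - α) (k + 1))
end

section
/- There exists a constant C > 0 such that the following holds. Let ε, τ, γ ∈ (0, 1/2) and let r be an integer with r ≥ C·ε^{-7}·log(2/τ)·(log(2/γ))^7. Let W be a linear subspace of 𝔽₂ⁿ, let D ⊆ W be nonempty with τ = |D|/|W|, and define T := {(x, y) ∈ W × W : x + y ∈ D}. If D is (r, ε/8)-algebraically spread within W, then T is ((1+ε)·τ, γ)-combinatorially spread as a subset of W × W. -/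
open scoped Classical

/-- A subset `X` of the linear subspace `W ⊆ 𝔽₂ⁿ` is `(r, ε)`-algebraically spread
within `W` if `X` has no density increment on any affine subspace of `W` of
codimension at most `r` (Definition 5.1 of the paper). -/
def AlgebraicallySpread (n : ℕ) (W : Submodule (ZMod 2) (Fin n → ZMod 2))
    (X : Set (Fin n → ZMod 2)) (r : ℕ) (ε : ℝ) : Prop :=
  ∀ (W' : Submodule (ZMod 2) (Fin n → ZMod 2)) (a : Fin n → ZMod 2),
    ((a + ·) '' (W' : Set (Fin n → ZMod 2))) ⊆ (W : Set (Fin n → ZMod 2)) →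
    Module.finrank (ZMod 2) W ≤ Module.finrank (ZMod 2) W' + r →
    (Nat.card ↥(X ∩ ((a + ·) '' (W' : Set (Fin n → ZMod 2)))) : ℝ) / (Nat.card ↥W' : ℝ) ≤
      (1 + ε) * ((Nat.card ↥X : ℝ) / (Nat.card ↥W : ℝ))


section Helpers

set_option linter.all false

open Finset

lemma exp_mul_le_cosh (s x : ℝ) (h1 : -1 ≤ x) (h2 : x ≤ 1) :
    Real.exp (s * x) ≤ Real.cosh s + x * Real.sinh s := by
  have h := convexOn_exp.2 (Set.mem_univ s) (Set.mem_univ (-s))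
    (show 0 ≤ (1 + x) / 2 by linarith) (show 0 ≤ (1 - x) / 2 by linarith) (by ring)
  simp only [smul_eq_mul] at h
  have e : (1 + x) / 2 * s + (1 - x) / 2 * -s = s * x := by ring
  rw [e] at h
  rw [Real.cosh_eq, Real.sinh_eq]
  linarith

lemma mgf_one {ι : Type*} (A : Finset ι) (hA : A.Nonempty) (h : ι → ℝ)
    (h0 : ∀ u, 0 ≤ h u) (h1 : ∀ u, h u ≤ 1) (s : ℝ) :
    ∑ u ∈ A, Real.exp (s * ((∑ v ∈ A, h v) / A.card - h u)) ≤
      A.card * Real.exp (s ^ 2 / 2) := by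
  have hc : (0 : ℝ) < A.card := by exact_mod_cast hA.card_pos
  set F := (∑ v ∈ A, h v) / A.card with hF
  have hF0 : 0 ≤ F := div_nonneg (sum_nonneg fun i _ => h0 i) hc.le
  have hF1 : F ≤ 1 := by
    rw [hF, div_le_one hc]
    calc _ ≤ ∑ v ∈ A, (1 : ℝ) := sum_le_sum fun i _ => h1 i
      _ = _ := by simp
  calc _ ≤ ∑ u ∈ A, (Real.cosh s + (F - h u) * Real.sinh s) :=
        sum_le_sum fun u _ => exp_mul_le_cosh s _ (by linarith [h1 u]) (by linarith [h0 u])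
    _ = A.card * Real.cosh s := by
        rw [sum_add_distrib, ← sum_mul, sum_sub_distrib]
        have : ∑ v ∈ A, h v = A.card * F := by rw [hF]; field_simp
        rw [this]; simp
    _ ≤ _ := by gcongr; exact Real.cosh_le_exp_half_sq s

lemma mgf_avg {ι : Type*} (A : Finset ι) (hA : A.Nonempty) (h : ι → ℝ)
    (h0 : ∀ u, 0 ≤ h u) (h1 : ∀ u, h u ≤ 1) (m : ℕ) (hm : 0 < m) (l : ℝ) :
    ∑ a ∈ Fintype.piFinset (fun _ : Fin m => A),
      Real.exp (2 * l * ((∑ v ∈ A, h v) / A.card - (∑ i, h (a i)) / m)) ≤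
      (A.card : ℝ) ^ m * Real.exp (2 * l ^ 2 / m) := by
  have hm' : (0 : ℝ) < m := by exact_mod_cast hm
  set F := (∑ v ∈ A, h v) / A.card with hF
  have e : ∀ a : Fin m → ι, Real.exp (2 * l * (F - (∑ i, h (a i)) / m)) =
      ∏ i, Real.exp ((2 * l / m) * (F - h (a i))) := by
    intro a
    rw [← Real.exp_sum]
    congr 1
    rw [← mul_sum, sum_sub_distrib]
    simp
    field_simp
  simp_rw [e]
  rw [← Finset.sum_pow' A (fun u => Real.exp ((2 * l / m) * (F - h u))) m]
  calc _ ≤ (A.card * Real.exp ((2 * l / m) ^ 2 / 2)) ^ m := by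
        apply pow_le_pow_left₀ (sum_nonneg fun _ _ => (Real.exp_pos _).le)
        exact mgf_one A hA h h0 h1 _
    _ = _ := by
        rw [mul_pow, ← Real.exp_nat_mul]
        congr 2
        field_simp
        

variable {G : Type*} [AddCommGroup G] [Module (ZMod 2) G] [Fintype G]

lemma add_add_self (x y : G) : x + y + y = x := by
  rw [add_assoc, ZModModule.add_self, add_zero]

/-- The set of diagonal shifts that keep `a` inside `A ^ m`. -/
noncomputable def Zset (A : Finset G) {m : ℕ} (a : Fin m → G) : Finset G :=
  univ.filter (fun z => ∀ i, a i + z ∈ A)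

/-- Joint weight of a tuple and a shift. -/
noncomputable def kap (A : Finset G) {m : ℕ} (a : Fin m → G) (t : G) : ℝ :=
  if (∀ i, a i ∈ A) ∧ (∀ i, a i + t ∈ A) then
    ((A.card : ℝ) ^ m * ((Zset A a).card : ℝ))⁻¹ else 0

/-- The law of the random shift. -/
noncomputable def nu (A : Finset G) (m : ℕ) (t : G) : ℝ := ∑ a : Fin m → G, kap A a t

lemma kap_nonneg (A : Finset G) {m : ℕ} (a : Fin m → G) (t : G) : 0 ≤ kap A a t := by
  unfold kap; split_ifs <;> positivity

lemma nu_nonneg (A : Finset G) (m : ℕ) (t : G) : 0 ≤ nu A m t :=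
  sum_nonneg fun a _ => kap_nonneg A a t

lemma Zset_card_shift (A : Finset G) {m : ℕ} (a : Fin m → G) (t : G) :
    (Zset A (a + fun _ => t)).card = (Zset A a).card := by
  apply Finset.card_bij (fun z _ => z + t)
  · intro z hz
    simp only [Zset, mem_filter, mem_univ, true_and, Pi.add_apply] at hz ⊢
    intro i
    have := hz i
    rwa [add_assoc, add_comm t z] at this
  · intro z _ w _ h
    exact add_right_cancel h
  · intro z hz
    refine ⟨z + t, ?_, add_add_self z t⟩
    simp only [Zset, mem_filter, mem_univ, true_and, Pi.add_apply] at hz ⊢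
    intro i
    have := hz i
    rwa [add_assoc, add_comm t, add_add_self]

lemma kap_symm (A : Finset G) {m : ℕ} (a : Fin m → G) (t : G) :
    kap A (a + fun _ => t) t = kap A a t := by
  unfold kap
  rw [Zset_card_shift]
  congr 1
  simp only [Pi.add_apply, add_add_self, eq_iff_iff]
  exact and_comm

lemma kap_sum (A : Finset G) {m : ℕ} (a : Fin m → G) :
    ∑ t, kap A a t = if (∀ i, a i ∈ A) then ((A.card : ℝ) ^ m)⁻¹ else 0 := by
  unfold kap
  split_ifs with h
  · simp only [h, implies_true, true_and]
    have hz : (0 : ℝ) < (Zset A a).card := by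
      have : (0 : G) ∈ Zset A a := by simp [Zset, h]
      exact_mod_cast Finset.card_pos.2 ⟨_, this⟩
    rw [← Finset.sum_filter, Finset.sum_const, nsmul_eq_mul]
    change ((Zset A a).card : ℝ) * _ = _
    rw [mul_inv]; field_simp
  · simp [h]

lemma sum_pi_ite {ι : Type*} [Fintype ι] (A : Finset ι) (m : ℕ) (g : (Fin m → ι) → ℝ) :
    ∑ a : Fin m → ι, (if (∀ i, a i ∈ A) then g a else 0) =
      ∑ a ∈ Fintype.piFinset (fun _ : Fin m => A), g a := by
  rw [← Finset.sum_filter]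
  apply Finset.sum_congr _ (fun _ _ => rfl)
  ext a; simp

lemma nu_sum (A : Finset G) (hA : A.Nonempty) (m : ℕ) : ∑ t, nu A m t = 1 := by
  have hc : (0 : ℝ) < A.card := by exact_mod_cast hA.card_pos
  unfold nu
  rw [Finset.sum_comm]
  simp_rw [kap_sum]
  rw [sum_pi_ite]
  simp only [sum_const, Fintype.card_piFinset, prod_const, card_univ, Fintype.card_fin,
    nsmul_eq_mul, Nat.cast_pow]
  field_simp

lemma nu_le (A : Finset G) (hA : A.Nonempty) (m : ℕ) (t : G) :
    (Fintype.card G : ℝ) * nu A m t ≤ ((Fintype.card G : ℝ) / A.card) ^ m := by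
  have hc : (0 : ℝ) < A.card := by exact_mod_cast hA.card_pos
  set k : (Fin m → G) → ℝ := fun a => if (∀ i, a i ∈ A) then
    ((A.card : ℝ) ^ m * ((Zset A a).card : ℝ))⁻¹ else 0 with hk
  have h1 : nu A m t ≤ ∑ a, k a := by
    apply sum_le_sum
    intro a _
    simp only [kap, hk]
    by_cases h : ∀ i, a i ∈ A
    · simp only [h, true_and, implies_true, if_true]
      split_ifs
      · rfl
      · positivity
    · simp [h]
  calc _ ≤ (Fintype.card G : ℝ) * ∑ a, k a := by gcongr
    _ = ∑ w : G, ∑ a, k a := by simp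
    _ = ∑ w : G, ∑ a, k (a + fun _ => w) := by
        apply sum_congr rfl
        intro w _
        exact (Equiv.sum_comp (Equiv.addRight (fun _ : Fin m => w)) k).symm
    _ = ∑ a, ∑ w : G, k (a + fun _ => w) := Finset.sum_comm
    _ ≤ ∑ a : Fin m → G, ((A.card : ℝ) ^ m)⁻¹ := by
        apply sum_le_sum
        intro a _
        simp only [hk, Zset_card_shift, Pi.add_apply]
        rw [← Finset.sum_filter, Finset.sum_const, nsmul_eq_mul]
        change ((Zset A a).card : ℝ) * _ ≤ _
        by_cases hz : ((Zset A a).card : ℝ) = 0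
        · rw [hz]; simp; 
        · rw [mul_inv]; apply le_of_eq; field_simp
    _ = _ := by
        simp [div_pow, div_eq_mul_inv, mul_pow]


/-- Iterated convolution powers of a weight function. -/
noncomputable def cpow (v : G → ℝ) : ℕ → G → ℝ
  | 0 => fun t => if t = 0 then 1 else 0
  | j + 1 => fun t => ∑ s, v s * cpow v j (t + s)

lemma cpow_nonneg (v : G → ℝ) (hv : ∀ t, 0 ≤ v t) (j : ℕ) (t : G) : 0 ≤ cpow v j t := by
  induction j generalizing t with
  | zero => unfold cpow; split_ifs <;> norm_num
  | succ j ih => exact sum_nonneg fun s _ => mul_nonneg (hv s) (ih _)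

lemma cpow_succ_sum (v : G → ℝ) (j : ℕ) (g : G → ℝ) :
    ∑ t, cpow v (j + 1) t * g t = ∑ s, v s * ∑ t, cpow v j t * g (s + t) := by
  simp only [cpow, sum_mul, mul_sum]
  rw [Finset.sum_comm]
  apply sum_congr rfl
  intro s _
  rw [← Equiv.sum_comp (Equiv.addRight s)]
  apply sum_congr rfl
  intro t _
  simp only [Equiv.coe_addRight, add_add_self]
  rw [add_comm t s]; ring

lemma cpow_sum (v : G → ℝ) (hv : ∑ t, v t = 1) (j : ℕ) : ∑ t, cpow v j t = 1 := by
  induction j with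
  | zero => simp [cpow]
  | succ j ih =>
    have := cpow_succ_sum v j (fun _ => 1)
    simp only [mul_one] at this
    rw [this, ih]; simpa using hv

section AP

variable (A : Finset G) (l m : ℕ) (S : (Fin l → G) → G → ℝ)

/-- Average of the test over the set `A`. -/
noncomputable def FA (s : Fin l → G) : ℝ := (∑ u ∈ A, S s u) / A.card

/-- Exponential moment function along the walk. -/
noncomputable def Theta (lam : ℝ) (j : ℕ) (s : Fin l → G) : ℝ :=
  ∑ t, cpow (nu A m) j t * Real.exp (lam * (FA A l S s - FA A l S (s + fun _ => t)))

lemma Theta_succ (lam : ℝ) (j : ℕ) (s : Fin l → G) :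
    Theta A l m S lam (j + 1) s = ∑ t, nu A m t *
      (Real.exp (lam * (FA A l S s - FA A l S (s + fun _ => t))) *
        Theta A l m S lam j (s + fun _ => t)) := by
  unfold Theta
  rw [cpow_succ_sum]
  apply sum_congr rfl
  intro r _
  congr 1
  rw [mul_sum]
  apply sum_congr rfl
  intro t _
  have : (s + fun _ => r + t) = ((s + fun _ => r) + fun _ => t) := by
    ext i; simp [add_assoc]
  rw [this, mul_left_comm, ← Real.exp_add]
  congr 2; ring

variable {A l m S}

lemma mgf_kap (hA : A.Nonempty) (hm : 0 < m) (h0 : ∀ s u, 0 ≤ S s u) (h1 : ∀ s u, S s u ≤ 1)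
    (lam : ℝ) (s : Fin l → G) :
    ∑ a : Fin m → G, (if (∀ i, a i ∈ A) then ((A.card : ℝ) ^ m)⁻¹ else 0) *
      Real.exp (2 * lam * (FA A l S s - (∑ i, S s (a i)) / m)) ≤ Real.exp (2 * lam ^ 2 / m) := by
  have hc : (0 : ℝ) < A.card := by exact_mod_cast hA.card_pos
  simp only [ite_mul, zero_mul]
  rw [sum_pi_ite, ← mul_sum]
  have := mgf_avg A hA (S s) (h0 s) (h1 s) m hm lam
  rw [inv_mul_le_iff₀ (by positivity)]
  exact this

lemma step_bound (hA : A.Nonempty) (hm : 0 < m) (h0 : ∀ s u, 0 ≤ S s u)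
    (h1 : ∀ s u, S s u ≤ 1) (hS : ∀ s u t, S (s + fun _ => t) (u + t) = S s u)
    (lam : ℝ) (Φ Ψ : (Fin l → G) → ℝ) :
    ∑ s, Φ s * ∑ t, nu A m t *
      (Real.exp (lam * (FA A l S s - FA A l S (s + fun _ => t))) * Ψ (s + fun _ => t)) ≤
      1 / 2 * (∑ s, Φ s ^ 2) + 1 / 2 * (Real.exp (2 * lam ^ 2 / m)) ^ 2 * ∑ s, Ψ s ^ 2 := by
  set C := Real.exp (2 * lam ^ 2 / m) with hC
  have hC0 : 0 < C := Real.exp_pos _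
  set F := FA A l S with hF
  set N : (Fin l → G) → (Fin m → G) → ℝ := fun s a => (∑ i, S s (a i)) / m with hN
  have hNs : ∀ s a t, N (s + fun _ => t) (a + fun _ => t) = N s a := by
    intro s a t; simp [hN, hS]
  have key : ∀ s t a, kap A a t * (Φ s * (Real.exp (lam * (F s - F (s + fun _ => t))) *
      Ψ (s + fun _ => t))) ≤ kap A a t * (1 / 2 * C⁻¹ * (Φ s ^ 2 *
        Real.exp (2 * lam * (F s - N s a)))) + kap A (a + fun _ => t) t *
        (1 / 2 * C * (Ψ (s + fun _ => t) ^ 2 * Real.exp (2 * (-lam) * (F (s + fun _ => t) -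
          N (s + fun _ => t) (a + fun _ => t))))) := by
    intro s t a
    rw [kap_symm, ← mul_add]
    apply mul_le_mul_of_nonneg_left _ (kap_nonneg _ _ _)
    rw [hNs]
    set x := F s - N s a
    set y := F (s + fun _ => t) - N s a
    have e1 : Real.exp (lam * (F s - F (s + fun _ => t))) =
        Real.exp (lam * x) * Real.exp (-lam * y) := by
      rw [← Real.exp_add]; congr 1; simp only [x, y]; ring
    have e2 : Real.exp (2 * lam * x) = Real.exp (lam * x) ^ 2 := by
      rw [← Real.exp_nat_mul]; congr 1; push_cast; ring
    have e3 : Real.exp (2 * (-lam) * y) = Real.exp (-lam * y) ^ 2 := by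
      rw [← Real.exp_nat_mul]; congr 1; push_cast; ring
    rw [e1, e2, e3]
    set p := Φ s * Real.exp (lam * x)
    set q := Ψ (s + fun _ => t) * Real.exp (-lam * y)
    have : p * q ≤ 1 / 2 * C⁻¹ * p ^ 2 + 1 / 2 * C * q ^ 2 := by
      have h : 0 ≤ C⁻¹ * (p - C * q) ^ 2 := by positivity
      have h' : C⁻¹ * (p - C * q) ^ 2 = C⁻¹ * p ^ 2 - 2 * (p * q) + C * q ^ 2 := by
        field_simp; ring
      linarith
    calc _ = p * q := by simp only [p, q]; ring
      _ ≤ _ := this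
      _ = _ := by simp only [p, q]; ring
  have i1 : ∑ s, ∑ t, ∑ a : Fin m → G, kap A a t * (1 / 2 * C⁻¹ * (Φ s ^ 2 *
        Real.exp (2 * lam * (F s - N s a)))) ≤ 1 / 2 * (∑ s, Φ s ^ 2) := by
    rw [mul_sum]
    apply sum_le_sum
    intro s _
    rw [Finset.sum_comm]
    simp_rw [← sum_mul, kap_sum]
    have := mgf_kap hA hm h0 h1 lam s
    calc _ = 1 / 2 * C⁻¹ * Φ s ^ 2 * ∑ a : Fin m → G,
          (if (∀ i, a i ∈ A) then ((A.card : ℝ) ^ m)⁻¹ else 0) *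
          Real.exp (2 * lam * (F s - N s a)) := by
          rw [mul_sum]; apply sum_congr rfl; intro a _; ring
      _ ≤ 1 / 2 * C⁻¹ * Φ s ^ 2 * C := by gcongr
      _ = _ := by field_simp
  have i2 : ∑ s, ∑ t, ∑ a : Fin m → G, kap A (a + fun _ => t) t *
        (1 / 2 * C * (Ψ (s + fun _ => t) ^ 2 * Real.exp (2 * (-lam) * (F (s + fun _ => t) -
          N (s + fun _ => t) (a + fun _ => t))))) ≤ 1 / 2 * C ^ 2 * (∑ s, Ψ s ^ 2) := by
    have e : ∀ t : G, ∑ s, ∑ a : Fin m → G, kap A (a + fun _ => t) t *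
        (1 / 2 * C * (Ψ (s + fun _ => t) ^ 2 * Real.exp (2 * (-lam) * (F (s + fun _ => t) -
          N (s + fun _ => t) (a + fun _ => t))))) = ∑ s, ∑ a : Fin m → G, kap A a t *
        (1 / 2 * C * (Ψ s ^ 2 * Real.exp (2 * (-lam) * (F s - N s a)))) := by
      intro t
      rw [← Equiv.sum_comp (Equiv.addRight (fun _ : Fin l => t)) (fun s =>
        ∑ a : Fin m → G, kap A a t *
        (1 / 2 * C * (Ψ s ^ 2 * Real.exp (2 * (-lam) * (F s - N s a)))))]
      apply sum_congr rfl
      intro s _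
      rw [← Equiv.sum_comp (Equiv.addRight (fun _ : Fin m => t)) (fun a => kap A a t *
        (1 / 2 * C * (Ψ ((Equiv.addRight (fun _ : Fin l => t)) s) ^ 2 * Real.exp (2 * (-lam) *
          (F ((Equiv.addRight (fun _ : Fin l => t)) s) -
          N ((Equiv.addRight (fun _ : Fin l => t)) s) a)))))]
      rfl
    rw [Finset.sum_comm]
    simp_rw [e]
    rw [Finset.sum_comm, mul_sum]
    apply sum_le_sum
    intro s _
    rw [Finset.sum_comm]
    simp_rw [← sum_mul, kap_sum]
    have := mgf_kap hA hm h0 h1 (-lam) s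
    calc _ = 1 / 2 * C * Ψ s ^ 2 * ∑ a : Fin m → G,
          (if (∀ i, a i ∈ A) then ((A.card : ℝ) ^ m)⁻¹ else 0) *
          Real.exp (2 * (-lam) * (F s - N s a)) := by
          rw [mul_sum]; apply sum_congr rfl; intro a _; ring
      _ ≤ 1 / 2 * C * Ψ s ^ 2 * C := by
          gcongr
          rw [neg_sq] at this; exact this
      _ = _ := by ring
  calc _ = ∑ s, ∑ t, ∑ a : Fin m → G, kap A a t * (Φ s * (Real.exp (lam * (F s -
        F (s + fun _ => t))) * Ψ (s + fun _ => t))) := by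
        apply sum_congr rfl; intro s _
        rw [mul_sum]
        apply sum_congr rfl; intro t _
        rw [nu, sum_mul, mul_sum]
        apply sum_congr rfl; intro a _
        ring
    _ ≤ _ := sum_le_sum fun s _ => sum_le_sum fun t _ => sum_le_sum fun a _ => key s t a
    _ = _ := by simp only [sum_add_distrib]
    _ ≤ _ := add_le_add i1 i2

lemma Theta_sq (hA : A.Nonempty) (hm : 0 < m) (h0 : ∀ s u, 0 ≤ S s u)
    (h1 : ∀ s u, S s u ≤ 1) (hS : ∀ s u t, S (s + fun _ => t) (u + t) = S s u)
    (lam : ℝ) (j : ℕ) :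
    ∑ s, Theta A l m S lam j s ^ 2 ≤
      (Real.exp (2 * lam ^ 2 / m)) ^ (2 * j) * (Fintype.card G : ℝ) ^ l := by
  induction j with
  | zero =>
    have : ∀ s, Theta A l m S lam 0 s = 1 := by
      intro s
      unfold Theta
      simp only [cpow, ite_mul, one_mul, zero_mul, sum_ite_eq', mem_univ, if_true]
      have : (s + fun _ => (0 : G)) = s := by ext i; simp
      rw [this]; simp
    simp [this]
  | succ j ih =>
    have h := step_bound hA hm h0 h1 hS lam (Theta A l m S lam (j + 1)) (Theta A l m S lam j)
    simp_rw [← Theta_succ] at h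
    simp_rw [← sq] at h
    set C := Real.exp (2 * lam ^ 2 / m)
    have : ∑ s, Theta A l m S lam (j + 1) s ^ 2 ≤ C ^ 2 * ∑ s, Theta A l m S lam j s ^ 2 := by
      linarith
    calc _ ≤ _ := this
      _ ≤ C ^ 2 * (C ^ (2 * j) * (Fintype.card G : ℝ) ^ l) := by gcongr
      _ = _ := by ring

/-- Almost periodicity: averaging over the random walk hardly changes the test. -/
lemma almost_periodic (hA : A.Nonempty) (hm : 0 < m) (h0 : ∀ s u, 0 ≤ S s u)
    (h1 : ∀ s u, S s u ≤ 1) (hS : ∀ s u t, S (s + fun _ => t) (u + t) = S s u)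
    (lam : ℝ) (hl : 0 < lam) (M : ℕ) :
    ∑ x ∈ Fintype.piFinset (fun _ : Fin l => A), (FA A l S x -
      ∑ t, cpow (nu A m) M t * FA A l S (x + fun _ => t)) ≤
      (A.card : ℝ) ^ l * ((l * Real.log ((Fintype.card G : ℝ) / A.card) +
        4 * M * lam ^ 2 / m) / (2 * lam)) := by
  have hc : (0 : ℝ) < A.card := by exact_mod_cast hA.card_pos
  have hN : (0 : ℝ) < Fintype.card G := by
    exact_mod_cast Fintype.card_pos_iff.2 ⟨0⟩
  set F := FA A l S with hF
  set w := cpow (nu A m) M with hw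
  have hw0 : ∀ t, 0 ≤ w t := cpow_nonneg _ (nu_nonneg A m) M
  have hw1 : ∑ t, w t = 1 := cpow_sum _ (nu_sum A hA m) M
  set R := l * Real.log ((Fintype.card G : ℝ) / A.card) + 4 * M * lam ^ 2 / m with hR
  set d : (Fin l → G) → ℝ := fun x => F x - ∑ t, w t * F (x + fun _ => t) with hd
  have hJ : ∀ x, Real.exp (lam * d x) ≤ Theta A l m S lam M x := by
    intro x
    have := convexOn_exp.map_sum_le (t := (univ : Finset G)) (w := w)
      (p := fun t => lam * (F x - F (x + fun _ => t))) (fun t _ => hw0 t) hw1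
      (fun _ _ => Set.mem_univ _)
    simp only [smul_eq_mul] at this
    have e : lam * d x = ∑ t, w t * (lam * (F x - F (x + fun _ => t))) := by
      have e2 : ∀ t, w t * (lam * (F x - F (x + fun _ => t))) =
          w t * (lam * F x) - lam * (w t * F (x + fun _ => t)) := fun t => by ring
      simp only [e2]
      rw [sum_sub_distrib, ← sum_mul, hw1, ← mul_sum]
      simp only [hd]; ring
    rw [e]
    exact this
  have hER : Real.exp R = ((Fintype.card G : ℝ) / A.card) ^ l *
      (Real.exp (2 * lam ^ 2 / m)) ^ (2 * M) := by
    rw [hR, Real.exp_add, Real.exp_nat_mul, Real.exp_log (by positivity), ← Real.exp_nat_mul]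
    congr 2; push_cast; ring
  have h2 : ∑ x ∈ Fintype.piFinset (fun _ : Fin l => A), Real.exp (2 * lam * d x) ≤
      (A.card : ℝ) ^ l * Real.exp R := by
    calc _ ≤ ∑ x ∈ Fintype.piFinset (fun _ : Fin l => A), Theta A l m S lam M x ^ 2 := by
          apply sum_le_sum
          intro x _
          have : Real.exp (2 * lam * d x) = Real.exp (lam * d x) ^ 2 := by
            rw [← Real.exp_nat_mul]; congr 1; push_cast; ring
          rw [this]
          exact pow_le_pow_left₀ (Real.exp_pos _).le (hJ x) 2
      _ ≤ ∑ x, Theta A l m S lam M x ^ 2 :=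
          sum_le_sum_of_subset_of_nonneg (subset_univ _) fun _ _ _ => sq_nonneg _
      _ ≤ _ := Theta_sq hA hm h0 h1 hS lam M
      _ = _ := by rw [hER, div_pow]; field_simp
  have h3 : ∑ x ∈ Fintype.piFinset (fun _ : Fin l => A), (1 + (2 * lam * d x - R)) ≤
      (A.card : ℝ) ^ l := by
    calc _ ≤ ∑ x ∈ Fintype.piFinset (fun _ : Fin l => A),
          Real.exp (2 * lam * d x) * Real.exp (-R) := by
          apply sum_le_sum
          intro x _
          rw [← Real.exp_add]
          have := Real.add_one_le_exp (2 * lam * d x + -R)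
          linarith
      _ ≤ (A.card : ℝ) ^ l * Real.exp R * Real.exp (-R) := by
          rw [← sum_mul]; gcongr
      _ = _ := by rw [mul_assoc, ← Real.exp_add]; simp
  rw [sum_add_distrib, sum_sub_distrib, ← mul_sum] at h3
  simp only [sum_const, Fintype.card_piFinset, prod_const, card_univ, Fintype.card_fin,
    nsmul_eq_mul, Nat.cast_pow, mul_one] at h3
  rw [mul_div_assoc', le_div_iff₀ (by positivity)]
  linarith

end AP

/-- Real character attached to a linear functional. -/
noncomputable def chi (ξ : Module.Dual (ZMod 2) G) (x : G) : ℝ := if ξ x = 0 then 1 else -1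

lemma zmod2_ne {a : ZMod 2} (h : a ≠ 0) : a = 1 := by
  revert a; decide

lemma chi_add (ξ : Module.Dual (ZMod 2) G) (x y : G) : chi ξ (x + y) = chi ξ x * chi ξ y := by
  unfold chi
  rw [map_add]
  by_cases h : ξ x = 0 <;> by_cases h' : ξ y = 0
  · simp [h, h']
  · simp [h, h']
  · simp [h, h']
  · rw [zmod2_ne h, zmod2_ne h']
    have : (1 : ZMod 2) + 1 = 0 := by decide
    simp [this]

lemma chi_add_left (ξ η : Module.Dual (ZMod 2) G) (x : G) :
    chi (ξ + η) x = chi ξ x * chi η x := by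
  unfold chi
  rw [LinearMap.add_apply]
  by_cases h : ξ x = 0 <;> by_cases h' : η x = 0
  · simp [h, h']
  · simp [h, h']
  · simp [h, h']
  · rw [zmod2_ne h, zmod2_ne h']
    have : (1 : ZMod 2) + 1 = 0 := by decide
    simp [this]

lemma chi_abs (ξ : Module.Dual (ZMod 2) G) (x : G) : |chi ξ x| = 1 := by
  unfold chi; split_ifs <;> simp

lemma chi_sum_ne {ξ : Module.Dual (ZMod 2) G} (h : ξ ≠ 0) : ∑ x, chi ξ x = 0 := by
  obtain ⟨y, hy⟩ : ∃ y, ξ y ≠ 0 := by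
    by_contra hh; push Not at hh; exact h (LinearMap.ext hh)
  have : ∑ x, chi ξ x = ∑ x, chi ξ (x + y) :=
    (Equiv.sum_comp (Equiv.addRight y) (fun x => chi ξ x)).symm
  have h2 : chi ξ y = -1 := by simp [chi, hy]
  simp_rw [chi_add, h2] at this
  rw [← sum_mul] at this
  linarith

lemma dual_finite : Finite (Module.Dual (ZMod 2) G) :=
  Finite.of_injective (fun ξ : Module.Dual (ZMod 2) G => (fun x => ξ x : G → ZMod 2))
    (fun a b h => LinearMap.ext fun x => congrFun h x)

noncomputable instance dualFintype : Fintype (Module.Dual (ZMod 2) G) :=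
  @Fintype.ofFinite _ dual_finite

lemma chi_sum_dual {x : G} (h : x ≠ 0) : ∑ ξ : Module.Dual (ZMod 2) G, chi ξ x = 0 := by
  obtain ⟨η, hη⟩ : ∃ η : Module.Dual (ZMod 2) G, η x ≠ 0 := by
    by_contra hh; push Not at hh
    exact h ((Module.forall_dual_apply_eq_zero_iff (ZMod 2) x).1 hh)
  have : ∑ ξ, chi ξ x = ∑ ξ, chi (ξ + η) x :=
    (Equiv.sum_comp (Equiv.addRight η) (fun ξ => chi ξ x)).symm
  have h2 : chi η x = -1 := by simp [chi, hη]
  simp_rw [chi_add_left, h2] at this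
  rw [← sum_mul] at this
  linarith

lemma chi_zero (x : G) : chi (0 : Module.Dual (ZMod 2) G) x = 1 := by simp [chi]
lemma chi_zero_right (ξ : Module.Dual (ZMod 2) G) : chi ξ 0 = 1 := by simp [chi]

/-- Fourier transform. -/
noncomputable def hat (f : G → ℝ) (ξ : Module.Dual (ZMod 2) G) : ℝ := ∑ x, f x * chi ξ x

/-- Convolution. -/
noncomputable def conv (f g : G → ℝ) (w : G) : ℝ := ∑ t, f t * g (w + t)

lemma hat_conv (f g : G → ℝ) (ξ : Module.Dual (ZMod 2) G) :
    hat (conv f g) ξ = hat f ξ * hat g ξ := by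
  unfold hat conv
  simp_rw [sum_mul]
  rw [Finset.sum_comm]
  apply sum_congr rfl
  intro t _
  rw [mul_sum, ← Equiv.sum_comp (Equiv.addRight t)]
  apply sum_congr rfl
  intro x _
  simp only [Equiv.coe_addRight]
  rw [add_add_self, chi_add]; ring

lemma hat_cpow (v : G → ℝ) (j : ℕ) (ξ : Module.Dual (ZMod 2) G) :
    hat (cpow v j) ξ = hat v ξ ^ j := by
  induction j with
  | zero => simp [hat, cpow, chi_zero_right]
  | succ j ih =>
    have : cpow v (j + 1) = conv v (cpow v j) := rfl
    rw [this, hat_conv, ih, pow_succ]; ring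

lemma parseval (f : G → ℝ) : ∑ ξ : Module.Dual (ZMod 2) G, hat f ξ ^ 2 =
    (Fintype.card (Module.Dual (ZMod 2) G) : ℝ) * ∑ x, f x ^ 2 := by
  have e : ∀ ξ : Module.Dual (ZMod 2) G, hat f ξ ^ 2 =
      ∑ x, ∑ y, f x * f y * chi ξ (x + y) := by
    intro ξ
    rw [sq, hat, sum_mul_sum]
    apply sum_congr rfl; intro x _; apply sum_congr rfl; intro y _
    rw [chi_add]; ring
  simp_rw [e]
  rw [Finset.sum_comm, mul_sum]
  apply sum_congr rfl; intro x _
  rw [Finset.sum_comm]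
  rw [Finset.sum_eq_single x]
  · have : x + x = 0 := by have := add_add_self (0 : G) x; simpa using this
    simp_rw [this, chi_zero_right]
    simp; ring
  · intro y _ hy
    rw [← mul_sum, chi_sum_dual, mul_zero]
    intro h
    apply hy
    have h3 := add_add_self x y
    rw [h, zero_add] at h3; exact h3
  · simp

lemma chi_prod {ι : Type*} (T : Finset ι) (ξ : ι → Module.Dual (ZMod 2) G) (x : G) :
    ∏ i ∈ T, chi (ξ i) x = chi (∑ i ∈ T, ξ i) x := by
  induction T using Finset.induction_on with
  | empty => simp [chi_zero]
  | insert a T ha ih => rw [prod_insert ha, sum_insert ha, chi_add_left, ih]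

lemma riesz {ι : Type*} [Fintype ι] (ξ : ι → Module.Dual (ZMod 2) G)
    (h : LinearIndependent (ZMod 2) ξ) (c : ℝ) (s : ι → ℝ) :
    ∑ x, ∏ i, (c + s i * chi (ξ i) x) = Fintype.card G * c ^ Fintype.card ι := by
  simp_rw [Finset.prod_add]
  rw [Finset.sum_comm]
  rw [Finset.sum_eq_single (univ : Finset ι)]
  · simp
  · intro T _ hT
    have hne : (univ \ T).Nonempty := by
      rw [sdiff_nonempty]; intro hh; exact hT (univ_subset_iff.1 hh)
    rw [← mul_sum]
    simp_rw [prod_mul_distrib, chi_prod]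
    rw [← mul_sum, chi_sum_ne, mul_zero, mul_zero]
    intro h0
    obtain ⟨i, hi⟩ := hne
    have := (linearIndependent_iff'.1 h) (univ \ T) (fun _ => 1) (by simpa using h0) i hi
    exact one_ne_zero this
  · simp

lemma chang {ι : Type*} [Fintype ι] (ξ : ι → Module.Dual (ZMod 2) G)
    (h : LinearIndependent (ZMod 2) ξ) (v : G → ℝ) (hv : ∀ t, 0 ≤ v t) (hv1 : ∑ t, v t = 1)
    (B : ℝ) (hB : ∀ t, Fintype.card G * v t ≤ B) (hs : ∀ i, 1 / 2 < |hat v (ξ i)|) :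
    (Fintype.card ι : ℝ) ≤ 8 * Real.log B := by
  have hN : (0 : ℝ) < Fintype.card G := by
    exact_mod_cast Fintype.card_pos_iff.2 ⟨0⟩
  set σ : ι → ℝ := fun i => if 0 ≤ hat v (ξ i) then 1 else -1 with hσ
  have hσa : ∀ i, σ i * hat v (ξ i) = |hat v (ξ i)| := by
    intro i; simp only [hσ]; split_ifs with h0
    · rw [abs_of_nonneg h0]; ring
    · rw [abs_of_neg (not_le.1 h0)]; ring
  have hσ1 : ∀ i x, -1 ≤ σ i * chi (ξ i) x ∧ σ i * chi (ξ i) x ≤ 1 := by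
    intro i x; rw [← abs_le, abs_mul, chi_abs]; simp only [hσ]; split_ifs <;> simp
  set d := Fintype.card ι
  have hJ := convexOn_exp.map_sum_le (t := (univ : Finset G)) (w := v)
      (p := fun t => ∑ i, 1 / 2 * (σ i * chi (ξ i) t)) (fun t _ => hv t) hv1
      (fun _ _ => Set.mem_univ _)
  simp only [smul_eq_mul] at hJ
  have e1 : ∑ t, v t * ∑ i, 1 / 2 * (σ i * chi (ξ i) t) = ∑ i, 1 / 2 * |hat v (ξ i)| := by
    simp_rw [mul_sum]
    rw [Finset.sum_comm]
    apply sum_congr rfl; intro i _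
    rw [← hσa, hat, mul_sum, mul_sum]
    apply sum_congr rfl; intro t _; ring
  have e2 : (d : ℝ) / 4 ≤ ∑ i, 1 / 2 * |hat v (ξ i)| := by
    calc (d : ℝ) / 4 = ∑ i : ι, (1 / 4 : ℝ) := by simp [d]; ring
      _ ≤ _ := sum_le_sum fun i _ => by linarith [hs i]
  have e3 : ∑ t, v t * Real.exp (∑ i, 1 / 2 * (σ i * chi (ξ i) t)) ≤
      ∑ t, B / Fintype.card G * ∏ i, (Real.cosh (1 / 2) +
        (σ i * Real.sinh (1 / 2)) * chi (ξ i) t) := by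
    apply sum_le_sum
    intro t _
    have hb : v t ≤ B / Fintype.card G := by
      rw [le_div_iff₀ hN]; linarith [hB t]
    apply mul_le_mul hb _ (Real.exp_pos _).le ((hv t).trans hb)
    rw [Real.exp_sum]
    apply prod_le_prod
    · intro i _; exact (Real.exp_pos _).le
    · intro i _
      have := exp_mul_le_cosh (1 / 2) _ (hσ1 i t).1 (hσ1 i t).2
      linarith
  rw [← mul_sum, riesz ξ h] at e3
  have e4 : B / Fintype.card G * (Fintype.card G * Real.cosh (1 / 2) ^ d) =
      B * Real.cosh (1 / 2) ^ d := by field_simp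
  rw [e4] at e3
  have hB0 : 0 < B := by
    by_contra hh
    push Not at hh
    have : ∑ t, v t ≤ 0 := sum_nonpos fun t _ => by
      by_contra h3; push Not at h3
      have := hB t; nlinarith
    linarith
  have e5 : Real.cosh (1 / 2) ^ d ≤ Real.exp (d / 8) := by
    calc _ ≤ (Real.exp ((1 / 2 : ℝ) ^ 2 / 2)) ^ d :=
          pow_le_pow_left₀ (Real.cosh_pos _).le (Real.cosh_le_exp_half_sq _) d
      _ = _ := by rw [← Real.exp_nat_mul]; congr 1; ring
  have e6 : Real.exp (d / 4) ≤ Real.exp (Real.log B + d / 8) := by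
    rw [Real.exp_add, Real.exp_log hB0]
    calc _ ≤ Real.exp (∑ i, 1 / 2 * |hat v (ξ i)|) := Real.exp_le_exp.2 e2
      _ ≤ _ := by rw [← e1]; exact hJ
      _ ≤ _ := e3
      _ ≤ _ := mul_le_mul_of_nonneg_left e5 hB0.le
  have := Real.exp_le_exp.1 e6
  linarith

lemma hat_abs_le (f : G → ℝ) (hf : ∀ t, 0 ≤ f t) (ξ : Module.Dual (ZMod 2) G) :
    |hat f ξ| ≤ ∑ t, f t := by
  unfold hat
  refine (abs_sum_le_sum_abs _ _).trans (le_of_eq ?_)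
  apply sum_congr rfl; intro t _
  rw [abs_mul, chi_abs, mul_one, abs_of_nonneg (hf t)]

lemma partA (A D : Finset G) (hA : A.Nonempty) (m M r : ℕ) (c η : ℝ) (hη : 0 ≤ η)
    (hr : 8 * (m * Real.log ((Fintype.card G : ℝ) / A.card)) ≤ r)
    (hsp : ∀ (V : Submodule (ZMod 2) G) (w : G),
      Module.finrank (ZMod 2) G ≤ Module.finrank (ZMod 2) V + r →
      (∑ v : G, if v ∈ V then (if w + v ∈ D then (1 : ℝ) else 0) else 0) / (Nat.card V : ℝ) ≤ c)
    (hM : 4 * (1 / 4 : ℝ) ^ M * D.card ≤ η ^ 2 * A.card) (y : G) :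
    ∑ u ∈ A, ∑ t, cpow (nu A m) M t * (if u + y + t ∈ D then (1 : ℝ) else 0) ≤
      A.card * (c + η) := by
  set v := nu A m with hv
  have hv0 := nu_nonneg A m
  have hv1 := nu_sum A hA m
  set ω := cpow v M with hω
  have hω0 : ∀ t, 0 ≤ ω t := cpow_nonneg _ hv0 M
  have hω1 : ∑ t, ω t = 1 := cpow_sum _ hv1 M
  set Spec : Set (Module.Dual (ZMod 2) G) := {ξ | 1 / 2 < |hat v ξ|} with hSpec
  obtain ⟨b, hb, hbs, hbl⟩ := exists_linearIndependent (ZMod 2) Spec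
  have hbd := chang (ι := b) (fun i => (i : Module.Dual (ZMod 2) G)) hbl v hv0 hv1
    _ (nu_le A hA m) (fun i => hb i.2)
  rw [Real.log_pow] at hbd
  have hbr : Fintype.card b ≤ r := by exact_mod_cast hbd.trans hr
  set V := (Submodule.span (ZMod 2) Spec).dualCoannihilator with hV
  have hVr : Module.finrank (ZMod 2) G ≤ Module.finrank (ZMod 2) V + r := by
    have h1 := Subspace.finrank_add_finrank_dualCoannihilator_eq (Submodule.span (ZMod 2) Spec)
    have h2 : Module.finrank (ZMod 2) (Submodule.span (ZMod 2) Spec) = Fintype.card b := by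
      rw [← hbs]
      have := finrank_span_eq_card hbl
      rw [Subtype.range_coe] at this
      exact this
    rw [h2] at h1
    rw [← h1, hV]; omega
  set dD : G → ℝ := fun x => if x ∈ D then 1 else 0 with hdD
  have hVc : (0 : ℝ) < Nat.card V := by
    exact_mod_cast Nat.card_pos
  set ρ : G → ℝ := fun t => if t ∈ V then ((Nat.card V : ℝ))⁻¹ else 0 with hρ
  have hρ0 : ∀ t, 0 ≤ ρ t := by intro t; simp only [hρ]; split_ifs <;> positivity
  have hρ1 : ∑ t, ρ t = 1 := by
    simp only [hρ]
    rw [← sum_filter, sum_const, nsmul_eq_mul]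
    have : ((univ.filter (fun t => t ∈ V)).card : ℝ) = Nat.card V := by
      congr 1
      rw [Nat.card_eq_fintype_card, Fintype.card_subtype]
    rw [this]; field_simp
  set h := conv ω dD with hh
  set e : G → ℝ := fun w => h w - conv ρ h w with he
  have hate : ∀ ξ, hat e ξ = (1 - hat ρ ξ) * hat v ξ ^ M * hat dD ξ := by
    intro ξ
    have : hat e ξ = hat h ξ - hat (conv ρ h) ξ := by
      unfold hat; rw [← sum_sub_distrib]; apply sum_congr rfl; intro x _
      simp only [he]; ring
    have h2 : hat h ξ = hat v ξ ^ M * hat dD ξ := by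
      rw [hh, hat_conv, hω, hat_cpow]
    rw [this, hat_conv ρ h, h2]; ring
  have hate2 : ∀ ξ, hat e ξ ^ 2 ≤ 4 * (1 / 4 : ℝ) ^ M * hat dD ξ ^ 2 := by
    intro ξ
    rw [hate]
    by_cases hξ : ξ ∈ Spec
    · have : hat ρ ξ = 1 := by
        rw [← hρ1]; unfold hat
        apply sum_congr rfl; intro t _
        by_cases ht : t ∈ V
        · have : ξ t = 0 := by
            rw [hV, Submodule.mem_dualCoannihilator] at ht
            exact ht ξ (Submodule.subset_span hξ)
          simp [chi, this]
        · simp [hρ, ht]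
      rw [this]
      have : 0 ≤ 4 * (1 / 4 : ℝ) ^ M * hat dD ξ ^ 2 := by positivity
      simpa using this
    · have h1 : |hat v ξ| ≤ 1 / 2 := not_lt.1 hξ
      have h2 : |hat ρ ξ| ≤ 1 := by rw [← hρ1]; exact hat_abs_le ρ hρ0 ξ
      rw [abs_le] at h2
      have h3 : (1 - hat ρ ξ) ^ 2 ≤ 4 := by nlinarith
      have h4 : (hat v ξ ^ M) ^ 2 ≤ (1 / 4 : ℝ) ^ M := by
        rw [← pow_mul, mul_comm, pow_mul]
        apply pow_le_pow_left₀ (sq_nonneg _)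
        rw [← sq_abs]; nlinarith [abs_nonneg (hat v ξ)]
      rw [mul_pow, mul_pow]
      apply mul_le_mul_of_nonneg_right _ (sq_nonneg _)
      exact mul_le_mul h3 h4 (sq_nonneg _) (by norm_num)
  have hE : ∑ x, e x ^ 2 ≤ 4 * (1 / 4 : ℝ) ^ M * D.card := by
    have hc : (0 : ℝ) < Fintype.card (Module.Dual (ZMod 2) G) := by
      exact_mod_cast Fintype.card_pos_iff.2 ⟨0⟩
    have h1 := parseval e
    have h2 := parseval dD
    have h3 : ∑ x, dD x ^ 2 = D.card := by
      simp [hdD]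
    have h4 : ∑ ξ : Module.Dual (ZMod 2) G, hat e ξ ^ 2 ≤
        4 * (1 / 4 : ℝ) ^ M * ∑ ξ : Module.Dual (ZMod 2) G, hat dD ξ ^ 2 := by
      rw [mul_sum]; exact sum_le_sum fun ξ _ => hate2 ξ
    rw [h1, h2, h3] at h4
    have : (Fintype.card (Module.Dual (ZMod 2) G) : ℝ) * ∑ x, e x ^ 2 ≤
      (Fintype.card (Module.Dual (ZMod 2) G) : ℝ) * (4 * (1 / 4 : ℝ) ^ M * D.card) := by
      linarith
    exact le_of_mul_le_mul_left this hc
  have hρh : ∀ w, conv ρ h w ≤ c := by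
    intro w
    have : conv ρ h w = ∑ t, ω t * ((∑ v : G, if v ∈ V then
        (if (w + t) + v ∈ D then (1 : ℝ) else 0) else 0) / (Nat.card V : ℝ)) := by
      unfold conv
      simp only [hh, conv]
      simp_rw [mul_sum, sum_div]
      rw [Finset.sum_comm]
      apply sum_congr rfl; intro t _
      rw [mul_sum]
      apply sum_congr rfl; intro s _
      simp only [hρ, hdD]
      rw [add_right_comm w s t]
      split_ifs <;> simp <;> field_simp
    rw [this]
    calc _ ≤ ∑ t, ω t * c := sum_le_sum fun t _ => mul_le_mul_of_nonneg_left
          (hsp V (w + t) hVr) (hω0 t)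
      _ = c := by rw [← sum_mul, hω1, one_mul]
  have hAc : (0 : ℝ) < A.card := by exact_mod_cast hA.card_pos
  have hsum : ∑ u ∈ A, e (u + y) ≤ A.card * η := by
    have h1 : (∑ u ∈ A, e (u + y)) ^ 2 ≤ (A.card : ℝ) * ∑ u ∈ A, e (u + y) ^ 2 :=
      sq_sum_le_card_mul_sum_sq
    have h2 : ∑ u ∈ A, e (u + y) ^ 2 ≤ ∑ x, e x ^ 2 := by
      calc _ ≤ ∑ u, e (u + y) ^ 2 :=
            sum_le_sum_of_subset_of_nonneg (subset_univ _) fun _ _ _ => sq_nonneg _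
        _ = _ := Equiv.sum_comp (Equiv.addRight y) (fun x => e x ^ 2)
    refine le_of_pow_le_pow_left₀ two_ne_zero (by positivity) ?_
    calc _ ≤ _ := h1
      _ ≤ (A.card : ℝ) * (η ^ 2 * A.card) := by gcongr; linarith
      _ = _ := by ring
  calc _ = ∑ u ∈ A, (e (u + y) + conv ρ h (u + y)) := by
        apply sum_congr rfl; intro u _
        simp only [he]; rw [sub_add_cancel]; rfl
    _ ≤ ∑ u ∈ A, e (u + y) + ∑ u ∈ A, c := by
        rw [sum_add_distrib]; gcongr with u _; exact hρh _
    _ ≤ _ := by rw [sum_const, nsmul_eq_mul]; linarith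

lemma wpm {ι : Type*} (s : Finset ι) (w z : ι → ℝ) (hw : ∀ i, 0 ≤ w i) (hz : ∀ i, 0 ≤ z i)
    (n : ℕ) : (∑ i ∈ s, w i * z i) ^ (n + 1) ≤
      (∑ i ∈ s, w i) ^ n * ∑ i ∈ s, w i * z i ^ (n + 1) := by
  set Wt := ∑ i ∈ s, w i with hWt
  have hW0 : 0 ≤ Wt := sum_nonneg fun i _ => hw i
  rcases hW0.eq_or_lt with h | h
  · have h0 : ∀ i ∈ s, w i = 0 := (sum_eq_zero_iff_of_nonneg fun i _ => hw i).1 h.symm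
    have : ∑ i ∈ s, w i * z i = 0 := sum_eq_zero fun i hi => by rw [h0 i hi, zero_mul]
    rw [this, zero_pow (Nat.succ_ne_zero n)]
    exact mul_nonneg (pow_nonneg hW0 n)
      (sum_nonneg fun i _ => mul_nonneg (hw i) (pow_nonneg (hz i) _))
  · have := Real.pow_arith_mean_le_arith_mean_pow s (fun i => w i / Wt) z
      (fun i _ => div_nonneg (hw i) hW0) (by rw [← sum_div, ← hWt]; field_simp)
      (fun i _ => hz i) (n + 1)
    have e1 : ∑ i ∈ s, w i / Wt * z i = (∑ i ∈ s, w i * z i) / Wt := by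
      rw [sum_div]; apply sum_congr rfl; intro i _; ring
    have e2 : ∑ i ∈ s, w i / Wt * z i ^ (n + 1) = (∑ i ∈ s, w i * z i ^ (n + 1)) / Wt := by
      rw [sum_div]; apply sum_congr rfl; intro i _; ring
    rw [e1, e2, div_pow, div_le_div_iff₀ (by positivity) h, pow_succ Wt n] at this
    have h3 : (∑ i ∈ s, w i * z i) ^ (n + 1) * Wt ≤
      (Wt ^ n * ∑ i ∈ s, w i * z i ^ (n + 1)) * Wt := by linarith
    exact le_of_mul_le_mul_right h3 h

lemma young_nat (a Q : ℝ) (ha : 0 ≤ a) (hQ : 0 ≤ Q) (l : ℕ) :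
    (l + 1) * (Q * a ^ l) ≤ l * a ^ (l + 1) + Q ^ (l + 1) := by
  induction l with
  | zero => simp
  | succ l ih =>
    push_cast
    have h1 := mul_le_mul_of_nonneg_left ih hQ
    have h2 : 0 ≤ (l + 1) * (a ^ l * (Q - a) ^ 2) := by positivity
    have e : (l + 1) * (a ^ l * (Q - a) ^ 2) = (l + 1) * (Q ^ 2 * a ^ l) -
      2 * ((l + 1) * (Q * a ^ (l + 1))) + (l + 1) * a ^ (l + 2) := by ring
    have e2 : Q * ((l + 1) * (Q * a ^ l)) = (l + 1) * (Q ^ 2 * a ^ l) := by ring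
    have e3 : Q * (l * a ^ (l + 1) + Q ^ (l + 1)) = l * (Q * a ^ (l + 1)) + Q ^ (l + 2) := by ring
    rw [e2, e3] at h1
    rw [e] at h2
    have e4 : l + 1 + 1 = l + 2 := rfl
    rw [e4]
    linarith

lemma Zset_card_eq (D : Finset G) {k : ℕ} (y : Fin k → G) :
    ((Zset D y).card : ℝ) = ∑ u, ∏ j, (if y j + u ∈ D then (1 : ℝ) else 0) := by
  simp_rw [Finset.prod_ite_zero]
  simp [Zset]

lemma holder (D : Finset G) (f g : G → ℝ) (hf0 : ∀ x, 0 ≤ f x) (hf1 : ∀ x, f x ≤ 1)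
    (hg0 : ∀ x, 0 ≤ g x) (hg1 : ∀ x, g x ≤ 1) (p q : ℕ) :
    (∑ x, ∑ y, f x * g y * (if x + y ∈ D then (1 : ℝ) else 0)) ^ ((p + 1) * (q + 1)) ≤
      (∑ x, f x) ^ (p * (q + 1)) * (∑ x, g x) ^ ((p + 1) * q) *
        ∑ y : Fin (p + 1) → G, ((Zset D y).card : ℝ) ^ (q + 1) := by
  set h : G → ℝ := fun x => ∑ y, g y * (if x + y ∈ D then (1 : ℝ) else 0) with hh
  have hh0 : ∀ x, 0 ≤ h x := fun x => sum_nonneg fun y _ => by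
    apply mul_nonneg (hg0 y); split_ifs <;> norm_num
  have e0 : ∑ x, ∑ y, f x * g y * (if x + y ∈ D then (1 : ℝ) else 0) = ∑ x, f x * h x := by
    apply sum_congr rfl; intro x _
    simp only [hh]; rw [mul_sum]; apply sum_congr rfl; intro y _; ring
  have s1 := wpm univ f h hf0 hh0 p
  set P : (Fin (p + 1) → G) → ℝ := fun y => ∏ j, g (y j) with hP
  have hP0 : ∀ y, 0 ≤ P y := fun y => prod_nonneg fun j _ => hg0 _
  have hP1 : ∀ y, P y ≤ 1 := fun y => prod_le_one (fun j _ => hg0 _) fun j _ => hg1 _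
  have hPs : ∑ y, P y = (∑ x, g x) ^ (p + 1) := by
    rw [Fintype.sum_pow]
  have s2 : ∑ x, f x * h x ^ (p + 1) ≤ ∑ y, P y * ((Zset D y).card : ℝ) := by
    calc _ ≤ ∑ x, h x ^ (p + 1) := sum_le_sum fun x _ => by
          have := pow_nonneg (hh0 x) (p + 1)
          nlinarith [hf1 x]
      _ = _ := by
          simp_rw [Zset_card_eq, mul_sum]
          rw [Finset.sum_comm]
          apply sum_congr rfl; intro x _
          simp only [hh]
          rw [Fintype.sum_pow]
          apply sum_congr rfl; intro y _
          rw [prod_mul_distrib]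
          simp only [add_comm x, hP]
  have s3 := wpm univ P (fun y => ((Zset D y).card : ℝ)) hP0 (fun y => Nat.cast_nonneg _) q
  have s4 : ∑ y, P y * ((Zset D y).card : ℝ) ^ (q + 1) ≤ ∑ y : Fin (p + 1) → G,
      ((Zset D y).card : ℝ) ^ (q + 1) := sum_le_sum fun y _ => by
    have : (0 : ℝ) ≤ ((Zset D y).card : ℝ) ^ (q + 1) := by positivity
    nlinarith [hP1 y]
  have hF0 : 0 ≤ ∑ x, f x := sum_nonneg fun x _ => hf0 x
  have hG0 : 0 ≤ ∑ x, g x := sum_nonneg fun x _ => hg0 x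
  have hT0 : 0 ≤ ∑ x, f x * h x := sum_nonneg fun x _ => mul_nonneg (hf0 x) (hh0 x)
  rw [e0, pow_mul]
  calc _ ≤ ((∑ x, f x) ^ p * ∑ y, P y * ((Zset D y).card : ℝ)) ^ (q + 1) := by
        apply pow_le_pow_left₀ (by positivity)
        exact s1.trans (mul_le_mul_of_nonneg_left s2 (by positivity))
    _ = (∑ x, f x) ^ (p * (q + 1)) * (∑ y, P y * ((Zset D y).card : ℝ)) ^ (q + 1) := by
        rw [mul_pow, ← pow_mul]
    _ ≤ (∑ x, f x) ^ (p * (q + 1)) * ((∑ y, P y) ^ q *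
          ∑ y : Fin (p + 1) → G, ((Zset D y).card : ℝ) ^ (q + 1)) := by
        apply mul_le_mul_of_nonneg_left _ (by positivity)
        exact s3.trans (mul_le_mul_of_nonneg_left s4
          (pow_nonneg (sum_nonneg fun y _ => hP0 y) _))
    _ = _ := by rw [hPs, ← pow_mul]; ring

/-- Number of common points for the test. -/
noncomputable def btwo (D : Finset G) {k : ℕ} (x : Fin k → G) (u : G) : ℝ :=
  (((Zset D x).filter (fun w => u + w ∈ D)).card : ℝ)

/-- The sifting test. -/
noncomputable def Stest (D : Finset G) (q : ℝ) {k : ℕ} (x : Fin k → G) (u : G) : ℝ :=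
  if q * (Zset D x).card ≤ btwo D x u then 1 else 0

lemma bad_sum (D : Finset G) (q : ℝ) (hq : 0 ≤ q) (k : ℕ) :
    ∑ y : Fin k → G, ∑ x ∈ Fintype.piFinset (fun _ : Fin k => Zset D y), ∑ u ∈ Zset D y,
      (1 - Stest D q x u) ≤
    Fintype.card G * q ^ k * ∑ y : Fin k → G, ((Zset D y).card : ℝ) ^ k := by
  have hS : ∀ (x : Fin k → G) u, 0 ≤ 1 - Stest D q x u := by
    intro x u; unfold Stest; split_ifs <;> norm_num
  have e1 : ∀ y : Fin k → G, ∑ x ∈ Fintype.piFinset (fun _ : Fin k => Zset D y),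
      ∑ u ∈ Zset D y, (1 - Stest D q x u) = ∑ x : Fin k → G, ∑ u,
        (1 - Stest D q x u) * (if y ∈ Fintype.piFinset
          (fun _ : Fin k => (Zset D x).filter (fun w => u + w ∈ D)) then 1 else 0) := by
    intro y
    rw [← sum_filter_add_sum_filter_not univ
      (fun x => x ∈ Fintype.piFinset (fun _ : Fin k => Zset D y))]
    rw [filter_mem_eq_inter, univ_inter]
    have z : ∑ x ∈ univ.filter (fun x => ¬ x ∈ Fintype.piFinset (fun _ : Fin k => Zset D y)),
      ∑ u, (1 - Stest D q x u) * (if y ∈ Fintype.piFinset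
          (fun _ : Fin k => (Zset D x).filter (fun w => u + w ∈ D)) then (1 : ℝ) else 0) = 0 := by
      apply sum_eq_zero
      intro x hx
      apply sum_eq_zero
      intro u _
      rw [if_neg, mul_zero]
      intro h
      apply (mem_filter.1 hx).2
      simp only [Fintype.mem_piFinset, Zset, mem_filter, mem_univ, true_and] at h ⊢
      intro i j
      rw [add_comm]; exact (h j).1 i
    rw [z, add_zero]
    apply sum_congr rfl
    intro x hx
    rw [← sum_subset (subset_univ (Zset D y))]
    · apply sum_congr rfl
      intro u hu
      rw [if_pos, mul_one]
      simp only [Fintype.mem_piFinset, Zset, mem_filter, mem_univ, true_and] at hx hu ⊢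
      intro j
      exact ⟨fun i => by rw [add_comm]; exact hx i j, by rw [add_comm]; exact hu j⟩
    · intro u _ hu
      rw [if_neg, mul_zero]
      intro h
      apply hu
      simp only [Fintype.mem_piFinset, Zset, mem_filter, mem_univ, true_and] at h ⊢
      intro j
      rw [add_comm]; exact (h j).2
  simp_rw [e1]
  rw [Finset.sum_comm, mul_sum]
  apply sum_le_sum
  intro x _
  rw [Finset.sum_comm]
  calc _ ≤ ∑ u : G, q ^ k * ((Zset D x).card : ℝ) ^ k := by
        apply sum_le_sum
        intro u _
        rw [← mul_sum]
        have e2 : ∑ y : Fin k → G, (if y ∈ Fintype.piFinset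
          (fun _ : Fin k => (Zset D x).filter (fun w => u + w ∈ D)) then (1 : ℝ) else 0) =
          btwo D x u ^ k := by
          rw [← sum_filter, filter_mem_eq_inter, univ_inter, sum_const, Fintype.card_piFinset]
          simp [btwo]
        rw [e2]
        unfold Stest
        split_ifs with h
        · simp; positivity
        · rw [sub_zero, one_mul, ← mul_pow]
          apply pow_le_pow_left₀ (by unfold btwo; positivity) (not_le.1 h).le
    _ = _ := by simp [card_univ]; ring

lemma sift (D : Finset G) (k : ℕ) (q Q δ : ℝ) (hq : 0 ≤ q) (hQ : 0 < Q) (hδ : 0 < δ)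
    (hqk : q ^ k = δ * Q)
    (h : (Fintype.card G : ℝ) ^ k * (Q * Fintype.card G) ^ (k + 1) ≤
      ∑ y : Fin k → G, ((Zset D y).card : ℝ) ^ (k + 1)) :
    ∃ y : Fin k → G, (Zset D y).Nonempty ∧ Q * Fintype.card G / 3 < (Zset D y).card ∧
      ∑ x ∈ Fintype.piFinset (fun _ : Fin k => Zset D y), ∑ u ∈ Zset D y,
        (1 - Stest D q x u) ≤ 3 * δ * ((Zset D y).card : ℝ) ^ (k + 1) := by
  set N : ℝ := (Fintype.card G : ℝ) with hN
  have hN0 : 0 < N := by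
    rw [hN]; exact_mod_cast Fintype.card_pos_iff.2 ⟨0⟩
  set z : (Fin k → G) → ℝ := fun y => ((Zset D y).card : ℝ) with hz
  set bad : (Fin k → G) → ℝ := fun y => ∑ x ∈ Fintype.piFinset (fun _ : Fin k => Zset D y),
    ∑ u ∈ Zset D y, (1 - Stest D q x u) with hbad
  have hbad0 : ∀ y, 0 ≤ bad y := fun y => sum_nonneg fun x _ => sum_nonneg fun u _ => by
    unfold Stest; split_ifs <;> norm_num
  have hb : ∑ y, bad y ≤ N * q ^ k * ∑ y, z y ^ k := bad_sum D q hq k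
  have hp : Q * N * ∑ y, z y ^ k ≤ ∑ y, z y ^ (k + 1) := by
    have h1 : ∑ y : Fin k → G, ((k : ℝ) + 1) * (Q * N * z y ^ k) ≤
        ∑ y : Fin k → G, (k * z y ^ (k + 1) + (Q * N) ^ (k + 1)) :=
      sum_le_sum fun y _ => young_nat _ _ (Nat.cast_nonneg _) (by positivity) k
    rw [sum_add_distrib, ← mul_sum, ← mul_sum, ← mul_sum] at h1
    have h2 : ∑ y : Fin k → G, (Q * N) ^ (k + 1) = N ^ k * (Q * N) ^ (k + 1) := by
      simp [card_univ, hN]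
    rw [h2] at h1
    have h3 : ((k : ℝ) + 1) * (Q * N * ∑ y, z y ^ k) ≤ ((k : ℝ) + 1) * ∑ y, z y ^ (k + 1) := by
      linarith
    exact le_of_mul_le_mul_left h3 (by positivity)
  have hpos : 0 < ∑ y, z y ^ (k + 1) := lt_of_lt_of_le (by positivity) h
  have hex : ∃ y, bad y / (3 * δ) + Q * N / 3 * z y ^ k < z y ^ (k + 1) := by
    by_contra hcon
    push Not at hcon
    have h1 : ∑ y, z y ^ (k + 1) ≤ ∑ y, (bad y / (3 * δ) + Q * N / 3 * z y ^ k) :=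
      sum_le_sum fun y _ => hcon y
    rw [sum_add_distrib, ← sum_div, ← mul_sum] at h1
    have h2 : (∑ y, bad y) / (3 * δ) ≤ (∑ y, z y ^ (k + 1)) / 3 := by
      rw [div_le_div_iff₀ (by positivity) (by norm_num)]
      rw [hqk] at hb
      have := mul_le_mul_of_nonneg_left hp hδ.le
      linarith
    linarith
  obtain ⟨y, hy⟩ := hex
  have hz0 : 0 ≤ z y := Nat.cast_nonneg _
  have hzp : 0 < z y := by
    rcases hz0.eq_or_lt with h0 | h0
    · exfalso
      rw [← h0, zero_pow (Nat.succ_ne_zero k)] at hy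
      have : 0 ≤ bad y / (3 * δ) + Q * N / 3 * 0 ^ k :=
        add_nonneg (div_nonneg (hbad0 y) (by positivity)) (by positivity)
      linarith
    · exact h0
  refine ⟨y, ?_, ?_, ?_⟩
  · rw [← card_pos]
    have h0 : (0 : ℝ) < ((Zset D y).card : ℝ) := hzp
    exact_mod_cast h0
  · have h1 : Q * N / 3 * z y ^ k < z y * z y ^ k := by
      have : 0 ≤ bad y / (3 * δ) := div_nonneg (hbad0 y) (by positivity)
      rw [pow_succ] at hy; linarith
    exact lt_of_mul_lt_mul_right h1 (by positivity)
  · have h1 : bad y / (3 * δ) ≤ z y ^ (k + 1) := by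
      have : 0 ≤ Q * N / 3 * z y ^ k := by positivity
      linarith
    rw [div_le_iff₀ (by positivity)] at h1
    linarith

lemma btwo_eq (D : Finset G) {k : ℕ} (x : Fin k → G) (u : G) :
    btwo D x u = ∑ w ∈ Zset D x, (if u + w ∈ D then (1 : ℝ) else 0) := by
  simp [btwo]

lemma btwo_shift (D : Finset G) {k : ℕ} (x : Fin k → G) (u t : G) :
    btwo D (x + fun _ => t) (u + t) = btwo D x u := by
  unfold btwo
  congr 1
  apply Finset.card_bij (fun z _ => z + t)
  · intro z hz
    simp only [Zset, mem_filter, mem_univ, true_and, Pi.add_apply] at hz ⊢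
    refine ⟨fun i => ?_, ?_⟩
    · have := hz.1 i
      rwa [add_assoc, add_comm t z] at this
    · have := hz.2
      rwa [add_assoc, add_comm t z] at this
  · intro a _ b _ h; exact add_right_cancel h
  · intro z hz
    simp only [Zset, mem_filter, mem_univ, true_and, Pi.add_apply] at hz ⊢
    refine ⟨z + t, ⟨fun i => ?_, ?_⟩, add_add_self z t⟩
    · rw [add_assoc, add_comm t (z + t), add_add_self]; exact hz.1 i
    · rw [add_assoc, add_comm t (z + t), add_add_self]; exact hz.2

lemma combine (D : Finset G) (k m M r : ℕ) (hk : 0 < k) (hm : 0 < m)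
    (q Q δ c η lam Λ : ℝ) (hq : 0 ≤ q) (hQ : 0 < Q) (hδ : 0 < δ) (hη : 0 ≤ η) (hlam : 0 < lam)
    (hqk : q ^ k = δ * Q)
    (h : (Fintype.card G : ℝ) ^ k * (Q * Fintype.card G) ^ (k + 1) ≤
      ∑ y : Fin k → G, ((Zset D y).card : ℝ) ^ (k + 1))
    (hΛ : Real.log (3 / Q) ≤ Λ) (hr : 8 * (m * Λ) ≤ r)
    (hsp : ∀ (V : Submodule (ZMod 2) G) (w : G),
      Module.finrank (ZMod 2) G ≤ Module.finrank (ZMod 2) V + r →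
      (∑ v : G, if v ∈ V then (if w + v ∈ D then (1 : ℝ) else 0) else 0) / (Nat.card V : ℝ) ≤ c)
    (hM : 4 * (1 / 4 : ℝ) ^ M * D.card ≤ η ^ 2 * (Q * Fintype.card G / 3)) :
    q * (1 - 3 * δ - (k * Λ + 4 * M * lam ^ 2 / m) / (2 * lam)) ≤ c + η := by
  have hN : (0 : ℝ) < Fintype.card G := by
    exact_mod_cast Fintype.card_pos_iff.2 ⟨0⟩
  obtain ⟨y, hyne, hyc, hyb⟩ := sift D k q Q δ hq hQ hδ hqk h
  set A := Zset D y with hA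
  have hAc : (0 : ℝ) < A.card := by exact_mod_cast hyne.card_pos
  have hlog : Real.log ((Fintype.card G : ℝ) / A.card) ≤ Λ := by
    refine le_trans (Real.log_le_log (by positivity) ?_) hΛ
    rw [div_le_div_iff₀ hAc hQ]
    linarith
  have hr' : 8 * (m * Real.log ((Fintype.card G : ℝ) / A.card)) ≤ r := by
    refine le_trans ?_ hr
    gcongr
  have hM' : 4 * (1 / 4 : ℝ) ^ M * D.card ≤ η ^ 2 * A.card :=
    hM.trans (mul_le_mul_of_nonneg_left hyc.le (sq_nonneg _))
  have hpA := partA A D hyne m M r c η hη hr' hsp hM'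
  set S : (Fin k → G) → G → ℝ := fun x u => Stest D q x u with hSdef
  have hS0 : ∀ s u, 0 ≤ S s u := by
    intro s u; simp only [hSdef, Stest]; split_ifs <;> norm_num
  have hS1 : ∀ s u, S s u ≤ 1 := by
    intro s u; simp only [hSdef, Stest]; split_ifs <;> norm_num
  have hSs : ∀ s u t, S (s + fun _ => t) (u + t) = S s u := by
    intro s u t; simp only [hSdef, Stest, btwo_shift, Zset_card_shift]
  have hap := almost_periodic (m := m) hyne hm hS0 hS1 hSs lam hlam M
  set ω := cpow (nu A m) M with hω
  have hω0 : ∀ t, 0 ≤ ω t := cpow_nonneg _ (nu_nonneg A m) M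
  set F := FA A k S with hF
  set err := (k * Λ + 4 * M * lam ^ 2 / m) / (2 * lam) with herr
  have hap2 : ∑ x ∈ Fintype.piFinset (fun _ : Fin k => A), (F x -
      ∑ t, ω t * F (x + fun _ => t)) ≤ (A.card : ℝ) ^ k * err := by
    refine hap.trans ?_
    apply mul_le_mul_of_nonneg_left _ (by positivity)
    rw [herr]
    gcongr
  have hF1 : (A.card : ℝ) ^ k * (1 - 3 * δ) ≤ ∑ x ∈ Fintype.piFinset (fun _ : Fin k => A), F x := by
    have e : ∑ x ∈ Fintype.piFinset (fun _ : Fin k => A), ∑ u ∈ A, (1 - Stest D q x u) =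
        A.card * ((A.card : ℝ) ^ k - ∑ x ∈ Fintype.piFinset (fun _ : Fin k => A), F x) := by
      have e1 : ∀ x, ∑ u ∈ A, (1 - Stest D q x u) = A.card * (1 - F x) := by
        intro x
        simp only [hF, FA, hSdef]
        rw [sum_sub_distrib, sum_const, nsmul_eq_mul, mul_one]
        field_simp
      simp_rw [e1]
      rw [← mul_sum, sum_sub_distrib]
      simp [Fintype.card_piFinset]
    rw [e] at hyb
    have h1 : A.card * ((A.card : ℝ) ^ k - ∑ x ∈ Fintype.piFinset (fun _ : Fin k => A), F x) ≤
      A.card * (3 * δ * (A.card : ℝ) ^ k) := by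
      rw [pow_succ] at hyb; linarith
    have := le_of_mul_le_mul_left h1 hAc
    linarith
  obtain ⟨x, hx, hxF⟩ : ∃ x ∈ Fintype.piFinset (fun _ : Fin k => A),
      1 - 3 * δ - err ≤ ∑ t, ω t * F (x + fun _ => t) := by
    by_contra hcon
    push Not at hcon
    have hne : (Fintype.piFinset (fun _ : Fin k => A)).Nonempty := by
      rw [Fintype.piFinset_nonempty]; exact fun _ => hyne
    have h1 := sum_lt_sum_of_nonempty hne hcon
    rw [sum_const, Fintype.card_piFinset] at h1
    rw [sum_sub_distrib] at hap2
    simp only [prod_const, card_univ, Fintype.card_fin, nsmul_eq_mul, Nat.cast_pow] at h1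
    linarith
  set B := Zset D x with hB
  have hBne : B.Nonempty := by
    refine ⟨y ⟨0, hk⟩, ?_⟩
    rw [Fintype.mem_piFinset] at hx
    simp only [hA, hB, Zset, mem_filter, mem_univ, true_and] at hx ⊢
    intro i; rw [add_comm]; exact hx i _
  have hBc : (0 : ℝ) < B.card := by exact_mod_cast hBne.card_pos
  have hSb : ∀ u, q * B.card * S x u ≤ ∑ w ∈ B, (if u + w ∈ D then (1 : ℝ) else 0) := by
    intro u
    rw [← btwo_eq]
    simp only [hSdef, Stest]
    split_ifs with h0
    · rw [mul_one]; exact h0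
    · rw [mul_zero]; unfold btwo; positivity
  have hFs : ∀ t, F (x + fun _ => t) = (∑ u ∈ A, S x (u + t)) / A.card := by
    intro t
    simp only [hF, FA]
    congr 1
    apply sum_congr rfl; intro u _
    have := hSs x (u + t) t
    rw [add_add_self] at this; exact this
  have hkey : q * B.card * (A.card * ∑ t, ω t * F (x + fun _ => t)) ≤
      B.card * (A.card * (c + η)) := by
    calc _ = ∑ t, ω t * ∑ u ∈ A, q * B.card * S x (u + t) := by
          simp_rw [hFs, ← mul_sum]
          rw [mul_sum, mul_sum]
          apply sum_congr rfl; intro t _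
          field_simp
      _ ≤ ∑ t, ω t * ∑ u ∈ A, ∑ w ∈ B, (if u + t + w ∈ D then (1 : ℝ) else 0) := by
          apply sum_le_sum; intro t _
          apply mul_le_mul_of_nonneg_left _ (hω0 t)
          exact sum_le_sum fun u _ => hSb _
      _ = ∑ w ∈ B, ∑ u ∈ A, ∑ t, ω t * (if u + w + t ∈ D then (1 : ℝ) else 0) := by
          simp_rw [mul_sum]
          rw [Finset.sum_comm]
          rw [Finset.sum_comm (s := B) (t := A)]
          apply sum_congr rfl; intro u _
          rw [Finset.sum_comm]
          apply sum_congr rfl; intro w _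
          apply sum_congr rfl; intro t _
          rw [add_right_comm u t w]
      _ ≤ ∑ w ∈ B, A.card * (c + η) := sum_le_sum fun w _ => hpA w
      _ = _ := by rw [sum_const, nsmul_eq_mul]
  have h1 : (B.card * A.card : ℝ) * (q * ∑ t, ω t * F (x + fun _ => t)) ≤
      (B.card * A.card : ℝ) * (c + η) := by linarith
  have h2 := le_of_mul_le_mul_left h1 (by positivity)
  exact (mul_le_mul_of_nonneg_left hxF hq).trans h2

set_option maxHeartbeats 4000000 in
lemma params (e γ τ : ℝ) (he : 0 < e) (he2 : e < 1 / 2) (hγ : 0 < γ) (hγe : γ ≤ e) (hγτ : γ ≤ τ)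
    (hτ : τ < 1 / 2) :
    ∃ (k m M : ℕ) (lam : ℝ), 0 < k ∧ 0 < m ∧ 0 < lam ∧
      ((1 + e / 2) * τ) ^ k ≤ ((1 + e) * τ) ^ k * γ ^ 2 ∧
      3 * ((1 + e / 4) / (1 + e / 2)) ^ k ≤ e / 50 ∧
      Real.log (3 / ((1 + e / 2) * τ) ^ k) ≤ k * Real.log (2 / τ) ∧
      4 * (1 / 4 : ℝ) ^ M * τ ≤ (e * τ / 50) ^ 2 * (((1 + e / 2) * τ) ^ k / 3) ∧
      (k * (k * Real.log (2 / τ)) + 4 * M * lam ^ 2 / m) / (2 * lam) ≤ e / 50 ∧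
      8 * (m * (k * Real.log (2 / τ))) ≤
        10 ^ 12 * e⁻¹ ^ 6 * Real.log (2 / τ) * Real.log (2 / γ) ^ 6 := by
  have hτ0 : 0 < τ := lt_of_lt_of_le hγ hγτ
  set L := Real.log (2 / γ) with hL
  set Lt := Real.log (2 / τ) with hLt
  have hexp1 := Real.exp_one_lt_d9
  have hLt1 : 1 ≤ Lt := by
    rw [hLt, Real.le_log_iff_exp_le (by positivity), le_div_iff₀ hτ0]
    nlinarith
  have hLL : Lt ≤ L := by
    apply Real.log_le_log (by positivity)
    gcongr
  have hL1 : 1 ≤ L := hLt1.trans hLL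
  have eL : Real.exp (-L) = γ / 2 := by
    rw [Real.exp_neg, hL, Real.exp_log (by positivity), inv_div]
  have eLt : Real.exp (-Lt) = τ / 2 := by
    rw [Real.exp_neg, hLt, Real.exp_log (by positivity), inv_div]
  set k : ℕ := ⌈25 * L / e⌉₊ with hk
  have hk1 : 25 * L / e ≤ k := Nat.le_ceil _
  have hk2 : (k : ℝ) < 25 * L / e + 1 := Nat.ceil_lt_add_one (by positivity)
  have hek : 25 * L ≤ e * k := by
    rw [div_le_iff₀ he] at hk1; linarith
  have hk50 : 50 * L ≤ k := by nlinarith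
  have hk26 : (k : ℝ) ≤ 26 * L / e := by
    have : 1 ≤ L / e := by rw [le_div_iff₀ he]; linarith
    have h2 : 26 * L / e = 25 * L / e + L / e := by ring
    linarith
  have hkpos : (0 : ℝ) < k := by linarith
  have hkL : 50 * L ≤ k * Lt := by nlinarith
  have hkLt0 : 0 < k * Lt := by positivity
  set M : ℕ := ⌈4 * (k * Lt)⌉₊ with hM
  have hM1 : 4 * (k * Lt) ≤ M := Nat.le_ceil _
  have hM2 : (M : ℝ) < 4 * (k * Lt) + 1 := Nat.ceil_lt_add_one (by positivity)
  have hM5 : (M : ℝ) ≤ 5 * (k * Lt) := by linarith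
  have hMpos : (0 : ℝ) < M := by linarith
  set lam : ℝ := 50 * k * (k * Lt) / e with hlam
  have hlam0 : 0 < lam := by positivity
  set m : ℕ := ⌈200 * M * lam / e⌉₊ with hm
  have hm1 : 200 * M * lam / e ≤ m := Nat.le_ceil _
  have hm2 : (m : ℝ) < 200 * M * lam / e + 1 := Nat.ceil_lt_add_one (by positivity)
  have hmpos : (0 : ℝ) < m := lt_of_lt_of_le (by positivity) hm1
  have hq2 : (τ / 2) ^ k ≤ ((1 + e / 2) * τ) ^ k / 3 := by
    have h2k : (4 : ℝ) ≤ 2 ^ k := by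
      have : 2 ≤ k := by
        have : (2 : ℝ) ≤ k := by linarith
        exact_mod_cast this
      calc (4 : ℝ) = 2 ^ 2 := by norm_num
        _ ≤ _ := pow_le_pow_right₀ (by norm_num) this
    have h3 : τ ^ k ≤ ((1 + e / 2) * τ) ^ k := by
      apply pow_le_pow_left₀ hτ0.le; nlinarith
    rw [div_pow]
    rw [div_le_div_iff₀ (by positivity) (by norm_num)]
    have : 0 < τ ^ k := by positivity
    nlinarith
  refine ⟨k, m, M, lam, by exact_mod_cast hkpos, by exact_mod_cast hmpos, hlam0,
    ?_, ?_, ?_, ?_, ?_, ?_⟩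
  · have h1 : (1 + e / 2) * Real.exp (e / 5) ≤ 1 + e := by
      have h2 : Real.exp (e / 5) * (1 - e / 5) ≤ 1 := by
        have := Real.one_sub_le_exp_neg (e / 5)
        calc _ ≤ Real.exp (e / 5) * Real.exp (-(e / 5)) := by gcongr
          _ = 1 := by rw [← Real.exp_add]; simp
      have h3 : Real.exp (e / 5) ≤ 1 / (1 - e / 5) := by
        rw [le_div_iff₀ (by linarith)]; exact h2
      calc _ ≤ (1 + e / 2) * (1 / (1 - e / 5)) := by gcongr
        _ ≤ 1 + e := by
          rw [mul_one_div, div_le_iff₀ (by linarith)]; nlinarith only [he, he2]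
    have h4 : 1 ≤ Real.exp (e / 5) ^ k * γ ^ 2 := by
      rw [← Real.exp_nat_mul]
      have h5 : γ ^ 2 ≥ Real.exp (-L) ^ 2 := by rw [eL]; gcongr; linarith
      rw [← Real.exp_nat_mul] at h5
      calc (1 : ℝ) = Real.exp 0 := by simp
        _ ≤ Real.exp (k * (e / 5) + (2 : ℕ) * -L) := by
          apply Real.exp_le_exp.2; push_cast; linarith
        _ = Real.exp (k * (e / 5)) * Real.exp ((2 : ℕ) * -L) := Real.exp_add _ _
        _ ≤ _ := by gcongr
    calc _ ≤ ((1 + e / 2) * τ) ^ k * (Real.exp (e / 5) ^ k * γ ^ 2) :=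
          le_mul_of_one_le_right (by positivity) h4
      _ = ((1 + e / 2) * Real.exp (e / 5) * τ) ^ k * γ ^ 2 := by
          rw [mul_pow, mul_pow, mul_pow]; ring
      _ ≤ _ := by gcongr
  · have h1 : (1 + e / 4) / (1 + e / 2) ≤ Real.exp (-(e / 5)) := by
      refine le_trans ?_ (Real.one_sub_le_exp_neg (e / 5))
      rw [div_le_iff₀ (by positivity)]; nlinarith only [he, he2]
    have h2 : ((1 + e / 4) / (1 + e / 2)) ^ k ≤ (γ / 2) ^ 5 := by
      calc _ ≤ Real.exp (-(e / 5)) ^ k := pow_le_pow_left₀ (by positivity) h1 k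
        _ = Real.exp (k * (-(e / 5))) := by rw [← Real.exp_nat_mul]
        _ ≤ Real.exp ((5 : ℕ) * -L) := by
          apply Real.exp_le_exp.2; push_cast; linarith
        _ = _ := by rw [Real.exp_nat_mul, eL]
    have h3 : (γ / 2) ^ 5 ≤ (γ / 2) * (1 / 4) ^ 4 := by
      rw [pow_succ, mul_comm]
      exact mul_le_mul_of_nonneg_left (pow_le_pow_left₀ (by linarith) (by linarith) 4)
        (by linarith)
    norm_num at h3
    linarith
  · rw [← Real.log_pow]
    apply Real.log_le_log (by positivity)
    have h4 : 3 / ((1 + e / 2) * τ) ^ k = (((1 + e / 2) * τ) ^ k / 3)⁻¹ := by rw [inv_div]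
    have h5 : (2 / τ) ^ k = ((τ / 2) ^ k)⁻¹ := by rw [← inv_pow, inv_div]
    rw [h4, h5]
    exact inv_anti₀ (by positivity) hq2
  · have h4 : (1 / 4 : ℝ) ≤ Real.exp (-1) := by
      rw [Real.exp_neg, ← one_div]
      exact one_div_le_one_div_of_le (Real.exp_pos 1) (by linarith)
    have h5 : (1 / 4 : ℝ) ^ M ≤ Real.exp (-M) := by
      calc _ ≤ Real.exp (-1) ^ M := pow_le_pow_left₀ (by norm_num) h4 M
        _ = _ := by rw [← Real.exp_nat_mul]; congr 1; ring
    have h8 : Real.exp (-8) ≤ 1 / 1250 := by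
      rw [Real.exp_neg, ← one_div]
      apply one_div_le_one_div_of_le (by norm_num)
      have h2 : (2.7 : ℝ) ≤ Real.exp 1 := by linarith [Real.exp_one_gt_d9]
      calc (1250 : ℝ) ≤ 2.7 ^ 8 := by norm_num
        _ ≤ Real.exp 1 ^ 8 := by gcongr
        _ = _ := by rw [← Real.exp_nat_mul]; norm_num
    have h6 : Real.exp (-M) ≤ (γ / 2) ^ 2 * (τ / 2) * (τ / 2) ^ k * (1 / 1250) := by
      calc Real.exp (-M) ≤ Real.exp ((2 : ℕ) * -L + -Lt + k * -Lt + -8) := by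
            apply Real.exp_le_exp.2
            push_cast
            have hk2' : Lt ≤ k * Lt := le_mul_of_one_le_left (by linarith) (by linarith)
            linarith
        _ = (γ / 2) ^ 2 * (τ / 2) * (τ / 2) ^ k * Real.exp (-8) := by
            rw [Real.exp_add, Real.exp_add, Real.exp_add, Real.exp_nat_mul, Real.exp_nat_mul,
              eL, eLt]
        _ ≤ _ := by gcongr
    calc _ ≤ 4 * ((γ / 2) ^ 2 * (τ / 2) * (τ / 2) ^ k * (1 / 1250)) * τ := by
          gcongr; exact h5.trans h6
      _ = (γ * τ / 50) ^ 2 * (τ / 2) ^ k := by ring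
      _ ≤ _ := by gcongr
  · have h1 : 4 * M * lam ^ 2 / m ≤ lam * e / 50 := by
      rw [div_le_iff₀ hmpos]
      rw [div_le_iff₀ he] at hm1
      nlinarith only [mul_le_mul_of_nonneg_right hm1 hlam0.le]
    have h2 : k * (k * Lt) = lam * e / 50 := by rw [hlam]; field_simp
    rw [div_le_iff₀ (by positivity), h2]
    linarith
  · have h1 : 200 * M * lam / e ≤ 50000 * (k ^ 3 * Lt ^ 2 / e ^ 2) := by
      calc _ ≤ 200 * (5 * (k * Lt)) * lam / e := by gcongr
        _ = _ := by rw [hlam]; field_simp; ring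
    have hk1' : (1 : ℝ) ≤ k := by linarith
    have h2 : 1 ≤ k ^ 3 * Lt ^ 2 / e ^ 2 := by
      rw [le_div_iff₀ (by positivity)]
      have a1 : (1 : ℝ) ≤ (k : ℝ) ^ 3 := one_le_pow₀ hk1'
      have a2 : (1 : ℝ) ≤ Lt ^ 2 := one_le_pow₀ hLt1
      nlinarith
    have h3 : (m : ℝ) ≤ 50001 * (k ^ 3 * Lt ^ 2 / e ^ 2) := by linarith
    calc _ ≤ 8 * (50001 * (k ^ 3 * Lt ^ 2 / e ^ 2) * (k * Lt)) := by gcongr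
      _ = 400008 * (k : ℝ) ^ 4 * Lt ^ 2 * Lt / e ^ 2 := by ring
      _ ≤ 400008 * (26 * L / e) ^ 4 * L ^ 2 * Lt / e ^ 2 := by gcongr
      _ = 182794055808 * (e⁻¹ ^ 6 * Lt * L ^ 6) := by field_simp; norm_num
      _ ≤ 10 ^ 12 * (e⁻¹ ^ 6 * Lt * L ^ 6) := by gcongr; norm_num
      _ = _ := by ring

lemma lowerZ (D : Finset G) (f g : G → ℝ) (hf0 : ∀ x, 0 ≤ f x) (hf1 : ∀ x, f x ≤ 1)
    (hg0 : ∀ x, 0 ≤ g x) (hg1 : ∀ x, g x ≤ 1) (p : ℕ) (N α β s γ Q : ℝ)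
    (hN : 0 < N) (hγ : 0 < γ) (hγ1 : γ ≤ 1) (hα : γ ≤ α) (hβ : γ ≤ β) (hs : 0 ≤ s) (hQ : 0 ≤ Q)
    (hfα : ∑ x, f x = N * α) (hgβ : ∑ x, g x = N * β)
    (hT : s * α * β * N ^ 2 ≤ ∑ x, ∑ y, f x * g y * (if x + y ∈ D then (1 : ℝ) else 0))
    (hQs : Q ≤ s ^ (p + 1) * γ ^ 2) :
    N ^ (p + 1) * (Q * N) ^ (p + 1 + 1) ≤
      ∑ y : Fin (p + 1) → G, ((Zset D y).card : ℝ) ^ (p + 1 + 1) := by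
  have hα0 : 0 < α := lt_of_lt_of_le hγ hα
  have hβ0 : 0 < β := lt_of_lt_of_le hγ hβ
  have h := holder D f g hf0 hf1 hg0 hg1 p (p + 1)
  set Z := ∑ y : Fin (p + 1) → G, ((Zset D y).card : ℝ) ^ (p + 1 + 1)
  rw [hfα, hgβ] at h
  have h1 := (pow_le_pow_left₀ (by positivity) hT ((p + 1) * (p + 1 + 1))).trans h
  set X := (N * α) ^ (p * (p + 1 + 1)) * (N * β) ^ ((p + 1) * (p + 1)) with hX
  have hX0 : 0 < X := by positivity
  have e1 : (s * α * β * N ^ 2) ^ ((p + 1) * (p + 1 + 1)) = X * (s ^ ((p + 1) * (p + 1 + 1)) *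
      (α ^ (p + 1 + 1) * β ^ (p + 1)) * (N ^ (p + 1) * N ^ (p + 1 + 1))) := by
    rw [hX]; ring
  rw [e1] at h1
  have h2 := le_of_mul_le_mul_left h1 hX0
  refine le_trans ?_ h2
  have h3 : γ ^ (2 * (p + 1 + 1)) ≤ α ^ (p + 1 + 1) * β ^ (p + 1) := by
    calc γ ^ (2 * (p + 1 + 1)) = γ ^ (p + 1 + 1) * γ ^ (p + 1) * γ := by ring
      _ ≤ γ ^ (p + 1 + 1) * γ ^ (p + 1) * 1 := by gcongr
      _ ≤ _ := by rw [mul_one]; gcongr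
  calc _ = Q ^ (p + 1 + 1) * (N ^ (p + 1) * N ^ (p + 1 + 1)) := by rw [mul_pow]; ring
    _ ≤ (s ^ (p + 1) * γ ^ 2) ^ (p + 1 + 1) * (N ^ (p + 1) * N ^ (p + 1 + 1)) := by gcongr
    _ = (s ^ ((p + 1) * (p + 1 + 1)) * γ ^ (2 * (p + 1 + 1))) *
        (N ^ (p + 1) * N ^ (p + 1 + 1)) := by rw [mul_pow, ← pow_mul, ← pow_mul]
    _ ≤ _ := by gcongr

set_option maxHeartbeats 4000000 in
lemma main_generic (D : Finset G) (ε τ γ : ℝ) (r : ℕ) (hε : 0 < ε) (hε2 : ε < 1 / 2)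
    (hτ0 : 0 < τ) (hτ2 : τ < 1 / 2) (hγ : 0 < γ) (hγ2 : γ < 1 / 2)
    (hτ : (D.card : ℝ) = τ * Fintype.card G)
    (hr : 10 ^ 12 * ε⁻¹ ^ 7 * Real.log (2 / τ) * Real.log (2 / γ) ^ 7 ≤ (r : ℝ))
    (hsp : ∀ (V : Submodule (ZMod 2) G) (w : G),
      Module.finrank (ZMod 2) G ≤ Module.finrank (ZMod 2) V + r →
      (∑ v : G, if v ∈ V then (if w + v ∈ D then (1 : ℝ) else 0) else 0) / (Nat.card V : ℝ) ≤
        (1 + ε / 8) * τ)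
    (f g : G → ℝ) (hf0 : ∀ x, 0 ≤ f x) (hf1 : ∀ x, f x ≤ 1)
    (hg0 : ∀ x, 0 ≤ g x) (hg1 : ∀ x, g x ≤ 1) :
    (∑ x, ∑ y, f x * g y * (if x + y ∈ D then (1 : ℝ) else 0)) /
      ((Fintype.card G : ℝ) * (Fintype.card G : ℝ)) ≤
      (1 + ε) * τ * ((∑ x, f x) / (Fintype.card G : ℝ)) *
        ((∑ y, g y) / (Fintype.card G : ℝ)) + γ := by
  by_contra hcon
  push Not at hcon
  set N : ℝ := (Fintype.card G : ℝ) with hNdef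
  have hN : 0 < N := by
    rw [hNdef]; exact_mod_cast Fintype.card_pos_iff.2 ⟨0⟩
  set T := ∑ x, ∑ y, f x * g y * (if x + y ∈ D then (1 : ℝ) else 0) with hT
  set α := (∑ x, f x) / N with hα
  set β := (∑ x, g x) / N with hβ
  have hfα : ∑ x, f x = N * α := by rw [hα]; field_simp
  have hgβ : ∑ x, g x = N * β := by rw [hβ]; field_simp
  have hα0 : 0 ≤ α := div_nonneg (sum_nonneg fun x _ => hf0 x) hN.le
  have hβ0 : 0 ≤ β := div_nonneg (sum_nonneg fun x _ => hg0 x) hN.le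
  have hI : ∀ x y, (0 : ℝ) ≤ (if x + y ∈ D then (1 : ℝ) else 0) ∧
      (if x + y ∈ D then (1 : ℝ) else 0) ≤ 1 := by
    intro x y; split_ifs <;> norm_num
  have hTτ : T ≤ N * N * τ := by
    calc T ≤ ∑ x : G, ∑ y : G, (if x + y ∈ D then (1 : ℝ) else 0) := by
          apply sum_le_sum; intro x _; apply sum_le_sum; intro y _
          apply mul_le_of_le_one_left (hI x y).1
          exact mul_le_one₀ (hf1 x) (hg0 y) (hg1 y)
      _ = ∑ x : G, (D.card : ℝ) := by
          apply sum_congr rfl; intro x _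
          have := Equiv.sum_comp (Equiv.addLeft x) (fun z => if z ∈ D then (1 : ℝ) else 0)
          simp only [Equiv.coe_addLeft] at this
          refine Eq.trans (b := ∑ z, (if z ∈ D then (1 : ℝ) else 0)) ?_ (by simp)
          rw [← this]
          apply sum_congr rfl; intro z _
          by_cases h : x + z ∈ D <;> simp only [h, if_true, if_false]
      _ = _ := by rw [sum_const, card_univ, nsmul_eq_mul, hτ]; ring
  have hTα : T ≤ N * N * α := by
    calc T ≤ ∑ x : G, ∑ y : G, f x := by
          apply sum_le_sum; intro x _; apply sum_le_sum; intro y _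
          rw [mul_assoc]
          apply mul_le_of_le_one_right (hf0 x)
          exact mul_le_one₀ (hg1 y) (hI x y).1 (hI x y).2
      _ = _ := by
          simp only [sum_const, card_univ, nsmul_eq_mul]
          rw [← mul_sum, hfα]; ring
  have hTβ : T ≤ N * N * β := by
    calc T ≤ ∑ x : G, ∑ y : G, g y := by
          apply sum_le_sum; intro x _; apply sum_le_sum; intro y _
          rw [mul_comm (f x), mul_assoc]
          apply mul_le_of_le_one_right (hg0 y)
          exact mul_le_one₀ (hf1 x) (hI x y).1 (hI x y).2
      _ = _ := by
          simp only [sum_const, card_univ, nsmul_eq_mul]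
          rw [hgβ]; ring
  rw [lt_div_iff₀ (by positivity)] at hcon
  have hNN : 0 < N * N := by positivity
  have hp0 : 0 ≤ (1 + ε) * τ * α * β := by positivity
  have hb : ∀ b, T ≤ N * N * b → γ < b := by
    intro b hb
    have : (N * N) * ((1 + ε) * τ * α * β + γ) < (N * N) * b := by linarith
    have := lt_of_mul_lt_mul_left this hNN.le
    linarith
  have hγτ := hb τ hTτ
  have hγα := hb α hTα
  have hγβ := hb β hTβ
  have hα1 : α ≤ 1 := by
    rw [hα, div_le_one hN]
    calc _ ≤ ∑ x : G, (1 : ℝ) := sum_le_sum fun x _ => hf1 x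
      _ = _ := by simp [hNdef]
  have hβ1 : β ≤ 1 := by
    rw [hβ, div_le_one hN]
    calc _ ≤ ∑ x : G, (1 : ℝ) := sum_le_sum fun x _ => hg1 x
      _ = _ := by simp [hNdef]
  set e := max ε γ with he
  have hεe : ε ≤ e := le_max_left _ _
  have hγe : γ ≤ e := le_max_right _ _
  have he0 : 0 < e := lt_of_lt_of_le hε hεe
  have he2 : e < 1 / 2 := max_lt hε2 hγ2
  have heT : (1 + e) * τ * α * β * N ^ 2 ≤ T := by
    have h1 : τ * α * β ≤ 1 := by
      have : τ * α ≤ 1 := mul_le_one₀ (by linarith) hα0 hα1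
      exact mul_le_one₀ this hβ0 hβ1
    have h0 : 0 ≤ τ * α * β := by positivity
    have h2 : (1 + e) * τ * α * β ≤ (1 + ε) * τ * α * β + γ := by
      have : e ≤ ε + γ := max_le (by linarith) (by linarith)
      have h3 : (e - ε) * (τ * α * β) ≤ γ * (τ * α * β) :=
        mul_le_mul_of_nonneg_right (by linarith) h0
      nlinarith
    calc _ = ((1 + e) * τ * α * β) * (N * N) := by ring
      _ ≤ _ := (mul_le_mul_of_nonneg_right h2 hNN.le).trans hcon.le
  obtain ⟨k, m, M, lam, hk, hm, hlam, c1, c2, c3, c4, c5, c6⟩ :=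
    params e γ τ he0 he2 hγ hγe hγτ.le hτ2
  set Q := ((1 + e / 2) * τ) ^ k with hQ
  have hQ0 : 0 < Q := by positivity
  have hZ : N ^ k * (Q * N) ^ (k + 1) ≤ ∑ y : Fin k → G, ((Zset D y).card : ℝ) ^ (k + 1) := by
    obtain ⟨p, rfl⟩ : ∃ p, k = p + 1 := ⟨k - 1, by omega⟩
    exact lowerZ D f g hf0 hf1 hg0 hg1 p N α β ((1 + e) * τ) γ Q hN hγ (by linarith) hγα.le
      hγβ.le (by positivity) hQ0.le hfα hgβ heT c1
  have hL1 : 1 ≤ Real.log (2 / γ) := by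
    have hexp1 := Real.exp_one_lt_d9
    rw [Real.le_log_iff_exp_le (by positivity), le_div_iff₀ hγ]
    nlinarith
  have hLt0 : 0 ≤ Real.log (2 / τ) := Real.log_nonneg (by
    rw [le_div_iff₀ hτ0]; linarith)
  have hr' : 8 * (m * (k * Real.log (2 / τ))) ≤ (r : ℝ) := by
    refine c6.trans (le_trans ?_ hr)
    have h1 : e⁻¹ ^ 6 ≤ ε⁻¹ ^ 7 := by
      have h2 : e⁻¹ ≤ ε⁻¹ := inv_anti₀ hε hεe
      have h3 : 1 ≤ ε⁻¹ := by rw [one_le_inv₀ hε]; linarith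
      calc e⁻¹ ^ 6 ≤ ε⁻¹ ^ 6 := by gcongr
        _ ≤ _ := pow_le_pow_right₀ h3 (by norm_num)
    have h4 : Real.log (2 / γ) ^ 6 ≤ Real.log (2 / γ) ^ 7 := pow_le_pow_right₀ hL1 (by norm_num)
    gcongr
  have hfin := combine D k m M r hk hm ((1 + e / 4) * τ) Q (((1 + e / 4) / (1 + e / 2)) ^ k)
    ((1 + e / 8) * τ) (e * τ / 50) lam (k * Real.log (2 / τ)) (by positivity) hQ0 (by positivity)
    (by positivity) hlam (by rw [hQ, ← mul_pow]; congr 1; field_simp) hZ c3 hr'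
    (fun V w hV => (hsp V w hV).trans (by gcongr))
    (by rw [hτ]; linarith only [mul_le_mul_of_nonneg_right c4 hN.le])
  have h9 : (1 + e / 4) * τ * (1 - e / 50 - e / 50) ≤ (1 + e / 8) * τ + e * τ / 50 := by
    refine le_trans ?_ hfin
    apply mul_le_mul_of_nonneg_left _ (by positivity)
    linarith
  have h10 : (1 + e / 4) * (1 - e / 50 - e / 50) ≤ (1 + e / 8) + e / 50 := by
    have : τ * ((1 + e / 4) * (1 - e / 50 - e / 50)) ≤ τ * ((1 + e / 8) + e / 50) := by linarith
    exact le_of_mul_le_mul_left this hτ0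
  nlinarith only [h10, he0, he2]

end Helpers

/-- Lemma 5.4 of the paper: if `D ⊆ W` is algebraically spread, then
`T = {(x, y) : x + y ∈ D}` is combinatorially spread. -/
theorem alg_spread_implies_comb_spread :
    ∃ C : ℝ, 0 < C ∧
      ∀ (n : ℕ) (W : Submodule (ZMod 2) (Fin n → ZMod 2))
        (D : Set (Fin n → ZMod 2)) (ε τ γ : ℝ) (r : ℕ),
        ε ∈ Set.Ioo (0 : ℝ) (1 / 2) → τ ∈ Set.Ioo (0 : ℝ) (1 / 2) →
        γ ∈ Set.Ioo (0 : ℝ) (1 / 2) →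
        D.Nonempty → D ⊆ (W : Set (Fin n → ZMod 2)) →
        τ = (Nat.card ↥D : ℝ) / (Nat.card ↥W : ℝ) →
        C * ε⁻¹ ^ 7 * Real.log (2 / τ) * Real.log (2 / γ) ^ 7 ≤ (r : ℝ) →
        AlgebraicallySpread n W D r (ε / 8) →
        ∀ f g : ↥W → ℝ,
          (∀ x, f x ∈ Set.Icc (0 : ℝ) 1) → (∀ y, g y ∈ Set.Icc (0 : ℝ) 1) →
          (∑ x : ↥W, ∑ y : ↥W, f x * g y *
              (if ((x : Fin n → ZMod 2) + (y : Fin n → ZMod 2)) ∈ D then (1 : ℝ) else 0)) /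
              ((Nat.card ↥W : ℝ) * (Nat.card ↥W : ℝ)) ≤
            (1 + ε) * τ * ((∑ x : ↥W, f x) / (Nat.card ↥W : ℝ)) *
                ((∑ y : ↥W, g y) / (Nat.card ↥W : ℝ)) + γ := by
  refine ⟨10 ^ 12, by positivity, ?_⟩
  intro n W D ε τ γ r hε hτ hγ hDne hDW hτD hr hsp f g hf hg
  have hW0 : (0 : ℝ) < (Nat.card ↥W : ℝ) := by exact_mod_cast Nat.card_pos
  set D' : Finset ↥W := Finset.univ.filter (fun x => (x : Fin n → ZMod 2) ∈ D) with hD'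
  have hmem : ∀ x : ↥W, x ∈ D' ↔ (x : Fin n → ZMod 2) ∈ D := by
    intro x; simp [hD']
  have hcard : (D'.card : ℝ) = Nat.card ↥D := by
    congr 1
    rw [hD', ← Fintype.card_subtype, ← Nat.card_eq_fintype_card]
    apply Nat.card_congr
    exact ⟨fun x => ⟨x.1, x.2⟩, fun x => ⟨⟨x.1, hDW x.2⟩, x.2⟩, fun _ => rfl, fun _ => rfl⟩
  have hcW : (Fintype.card ↥W : ℝ) = Nat.card ↥W := by rw [Nat.card_eq_fintype_card]
  have hτ' : (D'.card : ℝ) = τ * Fintype.card ↥W := by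
    rw [hcard, hcW, hτD]; field_simp
  have key := main_generic D' ε τ γ r hε.1 hε.2 hτ.1 hτ.2 hγ.1 hγ.2 hτ' hr ?_ f g
    (fun x => (hf x).1) (fun x => (hf x).2) (fun x => (hg x).1) (fun x => (hg x).2)
  · rw [hcW] at key
    convert key using 10
    rw [hmem]; rfl
  · intro V w hV
    set V' := V.map W.subtype with hV'
    have hinj : Function.Injective W.subtype := W.injective_subtype
    have hfr : Module.finrank (ZMod 2) V' = Module.finrank (ZMod 2) V :=
      (Submodule.equivMapOfInjective _ hinj V).finrank_eq.symm
    have hcV : Nat.card V' = Nat.card V := by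
      exact (Nat.card_congr (Submodule.equivMapOfInjective _ hinj V).toEquiv).symm
    have h := hsp V' (w : Fin n → ZMod 2) ?_ (by rw [hfr]; exact hV)
    · rw [← hτD, hcV] at h
      refine le_trans (le_of_eq ?_) h
      congr 1
      trans (∑ v : ↥W, if (v ∈ V ∧ w + v ∈ D') then (1 : ℝ) else 0)
      · apply Finset.sum_congr rfl
        intro v _
        by_cases h1 : v ∈ V <;> by_cases h2 : w + v ∈ D' <;>
          simp only [h1, h2, if_true, if_false, and_self, and_true, and_false]
      rw [← Finset.sum_filter, Finset.sum_const, nsmul_eq_mul, mul_one]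
      congr 1
      rw [← Fintype.card_subtype, ← Nat.card_eq_fintype_card]
      apply Nat.card_congr
      refine Equiv.ofBijective (fun v => ⟨(w : Fin n → ZMod 2) + ((v : ↥W) : Fin n → ZMod 2),
        (hmem _).1 v.2.2, ⟨_, ⟨v.1, v.2.1, rfl⟩, rfl⟩⟩) ⟨?_, ?_⟩
      · intro a b hab
        have := congrArg Subtype.val hab
        simp only [add_right_inj] at this
        exact Subtype.ext (Subtype.ext this)
      · rintro ⟨z, hz, a, ⟨v, hv, rfl⟩, rfl⟩
        refine ⟨⟨v, hv, (hmem _).2 hz⟩, rfl⟩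
    · rintro _ ⟨a, ⟨v, hv, rfl⟩, rfl⟩
      exact W.add_mem w.2 v.2
end
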